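/- The only solutions in positive integers x, y with gcd(x,y)=1 and nonnegative integers a, b of x^2 + 5^a·11^b = y^3 with a, b, x all odd are (a,b,x,y) = (1,1,3,4), (1,1,419,56), (3,1,37,14), (5,5,36599,1226). -/

import Mathlib

/-- `p` holds for all natural numbers below `n`. -/
def allBelow (p : ℕ → Bool) : ℕ → Bool
  | 0 => true
  | n + 1 => p n && allBelow p n

theorem allBelow_spec {p : ℕ → Bool} {n : ℕ} (h : allBelow p n = true) : ∀ m < n, p m = true := by
  induction n with
  | zero => exact fun m hm => absurd hm m.not_lt_zero
  | succ n ih =>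
    rw [allBelow, Bool.and_eq_true] at h
    intro m hm
    rcases Nat.lt_succ_iff_lt_or_eq.1 hm with hm | rfl
    · exact ih h.2 m hm
    · exact h.1

/-- `n` passes the test for a square modulo `64`, `63`, `65`, `11`, `17`, `19`: the binary digits
of each constant encode the set of quadratic residues. -/
def mayBeSquare (n : ℕ) : Bool :=
  Nat.testBit 144680414395695635 (n % 64) && (Nat.testBit 288872697407275667 (n % 63) &&
  (Nat.testBit 20863489977805260307 (n % 65) && (Nat.testBit 571 (n % 11) &&
  (Nat.testBit 107287 (n % 17) && Nat.testBit 199411 (n % 19)))))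

theorem mayBeSquare_sq (y : ℕ) : mayBeSquare (y ^ 2) = true := by
  have key : ∀ q M : ℕ, 0 < q → (∀ r < q, Nat.testBit M (r ^ 2 % q) = true) →
      Nat.testBit M (y ^ 2 % q) = true := fun q M hq h => by
    rw [Nat.pow_mod]
    exact h _ (Nat.mod_lt _ hq)
  simp only [mayBeSquare, Bool.and_eq_true]
  refine ⟨key _ _ (by norm_num) ?_, key _ _ (by norm_num) ?_, key _ _ (by norm_num) ?_,
    key _ _ (by norm_num) ?_, key _ _ (by norm_num) ?_, key _ _ (by norm_num) ?_⟩ <;>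
  decide +kernel

/-- Every `(c, e)` with `c` a multiple of `q`, `c < q * B`, `e < M` and `c ^ 3 - D * e ^ 6` a square
satisfies `R`. -/
def searchPoints (R : ℕ → ℕ → Bool) (D q M B : ℕ) : Bool :=
  allBelow (fun e => allBelow (fun A => !(Nat.ble (D * e ^ 6) ((q * A) ^ 3) &&
    (mayBeSquare ((q * A) ^ 3 - D * e ^ 6) && (decide (0 < e) && (decide (Nat.gcd (q * A) e = 1) &&
    decide (Nat.sqrt ((q * A) ^ 3 - D * e ^ 6) ^ 2 = (q * A) ^ 3 - D * e ^ 6))))) ||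
    R (q * A) e) B) M

theorem searchPoints_spec {R : ℕ → ℕ → Bool} {D q M B : ℕ} (h : searchPoints R D q M B = true) :
    ∀ e < M, ∀ A < B, (0 < e ∧ D * e ^ 6 ≤ (q * A) ^ 3 ∧
      Nat.sqrt ((q * A) ^ 3 - D * e ^ 6) ^ 2 = (q * A) ^ 3 - D * e ^ 6 ∧ Nat.gcd (q * A) e = 1) →
      R (q * A) e = true := by
  intro e he A hA ⟨h1, h2, h3, h4⟩
  have := allBelow_spec (allBelow_spec h e he) A hA
  have hs := mayBeSquare_sq (Nat.sqrt ((q * A) ^ 3 - D * e ^ 6))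
  rw [h3] at hs
  simpa [h1, Nat.ble_eq_true_of_le h2, h3, h4, hs] using this

/-- If `U√A + V√B` has norm `W ^ 3` and `s√A + t√B` lies in the ideal above `W`, then the cube of
the latter is a multiple of the former. -/
theorem exists_cube_quotient {A B U V W s t j c : ℤ} (hW : W ≠ 0)
    (hN : A * U ^ 2 - B * V ^ 2 = W ^ 3) (hcop : IsCoprime W V) (hj : s * V - t * U = W * j)
    (hc : A * s ^ 2 - B * t ^ 2 = c * W) :
    ∃ x y : ℤ, x ^ 2 - A * B * y ^ 2 = c ^ 3 ∧
      s * (A * s ^ 2 + 3 * B * t ^ 2) = U * x + B * V * y ∧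
      t * (3 * A * s ^ 2 + B * t ^ 2) = V * x + A * U * y := by
  have hW3 : W ^ 3 ≠ 0 := pow_ne_zero 3 hW
  have hsV : s * V = t * U + W * j := by linarith
  have hcop3 : IsCoprime (W ^ 3) (V ^ 3) := hcop.pow
  set S := s * (A * s ^ 2 + 3 * B * t ^ 2) with hS
  set T := t * (3 * A * s ^ 2 + B * t ^ 2) with hT
  have hVS : V ^ 3 * S = (t * U + W * j) * (A * (t * U + W * j) ^ 2 + 3 * B * (t * V) ^ 2) := by
    rw [hS, ← hsV]; ring
  have hVT : V ^ 3 * T = (t * V) * (3 * A * (t * U + W * j) ^ 2 + B * (t * V) ^ 2) := by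
    rw [hT, ← hsV]; ring
  obtain ⟨x, hx⟩ : W ^ 3 ∣ A * S * U - B * T * V := by
    apply hcop3.dvd_of_dvd_mul_left
    refine ⟨t ^ 3 * (A * U ^ 2 + B * V ^ 2) + 3 * t ^ 2 * W * j * A * U + 3 * t * A * W ^ 2 * j ^ 2
      + j ^ 3 * A ^ 2 * U, ?_⟩
    rw [show V ^ 3 * (A * S * U - B * T * V) = A * U * (V ^ 3 * S) - B * V * (V ^ 3 * T) by ring,
      hVS, hVT]
    linear_combination (t ^ 3 * (A * U ^ 2 + B * V ^ 2) + 3 * t ^ 2 * W * j * A * U +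
      3 * t * A * W ^ 2 * j ^ 2) * hN
  obtain ⟨y, hy⟩ : W ^ 3 ∣ T * U - S * V := by
    apply hcop3.dvd_of_dvd_mul_left
    refine ⟨2 * t ^ 3 * U * V + 3 * t ^ 2 * W * j * V - j ^ 3 * A * V, ?_⟩
    rw [show V ^ 3 * (T * U - S * V) = U * (V ^ 3 * T) - V * (V ^ 3 * S) by ring, hVS, hVT]
    linear_combination (2 * t ^ 3 * U * V + 3 * t ^ 2 * W * j * V) * hN
  refine ⟨x, y, ?_, ?_, ?_⟩
  · apply mul_left_cancel₀ (mul_ne_zero hW3 hW3)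
    have h1 : A * S ^ 2 - B * T ^ 2 = (c * W) ^ 3 := by rw [hS, hT, ← hc]; ring
    calc W ^ 3 * W ^ 3 * (x ^ 2 - A * B * y ^ 2)
        = (W ^ 3 * x) ^ 2 - A * B * (W ^ 3 * y) ^ 2 := by ring
      _ = (A * S ^ 2 - B * T ^ 2) * (A * U ^ 2 - B * V ^ 2) := by rw [← hx, ← hy]; ring
      _ = W ^ 3 * W ^ 3 * c ^ 3 := by rw [h1, hN]; ring
  · apply mul_left_cancel₀ hW3
    linear_combination U * hx + B * V * hy - S * hN
  · apply mul_left_cancel₀ hW3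
    linear_combination V * hx + A * U * hy - T * hN

/-- Reduction of the binary quadratic form attached to the ideal above `W`. -/
theorem exists_reduced_basis {A B U V W : ℤ}
    (hN : A * U ^ 2 - B * V ^ 2 = W ^ 3) (hcop : IsCoprime W V)
    (hAB : ∀ b : ℤ, b ^ 2 ≠ A * B) :
    ∃ s t s' t' j j' c b c' : ℤ, s * V - t * U = W * j ∧ s' * V - t' * U = W * j' ∧
      A * s ^ 2 - B * t ^ 2 = c * W ∧ A * s * s' - B * t * t' = b * W ∧
      A * s' ^ 2 - B * t' ^ 2 = c' * W ∧ b ^ 2 - c * c' = A * B ∧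
      2 * |b| ≤ |c| ∧ |c| ≤ |c'| := by
  have descent : ∀ n : ℕ, ∀ s t s' t' j j' c b c' : ℤ, c.natAbs = n →
      s * V - t * U = W * j → s' * V - t' * U = W * j' →
      A * s ^ 2 - B * t ^ 2 = c * W → A * s * s' - B * t * t' = b * W →
      A * s' ^ 2 - B * t' ^ 2 = c' * W → b ^ 2 - c * c' = A * B →
      ∃ s t s' t' j j' c b c' : ℤ, s * V - t * U = W * j ∧ s' * V - t' * U = W * j' ∧
      A * s ^ 2 - B * t ^ 2 = c * W ∧ A * s * s' - B * t * t' = b * W ∧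
      A * s' ^ 2 - B * t' ^ 2 = c' * W ∧ b ^ 2 - c * c' = A * B ∧
      2 * |b| ≤ |c| ∧ |c| ≤ |c'| := by
    intro n
    induction n using Nat.strong_induction_on with
    | _ n ih =>
      intro s t s' t' j j' c b c' hn h1 h2 h3 h4 h5 h6
      have hc0 : c ≠ 0 := by
        rintro rfl
        exact hAB b (by linarith)
      set k := round ((b : ℚ) / c) with hk
      have hb : 2 * |b - k * c| ≤ |c| := by
        have h := abs_sub_round ((b : ℚ) / c)
        rw [← hk] at h
        have hcq : (c : ℚ) ≠ 0 := by exact_mod_cast hc0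
        have e : (b : ℚ) / c - k = (b - k * c) / c := by field_simp
        rw [e, abs_div, div_le_iff₀ (abs_pos.2 hcq)] at h
        have h' : 2 * |(b : ℚ) - k * c| ≤ |(c : ℚ)| := by linarith
        exact_mod_cast h'
      have g2 : (s' - k * s) * V - (t' - k * t) * U = W * (j' - k * j) := by
        linear_combination h2 - k * h1
      have g4 : A * s * (s' - k * s) - B * t * (t' - k * t) = (b - k * c) * W := by
        linear_combination h4 - k * h3
      have g5 : A * (s' - k * s) ^ 2 - B * (t' - k * t) ^ 2 = (c' - 2 * k * b + k ^ 2 * c) * W := by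
        linear_combination h5 - 2 * k * h4 + k ^ 2 * h3
      have g6 : (b - k * c) ^ 2 - c * (c' - 2 * k * b + k ^ 2 * c) = A * B := by
        linear_combination h6
      by_cases hle : |c| ≤ |c' - 2 * k * b + k ^ 2 * c|
      · exact ⟨s, t, _, _, j, _, c, _, _, h1, g2, h3, g4, g5, g6, hb, hle⟩
      · refine ih (c' - 2 * k * b + k ^ 2 * c).natAbs ?_ (s' - k * s) (t' - k * t) s t
          (j' - k * j) j _ (b - k * c) c rfl g2 h1 g5 ?_ h3 ?_
        · have hlt := not_le.1 hle
          rw [Int.abs_eq_natAbs, Int.abs_eq_natAbs] at hlt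
          omega
        · linear_combination g4
        · linear_combination g6
  obtain ⟨p, q, hpq⟩ := hcop
  have hdiv : W ∣ A * (U * q) ^ 2 - B := by
    refine ⟨W ^ 2 * q ^ 2 - B * p * (1 + q * V), ?_⟩
    linear_combination q ^ 2 * hN + B * (1 + q * V) * hpq
  obtain ⟨c', hc'⟩ := hdiv
  refine descent _ W 0 (U * q) 1 V (-(U * p)) (A * W) (A * (U * q)) c' rfl (by ring) ?_
    (by ring) (by ring) ?_ ?_
  · linear_combination U * hpq
  · linear_combination hc'
  · linear_combination A * hc'

theorem sq_add_fiftyfive_eq_cube {x y c : ℤ} (h0 : 0 < c) (h8 : c ≤ 8)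
    (h : x ^ 2 + 55 * y ^ 2 = c ^ 3) :
    (c = 1 ∧ y = 0 ∧ (x = 1 ∨ x = -1)) ∨ (c = 4 ∧ y = 0 ∧ (x = 8 ∨ x = -8)) ∨
      (c = 4 ∧ (x = 3 ∨ x = -3) ∧ (y = 1 ∨ y = -1)) := by
  have hc3 : c ^ 3 ≤ 8 ^ 3 := by gcongr
  have hy1 : y ≤ 3 := by nlinarith [sq_nonneg x]
  have hy2 : -3 ≤ y := by nlinarith [sq_nonneg x]
  have hx1 : x ≤ 22 := by nlinarith [sq_nonneg y]
  have hx2 : -22 ≤ x := by nlinarith [sq_nonneg y]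
  have key : ∀ c ∈ Finset.Icc (1 : ℤ) 8, ∀ y ∈ Finset.Icc (-3 : ℤ) 3,
      ∀ x ∈ Finset.Icc (-22 : ℤ) 22, x ^ 2 + 55 * y ^ 2 = c ^ 3 →
      (c = 1 ∧ y = 0 ∧ (x = 1 ∨ x = -1)) ∨ (c = 4 ∧ y = 0 ∧ (x = 8 ∨ x = -8)) ∨
      (c = 4 ∧ (x = 3 ∨ x = -3) ∧ (y = 1 ∨ y = -1)) := by decide +kernel
  exact key c (by simp; omega) y (by simp; omega) x (by simp; omega) h

theorem definite_quotient {U V W : ℤ} (hW : 0 < W) (hN : U ^ 2 + 55 * V ^ 2 = W ^ 3)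
    (hcop : IsCoprime W V) :
    ∃ s t x y : ℤ, s * (s ^ 2 - 165 * t ^ 2) = U * x - 55 * V * y ∧
      t * (3 * s ^ 2 - 55 * t ^ 2) = V * x + U * y ∧
      ((y = 0 ∧ (x = 1 ∨ x = -1)) ∨ (y = 0 ∧ (x = 8 ∨ x = -8)) ∨
      ((x = 3 ∨ x = -3) ∧ (y = 1 ∨ y = -1))) := by
  have hN' : 1 * U ^ 2 - (-55) * V ^ 2 = W ^ 3 := by linarith
  obtain ⟨s, t, s', t', j, j', c, b, c', h1, h2, h3, h4, h5, h6, h7, h8⟩ :=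
    exists_reduced_basis hN' hcop (fun b => by nlinarith [sq_nonneg b])
  obtain ⟨x, y, e1, e2, e3⟩ := exists_cube_quotient hW.ne' hN' hcop h1 h3
  have hc0 : 0 ≤ c := by
    have : 0 ≤ c * W := by rw [← h3]; nlinarith [sq_nonneg s, sq_nonneg t]
    exact nonneg_of_mul_nonneg_left this hW
  have hc0' : 0 ≤ c' := by
    have : 0 ≤ c' * W := by rw [← h5]; nlinarith [sq_nonneg s', sq_nonneg t']
    exact nonneg_of_mul_nonneg_left this hW
  have hcne : c ≠ 0 := by
    rintro rfl
    nlinarith [sq_nonneg b]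
  rw [abs_of_nonneg hc0] at h7 h8
  rw [abs_of_nonneg hc0'] at h8
  have hc8 : c ≤ 8 := by
    have hb : 4 * b ^ 2 ≤ c ^ 2 := by
      have := abs_nonneg b
      nlinarith [sq_abs b]
    nlinarith
  refine ⟨s, t, x, y, by linarith, by linarith, ?_⟩
  have := sq_add_fiftyfive_eq_cube (by omega) hc8 (by linarith : x ^ 2 + 55 * y ^ 2 = c ^ 3)
  tauto

theorem sq_sub_mul_sq_ne_cube {e x y : ℤ}
    (he : e ∈ ({-1, 2, -2, 3, -3, 5, -5, 11, 6, -6} : Finset ℤ)) :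
    x ^ 2 - 165 * y ^ 2 ≠ e ^ 3 := by
  intro h
  have m3 : ∀ x y : ZMod 3, x ^ 2 - 165 * y ^ 2 ≠ 2 := by decide
  have m5 : ∀ x y : ZMod 5, x ^ 2 - 165 * y ^ 2 ≠ 2 ∧ x ^ 2 - 165 * y ^ 2 ≠ 3 := by decide
  have m11 : ∀ x y : ZMod 11, x ^ 2 - 165 * y ^ 2 ≠ 7 := by decide
  have m81 : ∀ x y : ZMod 81, x ^ 2 - 165 * y ^ 2 ≠ 27 := by decide +kernel
  have c3 := congrArg (Int.cast : ℤ → ZMod 3) h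
  have c5 := congrArg (Int.cast : ℤ → ZMod 5) h
  have c11 := congrArg (Int.cast : ℤ → ZMod 11) h
  have c81 := congrArg (Int.cast : ℤ → ZMod 81) h
  simp only [Finset.mem_insert, Finset.mem_singleton] at he
  push_cast at c3 c5 c11 c81
  rcases he with rfl | rfl | rfl | rfl | rfl | rfl | rfl | rfl | rfl | rfl
  · exact m3 _ _ (c3.trans (by decide))
  · exact (m5 _ _).2 (c5.trans (by decide))
  · exact (m5 _ _).1 (c5.trans (by decide))
  · exact m81 _ _ (c81.trans (by decide))
  · exact (m5 _ _).2 (c5.trans (by decide))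
  · exact m3 _ _ (c3.trans (by decide))
  · exact m11 _ _ (c11.trans (by decide))
  · exact m3 _ _ (c3.trans (by decide))
  · exact m11 _ _ (c11.trans (by decide))
  · exact m81 _ _ (c81.trans (by decide))

/-- A reduced form of discriminant `4 * 165` all of whose values have cubes represented by
`x ^ 2 - 165 * y ^ 2` represents `1`. -/
theorem exists_form_eq_one {c b c' : ℤ} (hd : b ^ 2 - c * c' = 165) (h1 : 2 * |b| ≤ |c|)
    (h2 : |c| ≤ |c'|)
    (H : ∀ m n : ℤ, ∃ x y : ℤ, x ^ 2 - 165 * y ^ 2 = (c * m ^ 2 + 2 * b * m * n + c' * n ^ 2) ^ 3) :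
    ∃ m n : ℤ, c * m ^ 2 + 2 * b * m * n + c' * n ^ 2 = 1 := by
  have hc : |c| ≤ 12 := by
    have hcc : |c| * |c'| = |b ^ 2 - 165| := by rw [← abs_mul]; congr 1; linarith
    have hb := abs_nonneg b
    have hc0 := abs_nonneg c
    have hb2 := sq_abs b
    rcases abs_cases (b ^ 2 - 165) with h | h <;> nlinarith
  have hb : |b| ≤ 6 := by linarith
  have hc0 : c ≠ 0 := by
    rintro rfl
    rw [abs_zero] at h1
    have : b = 0 := abs_eq_zero.1 (le_antisymm (by linarith) (abs_nonneg b))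
    subst this
    simp at hd
  have hc' : c' = (b ^ 2 - 165) / c := by
    rw [show b ^ 2 - 165 = c * c' by linarith, Int.mul_ediv_cancel_left _ hc0]
  have hdvd : c ∣ b ^ 2 - 165 := ⟨c', by linarith⟩
  have key : ∀ c ∈ Finset.Icc (-12 : ℤ) 12, ∀ b ∈ Finset.Icc (-6 : ℤ) 6, c ≠ 0 →
      c ∣ b ^ 2 - 165 → 2 * |b| ≤ |c| → ∃ m ∈ Finset.Icc (-7 : ℤ) 7, ∃ n ∈ Finset.Icc (0 : ℤ) 6,
        c * m ^ 2 + 2 * b * m * n + (b ^ 2 - 165) / c * n ^ 2 ∈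
          insert 1 ({-1, 2, -2, 3, -3, 5, -5, 11, 6, -6} : Finset ℤ) := by decide +kernel
  rw [abs_le] at hc hb
  obtain ⟨m, -, n, -, h⟩ := key c (by simp; omega) b (by simp; omega) hc0 hdvd h1
  rw [← hc'] at h
  rcases Finset.mem_insert.1 h with h | h
  · exact ⟨m, n, h⟩
  · obtain ⟨x, y, hxy⟩ := H m n
    exact absurd hxy (sq_sub_mul_sq_ne_cube h)

theorem isFundamental_one_hundred_sixty_five :
    Pell.IsFundamental (Pell.Solution₁.mk 1079 84 (by norm_num) : Pell.Solution₁ (165 : ℤ)) := by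
  refine ⟨by simp, by simp, ?_⟩
  intro s hs
  rw [Pell.Solution₁.x_mk]
  by_contra! hlt
  have hp := s.prop
  have hy : s.y.natAbs < 84 := by
    have : s.y ^ 2 < 84 ^ 2 := by nlinarith
    have := abs_lt_of_sq_lt_sq this (by norm_num)
    rw [Int.abs_eq_natAbs] at this
    omega
  have key : ∀ y < 84, Nat.sqrt (165 * y ^ 2 + 1) ^ 2 = 165 * y ^ 2 + 1 → y = 0 := by
    decide +kernel
  have hx : 165 * s.y.natAbs ^ 2 + 1 = s.x.natAbs ^ 2 := by
    zify
    rw [sq_abs, sq_abs]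
    linarith
  have h0 := key _ hy (by rw [hx, Nat.sqrt_eq'])
  rw [Int.natAbs_eq_zero] at h0
  rw [h0] at hp
  nlinarith

/-- Every unit `x + y√165` of norm one is a cube in `ℚ(√165)`. -/
theorem pell_solution_eq_cube {x y : ℤ} (h : x ^ 2 - 165 * y ^ 2 = 1) :
    ∃ p q : ℚ, p ^ 2 - 165 * q ^ 2 = 1 ∧ (x : ℚ) = p ^ 3 + 495 * p * q ^ 2 ∧
      (y : ℚ) = 3 * p ^ 2 * q + 165 * q ^ 3 := by
  let G : Subgroup (Pell.Solution₁ (165 : ℤ)) :=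
    { carrier := {s | ∃ p q : ℚ, p ^ 2 - 165 * q ^ 2 = 1 ∧ (s.x : ℚ) = p ^ 3 + 495 * p * q ^ 2 ∧
        (s.y : ℚ) = 3 * p ^ 2 * q + 165 * q ^ 3}
      one_mem' := ⟨1, 0, by norm_num, by simp, by simp⟩
      mul_mem' := by
        rintro s t ⟨p, q, h1, h2, h3⟩ ⟨p', q', h1', h2', h3'⟩
        refine ⟨p * p' + 165 * q * q', p * q' + q * p', ?_, ?_, ?_⟩
        · linear_combination (p' ^ 2 - 165 * q' ^ 2) * h1 + h1'
        · rw [Pell.Solution₁.x_mul]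
          push_cast
          rw [h2, h3, h2', h3']
          ring
        · rw [Pell.Solution₁.y_mul]
          push_cast
          rw [h2, h3, h2', h3']
          ring
      inv_mem' := by
        rintro s ⟨p, q, h1, h2, h3⟩
        refine ⟨p, -q, by linear_combination h1, ?_, ?_⟩
        · rw [Pell.Solution₁.x_inv, h2]; ring
        · rw [Pell.Solution₁.y_inv]
          push_cast
          rw [h3]; ring }
  have hgen : Pell.Solution₁.mk 1079 84 (by norm_num) ∈ G :=
    ⟨13 / 2, 1 / 2, by norm_num, by norm_num, by norm_num⟩
  obtain ⟨n, hn⟩ := isFundamental_one_hundred_sixty_five.eq_zpow_or_neg_zpow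
    (Pell.Solution₁.mk x y h)
  have hpow := G.zpow_mem hgen n
  rcases hn with hn | hn
  · rw [← hn] at hpow
    simpa [G] using hpow
  · obtain ⟨p, q, h1, h2, h3⟩ := hpow
    have hx := congrArg Pell.Solution₁.x hn
    have hy := congrArg Pell.Solution₁.y hn
    rw [Pell.Solution₁.x_mk, Pell.Solution₁.x_neg] at hx
    rw [Pell.Solution₁.y_mk, Pell.Solution₁.y_neg] at hy
    refine ⟨-p, -q, by linear_combination h1, ?_, ?_⟩
    · rw [hx]; push_cast; rw [h2]; ring
    · rw [hy]; push_cast; rw [h3]; ring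

theorem indefinite_cube {A B U V W : ℤ} (hAB : A * B = 165) (hW : W ≠ 0)
    (hN : A * U ^ 2 - B * V ^ 2 = W ^ 3) (hcop : IsCoprime W V) :
    ∃ e f : ℚ, (U : ℚ) = e * (A * e ^ 2 + 3 * B * f ^ 2) ∧
      (V : ℚ) = f * (3 * A * e ^ 2 + B * f ^ 2) ∧ (W : ℚ) = A * e ^ 2 - B * f ^ 2 := by
  obtain ⟨s, t, s', t', j, j', c, b, c', h1, h2, h3, h4, h5, h6, h7, h8⟩ :=
    exists_reduced_basis hN hcop (fun b hb => by
      rw [hAB] at hb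
      have h1 : b < 13 := by nlinarith
      have h2 : -13 < b := by nlinarith
      interval_cases b <;> omega)
  have lin : ∀ m n : ℤ, (m * s + n * s') * V - (m * t + n * t') * U = W * (m * j + n * j') := by
    intro m n
    linear_combination m * h1 + n * h2
  have val : ∀ m n : ℤ, A * (m * s + n * s') ^ 2 - B * (m * t + n * t') ^ 2 =
      (c * m ^ 2 + 2 * b * m * n + c' * n ^ 2) * W := by
    intro m n
    linear_combination m ^ 2 * h3 + 2 * m * n * h4 + n ^ 2 * h5
  obtain ⟨m, n, hmn⟩ := exists_form_eq_one (h6.trans hAB) h7 h8 (fun m n => by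
    obtain ⟨x, y, hxy, -⟩ := exists_cube_quotient hW hN hcop (lin m n) (val m n)
    exact ⟨x, y, by rw [← hxy, hAB]⟩)
  obtain ⟨x, y, hxy, hS, hT⟩ := exists_cube_quotient hW hN hcop (lin m n) (val m n)
  have hval := val m n
  rw [hmn] at hxy hval
  generalize m * s + n * s' = S at *
  generalize m * t + n * t' = T at *
  obtain ⟨p, q, hpq, hx, hy⟩ := pell_solution_eq_cube (by rw [← hAB, hxy]; norm_num)
  have hABq : (A : ℚ) * B = 165 := by exact_mod_cast hAB
  have hSq : (S : ℚ) * (A * S ^ 2 + 3 * B * T ^ 2) = U * x + B * V * y := by exact_mod_cast hS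
  have hTq : (T : ℚ) * (3 * A * S ^ 2 + B * T ^ 2) = V * x + A * U * y := by exact_mod_cast hT
  have hvq : (A : ℚ) * S ^ 2 - B * T ^ 2 = 1 * W := by exact_mod_cast hval
  have hxyq : (x : ℚ) ^ 2 - A * B * y ^ 2 = 1 := by exact_mod_cast hxy
  rw [← hABq] at hpq
  have hx' : (x : ℚ) = p ^ 3 + 3 * (A * B) * p * q ^ 2 := by rw [hx, hABq]; ring
  have hy' : (y : ℚ) = 3 * p ^ 2 * q + A * B * q ^ 3 := by rw [hy, hABq]
  refine ⟨S * p - B * T * q, T * p - A * S * q, ?_, ?_, ?_⟩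
  · have : (U : ℚ) = x * (S * (A * S ^ 2 + 3 * B * T ^ 2)) -
        B * y * (T * (3 * A * S ^ 2 + B * T ^ 2)) := by
      rw [hSq, hTq]; linear_combination -U * hxyq
    rw [this, hx', hy']
    ring
  · have : (V : ℚ) = x * (T * (3 * A * S ^ 2 + B * T ^ 2)) -
        A * y * (S * (A * S ^ 2 + 3 * B * T ^ 2)) := by
      rw [hSq, hTq]; linear_combination -V * hxyq
    rw [this, hx', hy']
    ring
  · linear_combination -hvq - (A * S ^ 2 - B * T ^ 2 : ℚ) * hpq

theorem exists_common_denominator (u v : ℚ) :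
    ∃ U V w : ℤ, 0 < w ∧ u = U / w ∧ v = V / w ∧ ∀ p : ℤ, Prime p → p ∣ U → p ∣ V → ¬ p ∣ w := by
  have hex : ∃ n : ℕ, ∃ U V : ℤ, 0 < n ∧ u = U / n ∧ v = V / n := by
    refine ⟨u.den * v.den, u.num * v.den, v.num * u.den, by positivity, ?_, ?_⟩
    · push_cast
      rw [mul_div_mul_right _ _ (by exact_mod_cast v.den_ne_zero), Rat.num_div_den]
    · push_cast
      rw [mul_comm (u.den : ℚ), mul_div_mul_right _ _ (by exact_mod_cast u.den_ne_zero),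
        Rat.num_div_den]
  classical
  obtain ⟨U, V, hn, hu, hv⟩ := Nat.find_spec hex
  refine ⟨U, V, Nat.find hex, by exact_mod_cast hn, by exact_mod_cast hu, by exact_mod_cast hv, ?_⟩
  rintro p hp ⟨U', rfl⟩ ⟨V', rfl⟩ ⟨w, hw⟩
  have hnz : (Nat.find hex : ℤ) ≠ 0 := by exact_mod_cast hn.ne'
  have hw0 : w ≠ 0 := by
    rintro rfl
    exact hnz (by rw [hw, mul_zero])
  have hpq : (p : ℚ) ≠ 0 := by exact_mod_cast hp.ne_zero
  have hwq : (w : ℚ) ≠ 0 := by exact_mod_cast hw0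
  have hwc : (Nat.find hex : ℚ) = p * w := by exact_mod_cast hw
  have habs : (w.natAbs : ℚ) = w ∨ (w.natAbs : ℚ) = -w := by
    rw [Nat.cast_natAbs, Int.cast_abs]
    exact abs_choice _
  have hlt : w.natAbs < Nat.find hex := by
    have h1 : Nat.find hex = p.natAbs * w.natAbs := by
      rw [← Int.natAbs_mul, ← hw, Int.natAbs_natCast]
    have h2 : 2 ≤ p.natAbs := (Int.prime_iff_natAbs_prime.1 hp).two_le
    have h3 : 0 < w.natAbs := Int.natAbs_pos.2 hw0
    nlinarith
  refine Nat.find_min hex hlt ?_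
  rw [hwc] at hu hv
  rcases habs with h | h
  · refine ⟨U', V', Int.natAbs_pos.2 hw0, ?_, ?_⟩
    · rw [hu, h]; push_cast; field_simp
    · rw [hv, h]; push_cast; field_simp
  · refine ⟨-U', -V', Int.natAbs_pos.2 hw0, ?_, ?_⟩
    · rw [hu, h]; push_cast; field_simp
    · rw [hv, h]; push_cast; field_simp

theorem isCoprime_of_no_common_prime {a b : ℤ} (ha : a ≠ 0)
    (h : ∀ p, Prime p → p ∣ a → ¬ p ∣ b) : IsCoprime a b :=
  isCoprime_of_prime_dvd (fun h0 => ha h0.1) h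

theorem dvd_of_prime_sq_mul_dvd {q m : ℤ} (hq : Prime q) (hq55 : q ∣ 55)
    (h : q ^ 2 ∣ 55 * m) : q ∣ m := by
  have hsq : Squarefree (55 : ℤ) := by
    rw [← Int.squarefree_natAbs]
    exact (by decide +kernel : Squarefree (55 : ℕ))
  obtain ⟨c, hc⟩ := hq55
  have hqc : ¬ q ∣ c := by
    rintro ⟨c', rfl⟩
    exact hq.not_isUnit (hsq q ⟨c', by linarith⟩)
  have : q ∣ c * m := by
    obtain ⟨r, hr⟩ := h
    refine ⟨r, mul_left_cancel₀ hq.ne_zero ?_⟩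
    linear_combination hr - m * hc
  exact (hq.dvd_or_dvd this).resolve_left hqc

/-- The second descent: from a cube `y + k√-55 = (u + v√-55) ^ 3` to a third part. -/
theorem second_descent {k a d : ℤ} {u v : ℚ} (hk : 0 < k)
    (hk3 : ∀ p, Prime p → ¬ p ^ 3 ∣ k) (hk55 : ∀ p, Prime p → p ∣ k → p ∣ 55)
    (hd : d ≠ 0) (ha : ∀ p, Prime p → p ∣ 55 → ¬ p ∣ a)
    (hx : u ^ 2 + 55 * v ^ 2 = a / (d : ℚ) ^ 2) (hv : v * (3 * u ^ 2 - 55 * v ^ 2) = k) :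
    ∃ p q : ℚ, (k : ℚ) = q * (p ^ 2 + 55 * q ^ 2) ∧ 3 * (k : ℚ) = v * (p ^ 2 - 165 * q ^ 2) ∧
      9 * (k : ℚ) * u = v * (p ^ 3 + 495 * p * q ^ 2) := by
  obtain ⟨U, V, w, hw, rfl, rfl, hcop⟩ := exists_common_denominator u v
  have hwq : (w : ℚ) ≠ 0 := by exact_mod_cast hw.ne'
  have hdq : (d : ℚ) ≠ 0 := by exact_mod_cast hd
  have hkq : (k : ℚ) ≠ 0 := by exact_mod_cast hk.ne'
  have p3 : Prime (3 : ℤ) := Int.prime_three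
  have hE : V * (3 * U ^ 2 - 55 * V ^ 2) = k * w ^ 3 := by
    field_simp at hv
    have : (V : ℚ) * (3 * U ^ 2 - 55 * V ^ 2) = k * w ^ 3 := by linear_combination hv
    exact_mod_cast this
  have hF : d ^ 2 * (U ^ 2 + 55 * V ^ 2) = a * w ^ 2 := by
    field_simp at hx
    have : (d : ℚ) ^ 2 * (U ^ 2 + 55 * V ^ 2) = a * w ^ 2 := by linear_combination hx
    exact_mod_cast this
  have hUV : ∀ p, Prime p → p ∣ U → ¬ p ∣ V := by
    intro p hp h1 h2
    have h3 : p ^ 3 ∣ k * w ^ 3 := by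
      obtain ⟨U', rfl⟩ := h1
      obtain ⟨V', rfl⟩ := h2
      exact ⟨V' * (3 * U' ^ 2 - 55 * V' ^ 2), by rw [← hE]; ring⟩
    exact hk3 p hp (hp.pow_dvd_of_dvd_mul_right 3
      (fun h => hcop p hp h1 h2 (hp.dvd_of_dvd_pow h)) h3)
  have hU55 : ∀ p, Prime p → p ∣ 55 → ¬ p ∣ U := by
    intro p hp h1 h2
    have hpV := hUV p hp h2
    obtain ⟨U', rfl⟩ := h2
    by_cases hpw : p ∣ w
    · obtain ⟨w', rfl⟩ := hpw
      refine hpV (hp.dvd_of_dvd_pow (n := 3) (dvd_of_prime_sq_mul_dvd hp h1 ?_))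
      exact ⟨3 * V * U' ^ 2 - k * p * w' ^ 3, by linear_combination -hE⟩
    · have : p ∣ a * w ^ 2 := by
        rw [← hF]
        exact ((Dvd.intro _ (by ring : p * (p * U' ^ 2) = (p * U') ^ 2)).add
          (h1.mul_right _)).mul_left _
      rcases hp.dvd_or_dvd this with h | h
      · exact ha p hp h1 h
      · exact hpw (hp.dvd_of_dvd_pow h)
  have h3k : ¬ (3 : ℤ) ∣ k := fun h => by
    have := hk55 3 p3 h
    omega
  have hkcop : IsCoprime k (3 * U ^ 2 - 55 * V ^ 2) := by
    refine isCoprime_of_no_common_prime hk.ne' fun p hp h1 h2 => ?_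
    have h55 := hk55 p hp h1
    have : p ∣ 3 * U ^ 2 := by
      have := h2.add (h55.mul_right (V ^ 2))
      rwa [sub_add_cancel] at this
    rcases hp.dvd_or_dvd this with h | h
    · have : p ∣ 1 :=
        (h55.sub (h.mul_right 18)).trans (dvd_of_eq (by norm_num))
      exact hp.not_isUnit (isUnit_of_dvd_one this)
    · exact hU55 p hp h55 (hp.dvd_of_dvd_pow h)
  obtain ⟨V', rfl⟩ : k ∣ V := hkcop.dvd_of_dvd_mul_right (Dvd.intro _ hE.symm)
  have hE' : V' * (3 * U ^ 2 - 55 * (k * V') ^ 2) = w ^ 3 := by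
    apply mul_left_cancel₀ hk.ne'
    linear_combination hE
  have hV'0 : V' ≠ 0 := by
    rintro rfl
    rw [zero_mul] at hE'
    exact (pow_pos hw 3).ne hE'
  by_cases h3V : (3 : ℤ) ∣ V'
  · obtain ⟨V'', rfl⟩ := h3V
    have h3w : (3 : ℤ) ∣ w := p3.dvd_of_dvd_pow (n := 3)
      (by rw [← hE', mul_assoc]; exact dvd_mul_right _ _)
    obtain ⟨w', rfl⟩ := h3w
    have h3U : ¬ (3 : ℤ) ∣ U := fun h => hUV 3 p3 h ((dvd_mul_right 3 V'').mul_left k)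
    have hE2 : V'' * (U ^ 2 - 165 * (k * V'') ^ 2) = 3 * w' ^ 3 := by linarith
    have h3V : (3 : ℤ) ∣ V'' := by
      rcases p3.dvd_or_dvd (Dvd.intro _ hE2.symm) with h | h
      · exact h
      · refine absurd (p3.dvd_of_dvd_pow (n := 2) ?_) h3U
        have := h.add (show (3 : ℤ) ∣ 165 * (k * V'') ^ 2 from ⟨55 * (k * V'') ^ 2, by ring⟩)
        rwa [sub_add_cancel] at this
    obtain ⟨V3, rfl⟩ := h3V
    have hE3 : V3 * (U ^ 2 - 165 * (3 * k * V3) ^ 2) = w' ^ 3 := by linarith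
    have hV3 : V3 ≠ 0 := by rintro rfl; simp at hV'0
    have hc3 : IsCoprime V3 (U ^ 2 - 165 * (3 * k * V3) ^ 2) := by
      refine isCoprime_of_no_common_prime hV3 fun p hp h1 h2 => ?_
      have : p ∣ U ^ 2 := by
        have := h2.add (show p ∣ 165 * (3 * k * V3) ^ 2 from
          (h1.mul_left (165 * 9 * k ^ 2 * V3)).trans (dvd_of_eq (by ring)))
        rwa [sub_add_cancel] at this
      exact hUV p hp (hp.dvd_of_dvd_pow this) ((h1.mul_left (9 * k)).trans (dvd_of_eq (by ring)))
    obtain ⟨V0, hV0⟩ := Int.eq_pow_of_mul_eq_pow_odd_left hc3 (by decide) hE3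
    obtain ⟨W, hW⟩ := Int.eq_pow_of_mul_eq_pow_odd_right hc3 (by decide) hE3
    have hw' : w' = V0 * W := by
      have : w' ^ 3 = (V0 * W) ^ 3 := by rw [← hE3, hW, hV0]; ring
      exact (Odd.strictMono_pow (by decide : Odd 3)).injective this
    have hW0 : W ≠ 0 := by rintro rfl; simp [hw'] at hw
    have hV00 : V0 ≠ 0 := by rintro rfl; simp [hw'] at hw
    have hWV : IsCoprime W (3 * k * V3) := by
      refine isCoprime_of_no_common_prime hW0 fun p hp h1 h2 => ?_
      have h1' : p ∣ U ^ 2 - 165 * (3 * k * V3) ^ 2 := by rw [hW]; exact dvd_pow h1 (by norm_num)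
      have : p ∣ U ^ 2 := by
        have := h1'.add (show p ∣ 165 * (3 * k * V3) ^ 2 from (dvd_pow h2 (by norm_num)).mul_left _)
        rwa [sub_add_cancel] at this
      exact hUV p hp (hp.dvd_of_dvd_pow this) ((h2.mul_left 3).trans (dvd_of_eq (by ring)))
    obtain ⟨e, f, h1, h2, h3⟩ := indefinite_cube (A := 1) (B := 165) (U := U)
      (by norm_num) hW0 (by rw [← hW]; ring) hWV
    subst hV0 hw'
    have hV0q : (V0 : ℚ) ≠ 0 := by exact_mod_cast hV00
    have hWq : (W : ℚ) ≠ 0 := by exact_mod_cast hW0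
    push_cast at h1 h2 h3 ⊢
    refine ⟨e / V0, f / V0, ?_, ?_, ?_⟩
    · field_simp
      linear_combination h2 / 3
    · field_simp
      linear_combination h3
    · field_simp
      linear_combination 9 * h1
  · have h3V' : ¬ (3 : ℤ) ∣ k * V' := fun h => by
      rcases p3.dvd_or_dvd h with h | h
      · exact h3k h
      · exact h3V h
    have hc : ∀ p, Prime p → p ∣ k * V' → ¬ p ∣ 3 * U ^ 2 - 55 * (k * V') ^ 2 := by
      intro p hp h1 h2
      have : p ∣ 3 * U ^ 2 := by
        have := h2.add (show p ∣ 55 * (k * V') ^ 2 from (dvd_pow h1 (by norm_num)).mul_left _)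
        rwa [sub_add_cancel] at this
      rcases hp.dvd_or_dvd this with h | h
      · exact h3V' (((hp.dvd_prime_iff_associated p3).1 h).symm.dvd.trans h1)
      · exact hUV p hp (hp.dvd_of_dvd_pow h) h1
    have hc3 : IsCoprime V' (3 * U ^ 2 - 55 * (k * V') ^ 2) :=
      isCoprime_of_no_common_prime hV'0 fun p hp h1 => hc p hp (h1.mul_left k)
    obtain ⟨V0, hV0⟩ := Int.eq_pow_of_mul_eq_pow_odd_left hc3 (by decide) hE'
    obtain ⟨W, hW⟩ := Int.eq_pow_of_mul_eq_pow_odd_right hc3 (by decide) hE'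
    have hw' : w = V0 * W := by
      have : w ^ 3 = (V0 * W) ^ 3 := by rw [← hE', hW, hV0]; ring
      exact (Odd.strictMono_pow (by decide : Odd 3)).injective this
    have hW0 : W ≠ 0 := by rintro rfl; simp [hw'] at hw
    have hV00 : V0 ≠ 0 := by rintro rfl; simp [hw'] at hw
    have hWV : IsCoprime W (k * V') :=
      isCoprime_of_no_common_prime hW0 fun p hp h1 h2 =>
        hc p hp h2 (by rw [hW]; exact dvd_pow h1 (by norm_num))
    obtain ⟨e, f, h1, h2, h3⟩ := indefinite_cube (A := 3) (B := 55) (by norm_num) hW0 hW hWV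
    subst hV0 hw'
    have hV0q : (V0 : ℚ) ≠ 0 := by exact_mod_cast hV00
    have hWq : (W : ℚ) ≠ 0 := by exact_mod_cast hW0
    push_cast at h1 h2 h3 ⊢
    refine ⟨3 * e / V0, f / V0, ?_, ?_, ?_⟩
    · field_simp
      linear_combination h2
    · field_simp
      linear_combination 3 * h3
    · field_simp
      linear_combination 9 * h1

theorem not_modEq_eight_sixteen : ∀ s t : ZMod 16,
    ¬ (s * (s ^ 2 - 165 * t ^ 2) = 8 ∧ t * (3 * s ^ 2 - 55 * t ^ 2) = 8) := by decide +kernel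

theorem not_modEq_one_two : ∀ s t : ZMod 2,
    ¬ (s * (s ^ 2 - 165 * t ^ 2) = 1 ∧ t * (3 * s ^ 2 - 55 * t ^ 2) = 1) := by decide +kernel

theorem ne_two_mod_nine : ∀ s t : ZMod 9, ∀ x ∈ ({3, -3} : Finset (ZMod 9)),
    ∀ y ∈ ({1, -1} : Finset (ZMod 9)), ∀ v ∈ ({2, -2} : Finset (ZMod 9)),
    v ≠ t * (3 * s ^ 2 - 55 * t ^ 2) * x - s * (s ^ 2 - 165 * t ^ 2) * y := by decide +kernel

theorem eight_mul_odd {U : ℤ} (hU : Odd U) : 8 * (U : ZMod 16) = 8 := by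
  obtain ⟨m, rfl⟩ := hU
  push_cast
  linear_combination (m : ZMod 16) * (by decide : (16 : ZMod 16) = 0)

/-- An odd solution of `U ^ 2 + 55 * V ^ 2 = W ^ 3` with `W` even has `V` not `±2` modulo `9`. -/
theorem false_of_two_mod_nine {U V W : ℤ} (hW : 0 < W) (hN : U ^ 2 + 55 * V ^ 2 = W ^ 3)
    (hcop : IsCoprime W V) (hU : Odd U) (hV : Odd V) (h9 : (V : ZMod 9) = 2 ∨ (V : ZMod 9) = -2) :
    False := by
  obtain ⟨s, t, x, y, hS, hT, h⟩ := definite_quotient hW hN hcop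
  have hU2 : (U : ZMod 2) = 1 := ZMod.intCast_eq_one_iff_odd.2 hU
  have hV2 : (V : ZMod 2) = 1 := ZMod.intCast_eq_one_iff_odd.2 hV
  rcases h with ⟨rfl, hx⟩ | ⟨rfl, hx⟩ | ⟨hx, hy⟩
  · have hx2 : (x : ZMod 2) = 1 :=
      ZMod.intCast_eq_one_iff_odd.2 (by rcases hx with rfl | rfl <;> decide)
    have hS' := congrArg (Int.cast : ℤ → ZMod 2) hS
    have hT' := congrArg (Int.cast : ℤ → ZMod 2) hT
    push_cast at hS' hT'
    exact not_modEq_one_two s t ⟨by rw [hS', hU2, hx2]; ring, by rw [hT', hV2, hx2]; ring⟩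
  · have hU' := eight_mul_odd hU
    have hV' := eight_mul_odd hV
    have hx16 : (x : ZMod 16) = 8 := by
      rcases hx with rfl | rfl
      · rfl
      · decide
    have hS' := congrArg (Int.cast : ℤ → ZMod 16) hS
    have hT' := congrArg (Int.cast : ℤ → ZMod 16) hT
    push_cast at hS' hT'
    refine not_modEq_eight_sixteen s t ⟨?_, ?_⟩
    · rw [hS', hx16]; linear_combination hU'
    · rw [hT', hx16]; linear_combination hV'
  · have key : V * 64 = t * (3 * s ^ 2 - 55 * t ^ 2) * x - s * (s ^ 2 - 165 * t ^ 2) * y := by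
      rw [hS, hT]
      have hx2 : x ^ 2 = 9 := by rcases hx with rfl | rfl <;> norm_num
      have hy2 : y ^ 2 = 1 := by rcases hy with rfl | rfl <;> norm_num
      linear_combination -V * hx2 - 55 * V * hy2
    have key' := congrArg (Int.cast : ℤ → ZMod 9) key
    push_cast at key'
    refine ne_two_mod_nine s t x ?_ y ?_ V ?_ ?_
    · rcases hx with rfl | rfl <;> simp
    · rcases hy with rfl | rfl <;> simp
    · rcases h9 with h | h <;> simp [h]
    · rw [← key', show (64 : ZMod 9) = 1 by decide, mul_one]

theorem cube_mod_nine : ∀ z : ZMod 9, 3 * z = 0 ∨ z ^ 3 = 1 ∨ z ^ 3 = -1 := by decide +kernel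

/-- For `k` equal to `±2` modulo `9`, no odd `x` and `z`, with `z` prime to `3`, satisfy
`x ^ 2 + 55 * k ^ 2 * z ^ 6 = y ^ 3`. -/
theorem false_of_sq_add_mul_pow_six {k x y z : ℤ} (hy : 0 < y)
    (hk9 : (k : ZMod 9) = 2 ∨ (k : ZMod 9) = -2) (hk : Odd k) (hz : Odd z) (hz3 : ¬ 3 ∣ z)
    (hx : Odd x) (hyk : IsCoprime y k) (hyz : IsCoprime y z)
    (h : x ^ 2 + 55 * k ^ 2 * z ^ 6 = y ^ 3) : False := by
  refine false_of_two_mod_nine (U := x) (V := k * z ^ 3) hy (by linear_combination h)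
    (hyk.mul_right hyz.pow_right) hx (hk.mul hz.pow) ?_
  have h3 : 3 * (z : ZMod 9) ≠ 0 := fun h0 => hz3 <| by
    have : ((3 * z : ℤ) : ZMod 9) = 0 := by push_cast; exact h0
    have := (ZMod.intCast_zmod_eq_zero_iff_dvd _ _).1 this
    push_cast at this
    omega
  push_cast
  rcases (cube_mod_nine z).resolve_left h3 with hz' | hz' <;> rcases hk9 with hk' | hk' <;>
    simp [hz', hk']

theorem exists_eq_sq_of_mul_eq_sq {a b c : ℤ} (hab : IsCoprime a b) (ha : 0 < a)
    (h : a * b = c ^ 2) : ∃ s t, a = s ^ 2 ∧ b = t ^ 2 := by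
  obtain ⟨s, hs⟩ := Int.sq_of_isCoprime hab h
  obtain ⟨t, ht⟩ := Int.sq_of_isCoprime hab.symm ((mul_comm _ _).trans h)
  have hb : 0 ≤ b := nonneg_of_mul_nonneg_right (h ▸ sq_nonneg c) ha
  exact ⟨s, t, hs.resolve_right fun h' => by nlinarith [sq_nonneg s],
    ht.elim id fun h' => by nlinarith [sq_nonneg t]⟩

theorem sq_add_cube_factor {x y m : ℤ} (hym : IsCoprime y m) (hx : x ≠ 0)
    (h : x ^ 2 + m ^ 3 = y ^ 3) :
    (∃ s t, y = m + s ^ 2 ∧ t ^ 2 = s ^ 4 + 3 * m * s ^ 2 + 3 * m ^ 2) ∨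
      ∃ s t, y = m + 3 * s ^ 2 ∧ t ^ 2 = 3 * s ^ 4 + 3 * m * s ^ 2 + m ^ 2 := by
  have hpos : 0 < y - m := by
    have : m ^ 3 < y ^ 3 := by have := sq_pos_of_ne_zero hx; linarith
    have := (Odd.strictMono_pow (R := ℤ) (by decide : Odd 3)).lt_iff_lt.1 this
    linarith
  have hy : IsCoprime (y - m) y := by
    obtain ⟨a, b, hab⟩ := hym
    exact ⟨-b, a + b, by linear_combination hab⟩
  have hm : IsCoprime (y - m) m := by
    obtain ⟨a, b, hab⟩ := hym
    exact ⟨a, a + b, by linear_combination hab⟩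
  have h3p : Prime (3 : ℤ) := Int.prime_three
  by_cases h3 : 3 ∣ y - m
  · right
    obtain ⟨A, hA⟩ := h3
    have hx3 : 3 ∣ x := by
      refine h3p.dvd_of_dvd_pow (n := 2) ⟨A * (y ^ 2 + y * m + m ^ 2), ?_⟩
      linear_combination h + (y ^ 2 + y * m + m ^ 2) * hA
    obtain ⟨X, rfl⟩ := hx3
    have hAd : A ∣ y - m := ⟨3, by rw [hA]; ring⟩
    have hcop : IsCoprime A (3 * A ^ 2 + y * m) := by
      obtain ⟨a, b, hab⟩ := (hy.of_isCoprime_of_dvd_left hAd).mul_right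
        (hm.of_isCoprime_of_dvd_left hAd)
      exact ⟨a - 3 * b * A, b, by linear_combination hab⟩
    have hyA : y = m + 3 * A := by linarith
    have hmul : A * (3 * A ^ 2 + y * m) = X ^ 2 := by
      apply mul_left_cancel₀ (by norm_num : (9 : ℤ) ≠ 0)
      rw [hyA] at h ⊢
      linear_combination -h
    have hA0 : 0 < A := by omega
    obtain ⟨s, t, hs, ht⟩ := exists_eq_sq_of_mul_eq_sq hcop hA0 hmul
    exact ⟨s, t, by rw [hyA, hs], by rw [← ht, hyA, hs]; ring⟩
  · left
    have hcop : IsCoprime (y - m) (y ^ 2 + y * m + m ^ 2) := by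
      have h3' : IsCoprime (y - m) 3 := (h3p.coprime_iff_not_dvd.2 h3).symm
      obtain ⟨a, b, hab⟩ := h3'.mul_right (hy.mul_right hm)
      exact ⟨a - b * (y - m), b, by linear_combination hab⟩
    have hmul : (y - m) * (y ^ 2 + y * m + m ^ 2) = x ^ 2 := by linear_combination -h
    obtain ⟨s, t, hs, ht⟩ := exists_eq_sq_of_mul_eq_sq hcop hpos hmul
    have hyA : y = m + s ^ 2 := by linarith
    exact ⟨s, t, hyA, by rw [← ht, hyA]; ring⟩

theorem eq_zero_of_sq_three : ∀ a b : ZMod 3, -a ^ 2 = b ^ 2 → a = 0 := by decide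

theorem eq_zero_of_three_mul_sq_five : ∀ a b : ZMod 5,
    3 * a ^ 2 = 4 * b ^ 2 ∨ -(3 * a ^ 2) = 4 * b ^ 2 → b = 0 := by decide

theorem eq_zero_of_sq_eq_three_mul_pow_four : ∀ a b : ZMod 5, b ^ 2 = 3 * a ^ 4 → a = 0 := by
  decide

theorem eq_zero_of_sq_eleven : ∀ a b : ZMod 11,
    -a ^ 2 = 4 * b ^ 2 ∨ -(3 * a ^ 2) = 4 * b ^ 2 → b = 0 := by decide +kernel

/-- The equation `e * f = 3 * m ^ 2`, `f - e = 4 * s ^ 2 + 6 * m` for `m = P * Q`, with `P` and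
`Q` powers of `5` and `11`. -/
theorem false_of_mul_eq_three_mul_sq {e f s P Q : ℤ} {p q : ℕ} (hP : P = 5 ^ p) (hQ : Q = 11 ^ q)
    (hp : 0 < p) (hq : 0 < q) (h5 : ¬ 5 ∣ s) (h11 : ¬ 11 ∣ s) (he : 0 < e)
    (hmul : e * f = 3 * (P * Q) ^ 2) (hsub : f - e = 4 * s ^ 2 + 6 * (P * Q)) : False := by
  have p5 : Prime (5 : ℤ) := by norm_num [Int.prime_iff_natAbs_prime]
  have p11 : Prime (11 : ℤ) := by norm_num [Int.prime_iff_natAbs_prime]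
  have dP : 5 ∣ P := hP ▸ dvd_pow_self 5 hp.ne'
  have dQ : 11 ∣ Q := hQ ▸ dvd_pow_self 11 hq.ne'
  have P0 : 0 < P := by rw [hP]; positivity
  have Q0 : 0 < Q := by rw [hQ]; positivity
  have aux : ∀ r : ℤ, Prime r → ¬ r ∣ s → ¬ r ∣ 4 → r ∣ P * Q → r ∣ e → r ∣ f → False := by
    intro r hr hs h4 hPQ h1 h2
    have : r ∣ 4 * s ^ 2 := by
      have := (dvd_sub h2 h1).sub (hPQ.mul_left 6)
      rwa [hsub, add_sub_cancel_right] at this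
    exact (hr.dvd_or_dvd this).elim h4 fun h => hs (hr.dvd_of_dvd_pow h)
  have aux5 := aux 5 p5 h5 (by norm_num) (dP.mul_right Q)
  have aux11 := aux 11 p11 h11 (by norm_num) (dQ.mul_left P)
  have split5 : P ^ 2 ∣ e ∨ P ^ 2 ∣ f := by
    have hd : P ^ 2 ∣ e * f := ⟨3 * Q ^ 2, by rw [hmul]; ring⟩
    by_cases h : 5 ∣ e
    · left
      have : IsCoprime (P ^ 2) f := by
        rw [hP]
        exact ((p5.coprime_iff_not_dvd.2 fun h' => aux5 h h').pow_left).pow_left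
      exact this.dvd_of_dvd_mul_right hd
    · right
      have : IsCoprime (P ^ 2) e := by
        rw [hP]
        exact ((p5.coprime_iff_not_dvd.2 h).pow_left).pow_left
      exact this.dvd_of_dvd_mul_left hd
  have split11 : Q ^ 2 ∣ e ∨ Q ^ 2 ∣ f := by
    have hd : Q ^ 2 ∣ e * f := ⟨3 * P ^ 2, by rw [hmul]; ring⟩
    by_cases h : 11 ∣ e
    · left
      have : IsCoprime (Q ^ 2) f := by
        rw [hQ]
        exact ((p11.coprime_iff_not_dvd.2 fun h' => aux11 h h').pow_left).pow_left
      exact this.dvd_of_dvd_mul_right hd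
    · right
      have : IsCoprime (Q ^ 2) e := by
        rw [hQ]
        exact ((p11.coprime_iff_not_dvd.2 h).pow_left).pow_left
      exact this.dvd_of_dvd_mul_left hd
  have hPQ : IsCoprime (P ^ 2) (Q ^ 2) := by
    rw [hP, hQ]
    exact ((Int.isCoprime_iff_gcd_eq_one.2 (by norm_num) : IsCoprime (5 : ℤ) 11).pow).pow
  have pos : ∀ c d : ℤ, c * d = 3 → 0 < c → (c = 1 ∧ d = 3) ∨ (c = 3 ∧ d = 1) := by
    intro c d hcd hc
    have : c ≤ 3 := by
      have : 0 < d := pos_of_mul_pos_right (by omega : 0 < c * d) hc.le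
      nlinarith
    interval_cases c <;> omega
  have hP2 : P ^ 2 ≠ 0 := by positivity
  have hQ2 : Q ^ 2 ≠ 0 := by positivity
  have h5' : ∀ a : ZMod 5, ¬ (3 * a ^ 2 = 4 * (s : ZMod 5) ^ 2 ∨
      -(3 * a ^ 2) = 4 * (s : ZMod 5) ^ 2) := fun a h =>
    h5 ((ZMod.intCast_zmod_eq_zero_iff_dvd s 5).1 (eq_zero_of_three_mul_sq_five a s h))
  have h11' : ∀ a : ZMod 11, ¬ (-a ^ 2 = 4 * (s : ZMod 11) ^ 2 ∨
      -(3 * a ^ 2) = 4 * (s : ZMod 11) ^ 2) := fun a h =>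
    h11 ((ZMod.intCast_zmod_eq_zero_iff_dvd s 11).1 (eq_zero_of_sq_eleven a s h))
  have P5 : (P : ZMod 5) = 0 := (ZMod.intCast_zmod_eq_zero_iff_dvd P 5).2 dP
  have Q11 : (Q : ZMod 11) = 0 := (ZMod.intCast_zmod_eq_zero_iff_dvd Q 11).2 dQ
  have m3 := congrArg (Int.cast : ℤ → ZMod 3) hsub
  have m5 := congrArg (Int.cast : ℤ → ZMod 5) hsub
  have m11 := congrArg (Int.cast : ℤ → ZMod 11) hsub
  rcases split5 with ⟨c, rfl⟩ | ⟨c, rfl⟩ <;> rcases split11 with h | h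
  · obtain ⟨d, hd⟩ := hPQ.mul_dvd (Dvd.intro c rfl) h
    rw [hd] at hmul he
    have hf : d * f = 3 := mul_left_cancel₀ (mul_ne_zero hP2 hQ2) (by linear_combination hmul)
    have hd0 : 0 < d := pos_of_mul_pos_right he (by positivity)
    have := mul_pos P0 Q0
    rcases pos d f hf hd0 with ⟨-, rfl⟩ | ⟨-, rfl⟩ <;> nlinarith [sq_nonneg s]
  · obtain ⟨d, rfl⟩ := h
    have hcd : c * d = 3 := mul_left_cancel₀ (mul_ne_zero hP2 hQ2) (by linear_combination hmul)
    have hc0 : 0 < c := pos_of_mul_pos_right he (by positivity)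
    push_cast at m5 m11
    rw [P5] at m5
    rw [Q11] at m11
    rcases pos c d hcd hc0 with ⟨rfl, rfl⟩ | ⟨rfl, rfl⟩
    · push_cast at m5
      exact h5' Q (Or.inl (by linear_combination m5))
    · push_cast at m11
      exact h11' P (Or.inr (by linear_combination m11))
  · obtain ⟨d, rfl⟩ := h
    have hcd : d * c = 3 := mul_left_cancel₀ (mul_ne_zero hP2 hQ2) (by linear_combination hmul)
    have hd0 : 0 < d := pos_of_mul_pos_right he (by positivity)
    push_cast at m5 m3
    rw [P5] at m5
    rcases pos d c hcd hd0 with ⟨rfl, rfl⟩ | ⟨rfl, rfl⟩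
    · push_cast at m3
      have hQ3 := eq_zero_of_sq_three Q s (by
        linear_combination m3 + (s ^ 2 + 2 * P * Q - P ^ 2 : ZMod 3) *
          (by decide : (3 : ZMod 3) = 0))
      rw [ZMod.intCast_zmod_eq_zero_iff_dvd, hQ] at hQ3
      have := Int.prime_three.dvd_of_dvd_pow hQ3
      norm_num at this
    · push_cast at m5
      exact h5' Q (Or.inr (by linear_combination m5))
  · obtain ⟨d, hd⟩ := hPQ.mul_dvd (Dvd.intro c rfl) h
    rw [hd] at hmul m5 m11
    have hf : e * d = 3 := mul_left_cancel₀ (mul_ne_zero hP2 hQ2) (by linear_combination hmul)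
    push_cast at m5 m11
    rw [P5] at m5
    rw [Q11] at m11
    rcases pos e d hf he with ⟨rfl, rfl⟩ | ⟨rfl, rfl⟩
    · push_cast at m11
      exact h11' 1 (Or.inl (by linear_combination m11))
    · push_cast at m5
      exact h5' 1 (Or.inr (by linear_combination m5))

/-- The equation `x ^ 2 + m ^ 3 = y ^ 3` with `m = 5 ^ p * 11 ^ q`. -/
theorem false_of_sq_add_cube {x y m : ℤ} {p q : ℕ} (hm : m = 5 ^ p * 11 ^ q) (hp : 0 < p)
    (hq : 0 < q) (hym : IsCoprime y m) (hx : x ≠ 0) (h : x ^ 2 + m ^ 3 = y ^ 3) : False := by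
  have d5 : 5 ∣ m := hm ▸ (dvd_pow_self 5 hp.ne').mul_right _
  have d11 : 11 ∣ m := hm ▸ (dvd_pow_self 11 hq.ne').mul_left _
  have m0 : 0 < m := by rw [hm]; positivity
  have hu : ∀ r : ℤ, r ∣ y → r ∣ m → IsUnit r := fun r h1 h2 => hym.isUnit_of_dvd' h1 h2
  have h5y : ¬ 5 ∣ y := fun h' => absurd (hu 5 h' d5) (by norm_num [Int.isUnit_iff])
  have h11y : ¬ 11 ∣ y := fun h' => absurd (hu 11 h' d11) (by norm_num [Int.isUnit_iff])
  rcases sq_add_cube_factor hym hx h with ⟨s, t, rfl, ht⟩ | ⟨s, t, rfl, ht⟩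
  · have h5 : ¬ 5 ∣ s := fun h' => h5y (d5.add (dvd_pow h' two_ne_zero))
    have h11 : ¬ 11 ∣ s := fun h' => h11y (d11.add (dvd_pow h' two_ne_zero))
    have key : (2 * |t| - 2 * s ^ 2 - 3 * m) * (2 * |t| + 2 * s ^ 2 + 3 * m) = 3 * m ^ 2 := by
      linear_combination 4 * sq_abs t + 4 * ht
    have hf : 0 < 2 * |t| + 2 * s ^ 2 + 3 * m := by positivity
    refine false_of_mul_eq_three_mul_sq (e := 2 * |t| - 2 * s ^ 2 - 3 * m)
      (f := 2 * |t| + 2 * s ^ 2 + 3 * m) rfl rfl hp hq h5 h11 ?_ (by rw [← hm]; exact key)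
      (by rw [← hm]; ring)
    exact pos_of_mul_pos_left (by rw [key]; positivity) hf.le
  · have ht5 := congrArg (Int.cast : ℤ → ZMod 5) ht
    push_cast at ht5
    rw [(ZMod.intCast_zmod_eq_zero_iff_dvd m 5).2 d5] at ht5
    have hs := eq_zero_of_sq_eq_three_mul_pow_four s t (by linear_combination ht5)
    exact h5y (d5.add ((dvd_pow ((ZMod.intCast_zmod_eq_zero_iff_dvd s 5).1 hs)
      two_ne_zero).mul_left 3))

instance fact_sq_ne_neg_fiftyfive : Fact (∀ r : ℚ, r ^ 2 ≠ -55 + 0 * r) :=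
  ⟨fun r h => by nlinarith [sq_nonneg r]⟩

open WeierstrassCurve.Affine

/-- The Mordell curve `Y² = X³ - D` over the rationals. -/
abbrev mordellCurve (D : ℤ) : WeierstrassCurve.Affine ℚ := ⟨0, 0, 0, 0, -(D : ℚ)⟩

namespace mordellCurve

variable {D k : ℤ}

theorem equation_iff (x y : ℚ) : (mordellCurve D).Equation x y ↔ y ^ 2 = x ^ 3 - D := by
  rw [WeierstrassCurve.Affine.equation_iff]
  constructor <;> intro h <;> linarith

theorem nonsingular_of_eq (hD : D ≠ 0) {x y : ℚ} (h : y ^ 2 = x ^ 3 - D) :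
    (mordellCurve D).Nonsingular x y := by
  rw [WeierstrassCurve.Affine.nonsingular_iff]
  refine ⟨(equation_iff x y).2 h, ?_⟩
  by_contra! hc
  simp only [zero_mul, mul_zero, add_zero, sub_zero] at hc
  have hx : x = 0 := by
    have : 3 * x ^ 2 = 0 := hc.1.symm
    simpa using this
  have hy : y = 0 := by linarith [hc.2]
  rw [hx, hy] at h
  apply hD
  have : (D : ℚ) = 0 := by linarith
  exact_mod_cast this

/-- The numerator of the abscissa of a rational point (`1` at infinity). -/
def num : (mordellCurve D).Point → ℤ
  | .zero => 1
  | .some x _ _ => x.num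

/-- The positive square root of the denominator of the abscissa (`0` at infinity). -/
def den : (mordellCurve D).Point → ℤ
  | .zero => 0
  | .some x _ _ => (Nat.sqrt x.den : ℤ)

/-- The numerator of the ordinate of a rational point (`1` at infinity). -/
def ynum : (mordellCurve D).Point → ℤ
  | .zero => 1
  | .some _ y _ => y.num

@[simp] theorem num_zero : num (0 : (mordellCurve D).Point) = 1 := rfl
@[simp] theorem den_zero : den (0 : (mordellCurve D).Point) = 0 := rfl

theorem cube_sub_int_den (x : ℚ) (n : ℤ) : (x ^ 3 - n).den = x.den ^ 3 := by
  rw [Rat.sub_intCast_den]; simp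

theorem exists_sq_of_sq_eq_cube {m n : ℕ} (hn : 0 < n) (h : m ^ 2 = n ^ 3) :
    ∃ t, n = t ^ 2 ∧ m = t ^ 3 := by
  have hd : n ∣ m := by
    rw [← Nat.pow_dvd_pow_iff (n := 2) (by norm_num), h]
    exact pow_dvd_pow n (by norm_num)
  obtain ⟨t, rfl⟩ := hd
  have : t ^ 2 = n := by
    have : n ^ 2 * t ^ 2 = n ^ 2 * n := by linarith [h]
    exact Nat.eq_of_mul_eq_mul_left (by positivity) this
  exact ⟨t, this.symm, by rw [← this]; ring⟩

theorem some_spec {x y : ℚ} (h : (mordellCurve D).Nonsingular x y) :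
    0 < den (.some x y h) ∧ x = num (.some x y h) / (den (.some x y h) : ℚ) ^ 2 ∧
      y = ynum (.some x y h) / (den (.some x y h) : ℚ) ^ 3 ∧
      IsCoprime (num (.some x y h)) (den (.some x y h)) := by
  have he := (equation_iff x y).1 h.1
  have hden : y.den ^ 2 = x.den ^ 3 := by
    rw [← cube_sub_int_den x D, ← he]; simp
  obtain ⟨t, ht, ht'⟩ := exists_sq_of_sq_eq_cube x.pos hden
  have hs : den (.some x y h) = t := by
    simp only [den, ht]
    rw [Nat.sqrt_eq']
  have ht0 : 0 < t := by
    rcases Nat.eq_zero_or_pos t with h0 | h0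
    · have := x.pos; simp [ht, h0] at this
    · exact h0
  rw [hs]
  refine ⟨by exact_mod_cast ht0, ?_, ?_, ?_⟩
  · conv_lhs => rw [← Rat.num_div_den x, ht]
    simp [num]
  · conv_lhs => rw [← Rat.num_div_den y, ht']
    simp [ynum]
  · have := x.isCoprime_num_den
    rw [ht] at this
    push_cast at this
    exact (IsCoprime.pow_right_iff (by norm_num)).1 this

theorem ne_zero_iff_den_pos (P : (mordellCurve D).Point) : P ≠ 0 ↔ 0 < den P := by
  rcases P with _ | ⟨x, y, h⟩
  · simp [← WeierstrassCurve.Affine.Point.zero_def]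
  · simp [(some_spec h).1]

theorem den_nonneg (P : (mordellCurve D).Point) : 0 ≤ den P := by
  rcases P with _ | ⟨x, y, h⟩
  · exact le_rfl
  · exact (some_spec h).1.le

theorem eq_zero_of_den_eq_zero {P : (mordellCurve D).Point} (h : den P = 0) : P = 0 := by
  by_contra hP
  have := (ne_zero_iff_den_pos P).1 hP
  omega

theorem isCoprime_num_den (P : (mordellCurve D).Point) : IsCoprime (num P) (den P) := by
  rcases P with _ | ⟨x, y, h⟩
  · exact isCoprime_one_left
  · exact (some_spec h).2.2.2

theorem ynum_sq (P : (mordellCurve D).Point) : ynum P ^ 2 = num P ^ 3 - D * den P ^ 6 := by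
  rcases P with _ | ⟨x, y, h⟩
  · simp [ynum, num, den]
  · obtain ⟨h1, h2, h3, -⟩ := some_spec h
    have he := (equation_iff x y).1 h.1
    generalize num (.some x y h) = a at *
    generalize den (.some x y h) = d at *
    generalize ynum (.some x y h) = b at *
    have hd : (d : ℚ) ≠ 0 := by exact_mod_cast h1.ne'
    rw [h2, h3] at he
    field_simp at he
    rw [mul_comm D]
    exact_mod_cast he

theorem num_pos (hD : 0 < D) (P : (mordellCurve D).Point) : 0 < num P := by
  rcases P with _ | ⟨x, y, h⟩
  · exact one_pos
  · have h1 := (some_spec h).1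
    have h2 := ynum_sq (.some x y h)
    by_contra! hc
    have : num (.some x y h) ^ 3 ≤ 0 := by
      have := pow_nonneg (neg_nonneg.2 hc) 3
      nlinarith
    have : 0 < D * den (.some x y h) ^ 6 := by positivity
    nlinarith [sq_nonneg (ynum (.some x y h))]

@[simp] theorem num_neg (P : (mordellCurve D).Point) : num (-P) = num P := by
  rcases P with _ | ⟨x, y, h⟩ <;> rfl

@[simp] theorem den_neg (P : (mordellCurve D).Point) : den (-P) = den P := by
  rcases P with _ | ⟨x, y, h⟩ <;> rfl

theorem eq_or_eq_neg_of_num_den {P Q : (mordellCurve D).Point} (h : num P = num Q)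
    (h' : den P = den Q) : P = Q ∨ P = -Q := by
  rcases P with _ | ⟨x, y, hP⟩
  · left
    exact (eq_zero_of_den_eq_zero h'.symm).symm
  rcases Q with _ | ⟨x', y', hQ⟩
  · left
    exact eq_zero_of_den_eq_zero h'
  apply Point.X_eq_iff.1
  rw [(some_spec hP).2.1, (some_spec hQ).2.1, h, h']

theorem num_den_unique {x y : ℚ} (h : (mordellCurve D).Nonsingular x y) {a d : ℤ} (hd : 0 < d)
    (hc : IsCoprime a d) (hx : x = a / (d : ℚ) ^ 2) :
    num (.some x y h) = a ∧ den (.some x y h) = d := by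
  have hx' : x = ((a : ℤ) : ℚ) / ((d ^ 2 : ℤ) : ℚ) := by push_cast; exact hx
  have hcop : Nat.Coprime a.natAbs (d ^ 2).natAbs := by
    rw [← Int.isCoprime_iff_nat_coprime]; exact hc.pow_right
  have h1 : x.num = a := by
    rw [hx']; exact Rat.num_div_eq_of_coprime (by positivity) hcop
  have h2 : (x.den : ℤ) = d ^ 2 := by
    rw [hx']; exact Rat.den_div_eq_of_coprime (by positivity) hcop
  refine ⟨h1, ?_⟩
  have h3 : x.den = d.natAbs ^ 2 := by zify; rw [h2]; simp
  simp only [den, h3, Nat.sqrt_eq']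
  omega

theorem dvd_of_dvd_mul_of_no_common_prime {p u v w : ℤ} (hv : u ∣ p * v)
    (hw : u ∣ p * w)
    (h : ∀ q : ℤ, Prime q → q ∣ u → q ∣ v → q ∣ w → False) : u ∣ p := by
  have hg : Int.gcd (Int.gcd u v) w = 1 := by
    by_contra hne
    obtain ⟨q, hq, hqd⟩ := Nat.exists_prime_and_dvd hne
    have hqd' : (q : ℤ) ∣ (Int.gcd (Int.gcd u v) w : ℤ) := by exact_mod_cast hqd
    have h1 := hqd'.trans (Int.gcd_dvd_left _ _)
    exact h q (Nat.prime_iff_prime_int.1 hq) (h1.trans (Int.gcd_dvd_left _ _))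
      (h1.trans (Int.gcd_dvd_right _ _)) (hqd'.trans (Int.gcd_dvd_right _ _))
  have hb : ∃ r s t : ℤ, r * u + s * v + t * w = 1 := by
    have e1 := Int.gcd_eq_gcd_ab u v
    have e2 := Int.gcd_eq_gcd_ab (Int.gcd u v) w
    rw [hg] at e2
    set A := Int.gcdA (Int.gcd u v) w
    refine ⟨Int.gcdA u v * A, Int.gcdB u v * A, Int.gcdB (Int.gcd u v) w, ?_⟩
    push_cast at e2
    linear_combination (-1) * e2 - A * e1
  obtain ⟨r, s, t, hb⟩ := hb
  have : p = r * p * u + s * (p * v) + t * (p * w) := by linear_combination (-p) * hb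
  rw [this]
  exact dvd_add (dvd_add (dvd_mul_left _ _) (hv.mul_left _)) (hw.mul_left _)

theorem no_common_prime {a d a' d' : ℤ} (h : IsCoprime a d) (h' : IsCoprime a' d') (q : ℤ)
    (hq : Prime q) (h1 : q ∣ d ^ 2 * d' ^ 2) (h2 : q ∣ a * d' ^ 2 + a' * d ^ 2)
    (h3 : q ∣ a * a') : False := by
  have key : ∀ {a d a' d' : ℤ}, IsCoprime a d → IsCoprime a' d' → q ∣ d →
      q ∣ a * d' ^ 2 + a' * d ^ 2 → q ∣ a * a' → False := by
    intro a d a' d' h h' h1 h2 h3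
    have ha : ¬ q ∣ a := fun hqa => hq.not_isUnit (h.isUnit_of_dvd' hqa h1)
    have ha' := (hq.dvd_or_dvd h3).resolve_left ha
    have h4 : q ∣ a * d' ^ 2 := (dvd_add_left ((dvd_pow h1 two_ne_zero).mul_left a')).1 h2
    have h5 := hq.dvd_of_dvd_pow ((hq.dvd_or_dvd h4).resolve_left ha)
    exact hq.not_isUnit (h'.isUnit_of_dvd' ha' h5)
  rcases hq.dvd_or_dvd h1 with h1 | h1
  · exact key h h' (hq.dvd_of_dvd_pow h1) h2 h3
  · exact key h' h (hq.dvd_of_dvd_pow h1) (by rwa [add_comm]) (by rwa [mul_comm])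

theorem parallelogram_aux {p q r a d a' d' : ℤ} (h : IsCoprime a d) (h' : IsCoprime a' d')
    (hd : d ≠ 0) (hd' : d' ≠ 0)
    (hq : p * (a * d' ^ 2 + a' * d ^ 2) = q * (d ^ 2 * d' ^ 2))
    (hr : p * (a * a') = r * (d ^ 2 * d' ^ 2)) :
    ∃ g, p = g * (d ^ 2 * d' ^ 2) ∧ q = g * (a * d' ^ 2 + a' * d ^ 2) ∧ r = g * (a * a') := by
  have hne : d ^ 2 * d' ^ 2 ≠ 0 := by positivity
  obtain ⟨g, hg⟩ := dvd_of_dvd_mul_of_no_common_prime (Dvd.intro_left _ hq.symm)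
    (Dvd.intro_left _ hr.symm) (no_common_prime h h')
  refine ⟨g, by rw [hg]; ring, ?_, ?_⟩
  · apply mul_right_cancel₀ hne
    rw [← hq, hg]; ring
  · apply mul_right_cancel₀ hne
    rw [← hr, hg]; ring

theorem neg_some' {x y : ℚ} (h : (mordellCurve D).Nonsingular x y) :
    ∃ h', -(Point.some x y h) = Point.some x (-y) h' := by
  refine ⟨?_, ?_⟩
  · have := (WeierstrassCurve.Affine.nonsingular_neg x y).2 h
    simpa [WeierstrassCurve.Affine.negY] using this
  · rw [Point.neg_some]
    simp [WeierstrassCurve.Affine.negY]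

theorem some_congr {x y x' y' : ℚ} (h : (mordellCurve D).Nonsingular x y) (hx : x = x')
    (hy : y = y') : ∃ h', Point.some x y h = Point.some x' y' h' := by
  subst hx hy
  exact ⟨h, rfl⟩

theorem add_some_of_X_ne {x₁ x₂ y₁ y₂ : ℚ} (h₁ : (mordellCurve D).Nonsingular x₁ y₁)
    (h₂ : (mordellCurve D).Nonsingular x₂ y₂) (hx : x₁ ≠ x₂) {l x₃ y₃ : ℚ}
    (hl : l * (x₁ - x₂) = y₁ - y₂) (hx₃ : x₃ = l ^ 2 - x₁ - x₂)
    (hy₃ : y₃ = -(y₁ + l * (x₃ - x₁))) :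
    ∃ h, Point.some x₁ y₁ h₁ + Point.some x₂ y₂ h₂ = Point.some x₃ y₃ h := by
  have hsl : (mordellCurve D).slope x₁ x₂ y₁ y₂ = l := by
    rw [WeierstrassCurve.Affine.slope_of_X_ne hx, ← hl]
    exact mul_div_cancel_right₀ _ (sub_ne_zero.2 hx)
  rw [Point.add_of_X_ne hx]
  apply some_congr
  · rw [hsl, hx₃]
    simp [WeierstrassCurve.Affine.addX]
  · rw [hsl, hy₃, hx₃]
    simp [WeierstrassCurve.Affine.addX, WeierstrassCurve.Affine.addY,
      WeierstrassCurve.Affine.negAddY, WeierstrassCurve.Affine.negY]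
    ring

theorem add_self_some {x y : ℚ} (h : (mordellCurve D).Nonsingular x y) (hy : y ≠ 0)
    {l x₃ y₃ : ℚ} (hl : l * (2 * y) = 3 * x ^ 2) (hx₃ : x₃ = l ^ 2 - 2 * x)
    (hy₃ : y₃ = -(y + l * (x₃ - x))) :
    ∃ h', Point.some x y h + Point.some x y h = Point.some x₃ y₃ h' := by
  have hy' : y ≠ (mordellCurve D).negY x y := by
    intro h
    simp only [WeierstrassCurve.Affine.negY, zero_mul, sub_zero] at h
    exact hy (by linarith)
  have hsl : (mordellCurve D).slope x x y y = l := by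
    rw [WeierstrassCurve.Affine.slope_of_Y_ne rfl hy']
    simp only [WeierstrassCurve.Affine.negY]
    rw [div_eq_iff (by simpa [← two_mul] using hy)]
    linear_combination -hl
  rw [Point.add_self_of_Y_ne hy']
  apply some_congr
  · rw [hsl, hx₃]
    simp [WeierstrassCurve.Affine.addX]
    ring
  · rw [hsl, hy₃, hx₃]
    simp [WeierstrassCurve.Affine.addX, WeierstrassCurve.Affine.addY,
      WeierstrassCurve.Affine.negAddY, WeierstrassCurve.Affine.negY]
    ring

/-- The quasi-parallelogram law for reduced coordinates. -/
theorem parallelogram (hD : 0 < D) (P Q : (mordellCurve D).Point) : ∃ g : ℤ, 0 < g ∧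
    (num P * den Q ^ 2 - num Q * den P ^ 2) ^ 2 = g * (den (P + Q) ^ 2 * den (P - Q) ^ 2) ∧
    2 * (num P * num Q * (num P * den Q ^ 2 + num Q * den P ^ 2) - 2 * D * den P ^ 4 * den Q ^ 4) =
      g * (num (P + Q) * den (P - Q) ^ 2 + num (P - Q) * den (P + Q) ^ 2) ∧
    (num P * num Q) ^ 2 +
        4 * D * (num P * den Q ^ 2 + num Q * den P ^ 2) * den P ^ 2 * den Q ^ 2 =
      g * (num (P + Q) * num (P - Q)) := by
  have pos_of : ∀ {g : ℤ}, (num P * num Q) ^ 2 +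
        4 * D * (num P * den Q ^ 2 + num Q * den P ^ 2) * den P ^ 2 * den Q ^ 2 =
      g * (num (P + Q) * num (P - Q)) → 0 < g := by
    intro g hg
    have h1 := num_pos hD P
    have h2 := num_pos hD Q
    have h3 := num_pos hD (P + Q)
    have h4 := num_pos hD (P - Q)
    have h5 := den_nonneg P
    have h6 := den_nonneg Q
    have : 0 < g * (num (P + Q) * num (P - Q)) := by rw [← hg]; positivity
    exact pos_of_mul_pos_left this (by positivity)
  suffices ∃ g : ℤ,
    (num P * den Q ^ 2 - num Q * den P ^ 2) ^ 2 = g * (den (P + Q) ^ 2 * den (P - Q) ^ 2) ∧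
    2 * (num P * num Q * (num P * den Q ^ 2 + num Q * den P ^ 2) - 2 * D * den P ^ 4 * den Q ^ 4) =
      g * (num (P + Q) * den (P - Q) ^ 2 + num (P - Q) * den (P + Q) ^ 2) ∧
    (num P * num Q) ^ 2 +
        4 * D * (num P * den Q ^ 2 + num Q * den P ^ 2) * den P ^ 2 * den Q ^ 2 =
      g * (num (P + Q) * num (P - Q)) by
    obtain ⟨g, h1, h2, h3⟩ := this
    exact ⟨g, pos_of h3, h1, h2, h3⟩
  clear pos_of
  have double : ∀ P : (mordellCurve D).Point, ∃ g : ℤ,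
      2 * (num P * num P * (num P * den P ^ 2 + num P * den P ^ 2)
        - 2 * D * den P ^ 4 * den P ^ 4) = g * den (P + P) ^ 2 ∧
      (num P * num P) ^ 2 +
        4 * D * (num P * den P ^ 2 + num P * den P ^ 2) * den P ^ 2 * den P ^ 2 =
      g * num (P + P) := by
    intro P
    rcases P with _ | ⟨x, y, h⟩
    · exact ⟨1, by simp [← Point.zero_def], by simp [← Point.zero_def]⟩
    by_cases hy : y = 0
    · have h0 : Point.some x y h + Point.some x y h = 0 :=
        Point.add_self_of_Y_eq (by simp [WeierstrassCurve.Affine.negY, hy])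
      have hs := ynum_sq (.some x y h)
      rw [h0]
      refine ⟨_, ?_, (mul_one _).symm⟩
      have : ynum (.some x y h) = 0 := by simp [ynum, hy]
      rw [this] at hs
      rw [den_zero]
      linear_combination (-4) * den (.some x y h) ^ 2 * hs
    · obtain ⟨h', e⟩ := add_self_some h hy (l := 3 * x ^ 2 / (2 * y)) (by field_simp) rfl rfl
      obtain ⟨h1, h2, h3, h4⟩ := some_spec h
      obtain ⟨h1', h2', -, h4'⟩ := some_spec h'
      have hs := (equation_iff x y).1 h.1
      rw [e]
      generalize num (.some x y h) = a at *
      generalize den (.some x y h) = d at *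
      generalize num (.some _ _ h') = a' at *
      generalize den (.some _ _ h') = d' at *
      have hd : (d : ℚ) ≠ 0 := by exact_mod_cast h1.ne'
      have hd' : (d' : ℚ) ≠ 0 := by exact_mod_cast h1'.ne'
      have hdbl : 4 * (x ^ 3 - D) * a' = (x ^ 4 + 8 * D * x) * d' ^ 2 := by
        have : (3 * x ^ 2 / (2 * y)) ^ 2 - 2 * x = (x ^ 4 + 8 * D * x) / (4 * (x ^ 3 - D)) := by
          rw [← hs]
          field_simp
          linear_combination (-32) * x * hs
        rw [this] at h2'
        have hne : x ^ 3 - D ≠ 0 := by rw [← hs]; positivity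
        field_simp at h2'
        linarith
      rw [h2] at hdbl
      field_simp at hdbl
      have hdbl' : (4 * (a ^ 3 - D * d ^ 6)) * d ^ 2 * a' =
          (a ^ 4 + 8 * D * d ^ 6 * a) * d' ^ 2 := by
        have : (((4 * (a ^ 3 - D * d ^ 6)) * d ^ 2 * a' : ℤ) : ℚ) =
          ((a ^ 4 + 8 * D * d ^ 6 * a) * d' ^ 2 : ℤ) := by push_cast; linear_combination hdbl
        exact_mod_cast this
      have : d' ^ 2 ∣ (4 * (a ^ 3 - D * d ^ 6)) * d ^ 2 :=
        h4'.symm.pow_left.dvd_of_dvd_mul_right (Dvd.intro_left _ hdbl'.symm)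
      obtain ⟨g, hg⟩ := this
      refine ⟨g, by linear_combination hg, ?_⟩
      have hne : d' ^ 2 ≠ 0 := by positivity
      apply mul_right_cancel₀ hne
      linear_combination (-1) * hdbl' + a' * hg
  rcases P with _ | ⟨x₁, y₁, hP⟩
  · exact ⟨1, by simp [← Point.zero_def, zero_sub, zero_add]; ring,
      by simp [← Point.zero_def]; ring, by simp [← Point.zero_def]; ring⟩
  rcases Q with _ | ⟨x₂, y₂, hQ⟩
  · exact ⟨1, by simp [← Point.zero_def]; ring,
      by simp [← Point.zero_def]; ring, by simp [← Point.zero_def]; ring⟩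
  by_cases hx : x₁ = x₂
  · rcases Point.X_eq_iff (h₁ := hP) (h₂ := hQ) |>.1 hx with e | e
    · rw [← e]
      obtain ⟨g, h1, h2⟩ := double (.some x₁ y₁ hP)
      exact ⟨g, by simp, by simp [h1], by simp [h2]⟩
    · have e' : Point.some x₂ y₂ hQ = -Point.some x₁ y₁ hP := by rw [e, neg_neg]
      rw [e']
      obtain ⟨g, h1, h2⟩ := double (.some x₁ y₁ hP)
      generalize Point.some x₁ y₁ hP = R at *
      exact ⟨g, by simp, by simp [h1], by simp [h2]⟩
  · obtain ⟨hQ', eQ⟩ := neg_some' hQ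
    have hx' := sub_ne_zero.2 hx
    obtain ⟨hp, ep⟩ := add_some_of_X_ne hP hQ hx (l := (y₁ - y₂) / (x₁ - x₂))
      (by field_simp) rfl rfl
    obtain ⟨hm, em⟩ := add_some_of_X_ne hP hQ' hx (l := (y₁ + y₂) / (x₁ - x₂))
      (by field_simp; ring) rfl rfl
    rw [← eQ, ← sub_eq_add_neg] at em
    rw [em, ep]
    obtain ⟨d1, e1, -, c1⟩ := some_spec hP
    obtain ⟨d2, e2, -, c2⟩ := some_spec hQ
    obtain ⟨d3, e3, -, c3⟩ := some_spec hp
    obtain ⟨d4, e4, -, c4⟩ := some_spec hm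
    have s1 := (equation_iff x₁ y₁).1 hP.1
    have s2 := (equation_iff x₂ y₂).1 hQ.1
    generalize num (.some x₁ y₁ hP) = a₁ at *
    generalize den (.some x₁ y₁ hP) = d₁ at *
    generalize num (.some x₂ y₂ hQ) = a₂ at *
    generalize den (.some x₂ y₂ hQ) = d₂ at *
    generalize num (.some _ _ hp) = a₃ at *
    generalize den (.some _ _ hp) = d₃ at *
    generalize num (.some _ _ hm) = a₄ at *
    generalize den (.some _ _ hm) = d₄ at *
    have n1 : (d₁ : ℚ) ≠ 0 := by exact_mod_cast d1.ne'
    have n2 : (d₂ : ℚ) ≠ 0 := by exact_mod_cast d2.ne'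
    have n3 : (d₃ : ℚ) ≠ 0 := by exact_mod_cast d3.ne'
    have n4 : (d₄ : ℚ) ≠ 0 := by exact_mod_cast d4.ne'
    have sum : (x₁ - x₂) ^ 2 * (a₃ / (d₃ : ℚ) ^ 2 + a₄ / (d₄ : ℚ) ^ 2) =
        2 * (x₁ * x₂ * (x₁ + x₂) - 2 * D) := by
      rw [← e3, ← e4]
      field_simp
      linear_combination 2 * s1 + 2 * s2
    have prod : (x₁ - x₂) ^ 2 * (a₃ / (d₃ : ℚ) ^ 2 * (a₄ / (d₄ : ℚ) ^ 2)) =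
        (x₁ * x₂) ^ 2 + 4 * D * (x₁ + x₂) := by
      rw [← e3, ← e4]
      field_simp
      have i1 : y₁ ^ 4 = (x₁ ^ 3 - D) ^ 2 := by rw [← s1]; ring
      have i2 : y₂ ^ 4 = (x₂ ^ 3 - D) ^ 2 := by rw [← s2]; ring
      have i3 : y₁ ^ 2 * y₂ ^ 2 = (x₁ ^ 3 - D) * (x₂ ^ 3 - D) := by rw [← s1, ← s2]
      linear_combination i1 + i2 - 2 * i3 - 2 * (x₁ + x₂) * (x₁ - x₂) ^ 2 * (s1 + s2)
    rw [e1, e2] at sum prod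
    field_simp at sum prod
    apply parallelogram_aux c3 c4 d3.ne' d4.ne'
    · have : (((a₁ * d₂ ^ 2 - a₂ * d₁ ^ 2) ^ 2 * (a₃ * d₄ ^ 2 + a₄ * d₃ ^ 2) : ℤ) : ℚ) =
        (2 * (a₁ * a₂ * (a₁ * d₂ ^ 2 + a₂ * d₁ ^ 2) - 2 * D * d₁ ^ 4 * d₂ ^ 4) *
          (d₃ ^ 2 * d₄ ^ 2) : ℤ) := by
        push_cast
        linear_combination sum
      exact_mod_cast this
    · have : (((a₁ * d₂ ^ 2 - a₂ * d₁ ^ 2) ^ 2 * (a₃ * a₄) : ℤ) : ℚ) =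
        (((a₁ * a₂) ^ 2 + 4 * D * (a₁ * d₂ ^ 2 + a₂ * d₁ ^ 2) * d₁ ^ 2 * d₂ ^ 2) *
          (d₃ ^ 2 * d₄ ^ 2) : ℤ) := by
        push_cast
        linear_combination prod
      exact_mod_cast this

theorem not_dvd_num_add (hD : 0 < D) {q : ℤ} (hq : Prime q) (hqD : q ∣ 4 * D)
    {P Q : (mordellCurve D).Point} (hP : ¬ q ∣ num P) (hQ : ¬ q ∣ num Q) :
    ¬ q ∣ num (P + Q) := by
  intro h
  obtain ⟨g, -, -, -, hL⟩ := parallelogram hD P Q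
  have h1 : q ∣ (num P * num Q) ^ 2 +
      4 * D * (num P * den Q ^ 2 + num Q * den P ^ 2) * den P ^ 2 * den Q ^ 2 := by
    rw [hL]
    exact (h.mul_right _).mul_left _
  have h2 := (dvd_add_left (((hqD.mul_right _).mul_right _).mul_right _)).1 h1
  rcases hq.dvd_or_dvd (hq.dvd_of_dvd_pow h2) with h3 | h3
  · exact hP h3
  · exact hQ h3

/-- Points whose abscissa has numerator prime to a prime divisor `q` of `4 * D`. -/
def numSubgroup (hD : 0 < D) {q : ℤ} (hq : Prime q) (hqD : q ∣ 4 * D) :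
    AddSubgroup (mordellCurve D).Point where
  carrier := {P | ¬ q ∣ num P}
  add_mem' := not_dvd_num_add hD hq hqD
  zero_mem' := by
    simp only [Set.mem_ofPred_eq, num_zero]
    exact fun h => hq.not_isUnit (isUnit_of_dvd_one h)
  neg_mem' := by simp

theorem not_dvd_num_zsmul (hD : 0 < D) {q : ℤ} (hq : Prime q) (hqD : q ∣ 4 * D)
    {P : (mordellCurve D).Point} (hP : ¬ q ∣ num P) (n : ℤ) : ¬ q ∣ num (n • P) :=
  (numSubgroup hD hq hqD).zsmul_mem hP n

theorem pow_dvd_or_pow_dvd {q x y : ℤ} (hq : Prime q) {v : ℕ} (h : q ^ (2 * v) ∣ x * y) :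
    q ^ v ∣ x ∨ q ^ v ∣ y := by
  by_contra! hc
  have h1 := emultiplicity_lt_iff_not_dvd.2 hc.1
  have h2 := emultiplicity_lt_iff_not_dvd.2 hc.2
  have h3 := pow_dvd_iff_le_emultiplicity.1 h
  rw [emultiplicity_mul hq] at h3
  obtain ⟨m, hm⟩ := ENat.ne_top_iff_exists.1 h1.ne_top
  obtain ⟨n, hn⟩ := ENat.ne_top_iff_exists.1 h2.ne_top
  rw [← hm] at h1 h3
  rw [← hn] at h2 h3
  norm_cast at h1 h2 h3
  omega

theorem pow_dvd_den_add (hD : 0 < D) {q : ℤ} (hq : Prime q) {v : ℕ}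
    {P Q : (mordellCurve D).Point} (hP : q ^ v ∣ den P) (hQ : q ^ v ∣ den Q) :
    q ^ v ∣ den (P + Q) := by
  rcases Nat.eq_zero_or_pos v with rfl | hv
  · simp
  obtain ⟨g, -, hN, hM, hL⟩ := parallelogram hD P Q
  have hcop : ∀ R : (mordellCurve D).Point, q ∣ den R → ¬ q ∣ num R := fun R h h' =>
    hq.not_isUnit ((isCoprime_num_den R).isUnit_of_dvd' h' h)
  have hq1 : q ∣ q ^ v := dvd_pow_self q hv.ne'
  have hP' := hcop P (hq1.trans hP)
  have hQ' := hcop Q (hq1.trans hQ)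
  have hg : ¬ q ∣ g := by
    intro hg
    have h1 : q ∣ (num P * num Q) ^ 2 +
        4 * D * (num P * den Q ^ 2 + num Q * den P ^ 2) * den P ^ 2 * den Q ^ 2 := by
      rw [hL]
      exact hg.mul_right _
    have h2 := (dvd_add_left ((dvd_pow (hq1.trans hQ) two_ne_zero).mul_left _)).1 h1
    rcases hq.dvd_or_dvd (hq.dvd_of_dvd_pow h2) with h3 | h3
    · exact hP' h3
    · exact hQ' h3
  have hP2 : q ^ (2 * v) ∣ den P ^ 2 := by
    rw [mul_comm, pow_mul]; exact pow_dvd_pow_of_dvd hP 2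
  have hQ2 : q ^ (2 * v) ∣ den Q ^ 2 := by
    rw [mul_comm, pow_mul]; exact pow_dvd_pow_of_dvd hQ 2
  have hprod : q ^ (2 * v) ∣ den (P + Q) * den (P - Q) := by
    have h1 : q ^ (2 * v) ∣ num P * den Q ^ 2 - num Q * den P ^ 2 :=
      dvd_sub (hQ2.mul_left _) (hP2.mul_left _)
    have h2 := pow_dvd_pow_of_dvd h1 2
    rw [hN, ← pow_mul] at h2
    have h3 := hq.pow_dvd_of_dvd_mul_left _ hg h2
    rw [pow_mul, ← mul_pow] at h3
    exact (Int.pow_dvd_pow_iff two_ne_zero).1 h3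
  have hsum : q ^ (2 * v) ∣
      num (P + Q) * den (P - Q) ^ 2 + num (P - Q) * den (P + Q) ^ 2 := by
    apply hq.pow_dvd_of_dvd_mul_left _ hg
    rw [← hM]
    apply Dvd.dvd.mul_left
    apply dvd_sub
    · exact (dvd_add (hQ2.mul_left _) (hP2.mul_left _)).mul_left _
    · rw [show den Q ^ 4 = den Q ^ 2 * den Q ^ 2 by ring]
      exact (hQ2.mul_right _).mul_left _
  rcases pow_dvd_or_pow_dvd hq hprod with h | h
  · exact h
  · have h2 : q ^ (2 * v) ∣ den (P - Q) ^ 2 := by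
      rw [mul_comm, pow_mul]; exact pow_dvd_pow_of_dvd h 2
    have h3 := (dvd_add_right (h2.mul_left _)).1 hsum
    have h4 := hq.pow_dvd_of_dvd_mul_left _ (hcop _ (hq1.trans h)) h3
    rw [mul_comm, pow_mul] at h4
    exact (Int.pow_dvd_pow_iff two_ne_zero).1 h4

/-- Points whose denominator is divisible by a given prime power. -/
def denSubgroup (hD : 0 < D) {q : ℤ} (hq : Prime q) (v : ℕ) :
    AddSubgroup (mordellCurve D).Point where
  carrier := {P | q ^ v ∣ den P}
  add_mem' := pow_dvd_den_add hD hq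
  zero_mem' := by simp
  neg_mem' := by simp

theorem pow_dvd_den_zsmul (hD : 0 < D) {q : ℤ} (hq : Prime q) {v : ℕ}
    {P : (mordellCurve D).Point} (hP : q ^ v ∣ den P) (n : ℤ) : q ^ v ∣ den (n • P) :=
  (denSubgroup hD hq v).zsmul_mem hP n

theorem dvd_den_zsmul (hD : 0 < D) {q : ℤ} (hq : Prime q)
    {P : (mordellCurve D).Point} (hP : q ∣ den P) (n : ℤ) : q ∣ den (n • P) := by
  have := pow_dvd_den_zsmul hD hq (v := 1) (P := P) (by simpa using hP) n
  simpa using this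

/-- If `Q` reduces to the origin at `3` while `P` does not, and the numerator of `Q` is prime to
`2 * D`, then no cancellation occurs in the parallelogram law. -/
theorem den_add_mul_den_sub (hD : 0 < D) {P Q : (mordellCurve D).Point}
    (hQ : ∀ q : ℤ, Prime q → q ∣ 4 * D → ¬ q ∣ num Q) (hQ3 : 3 ∣ den Q) (hP3 : ¬ 3 ∣ den P) :
    (num P * den Q ^ 2 - num Q * den P ^ 2) ^ 2 = (den (P + Q) * den (P - Q)) ^ 2 := by
  obtain ⟨g, hg, hN, hM, hL⟩ := parallelogram hD P Q
  suffices g = 1 by rw [hN, this]; ring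
  by_contra hne
  obtain ⟨q', hq', hqg'⟩ := Int.exists_prime_and_dvd (n := g) (by omega)
  set q : ℤ := q'
  have hq : Prime q := hq'
  have hqN : q ∣ num P * den Q ^ 2 - num Q * den P ^ 2 :=
    hq.dvd_of_dvd_pow (hN ▸ hqg'.mul_right _)
  have hqM := hM ▸ hqg'.mul_right
    (num (P + Q) * den (P - Q) ^ 2 + num (P - Q) * den (P + Q) ^ 2)
  have hqL := hL ▸ hqg'.mul_right (num (P + Q) * num (P - Q))
  have cP : q ∣ num P → q ∣ den P → False := fun h h' =>
    hq.not_isUnit ((isCoprime_num_den P).isUnit_of_dvd' h h')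
  have cQ : q ∣ num Q → q ∣ den Q → False := fun h h' =>
    hq.not_isUnit ((isCoprime_num_den Q).isUnit_of_dvd' h h')
  have hq4D : ¬ q ∣ 4 * D := by
    intro h
    have hQq := hQ q hq h
    have h1 := hq.dvd_of_dvd_pow
      ((dvd_add_left (((h.mul_right _).mul_right _).mul_right _)).1 hqL)
    have h2 := (hq.dvd_or_dvd h1).resolve_right hQq
    have h3 := (dvd_sub_right (h2.mul_right _)).1 hqN
    exact cP h2 (hq.dvd_of_dvd_pow ((hq.dvd_or_dvd h3).resolve_left hQq))
  have hq3 : ¬ q ∣ 3 := by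
    intro h
    have hass : Associated q 3 := hq.associated_of_dvd Int.prime_three h
    have hQq : q ∣ den Q := h.trans hQ3
    have h3 := (dvd_sub_right ((dvd_pow hQq two_ne_zero).mul_left (num P))).1 hqN
    have h4 := hq.dvd_of_dvd_pow ((hq.dvd_or_dvd h3).resolve_left fun h => cQ h hQq)
    exact hP3 (hass.symm.dvd.trans h4)
  have hq18D : ¬ q ∣ 18 * D := by
    intro h
    have h' : q ∣ 3 * 3 * (4 * D) := by
      exact (h.mul_left 2).trans (dvd_of_eq (by ring))
    rcases hq.dvd_or_dvd h' with h | h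
    · rcases hq.dvd_or_dvd h with h | h <;> exact hq3 h
    · exact hq4D h
  set s := num P * num Q with hs
  set t := num P * den Q ^ 2 + num Q * den P ^ 2 with ht
  set u := den P ^ 2 * den Q ^ 2 with hu
  have e1 : q ∣ t ^ 2 - 4 * s * u := by
    exact (dvd_pow hqN two_ne_zero).trans (dvd_of_eq (by rw [hs, ht, hu]; ring))
  have e2 : q ∣ 2 * (t * s) - 4 * D * u ^ 2 := by
    exact hqM.trans (dvd_of_eq (by rw [hu]; ring))
  have e3 : q ∣ s ^ 2 + 4 * D * t * u := by
    exact hqL.trans (dvd_of_eq (by rw [hu]; ring))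
  have fin : q ∣ u → False := by
    intro h
    have h1 : q ∣ t := hq.dvd_of_dvd_pow ((dvd_sub_left (h.mul_left _)).1 e1)
    have h2 : q ∣ s := hq.dvd_of_dvd_pow ((dvd_add_left (h.mul_left _)).1 e3)
    exact no_common_prime (isCoprime_num_den P) (isCoprime_num_den Q) q hq h h1 h2
  have h4 : q ∣ 18 * D * (t * u ^ 2) * 2 := by
    exact (((e1.mul_left (2 * s)).sub (e2.mul_left t)).add (e3.mul_left (8 * u))).trans
      (dvd_of_eq (by ring))
  have hq2 : ¬ q ∣ 2 := fun h => hq4D ((h.trans (by norm_num : (2 : ℤ) ∣ 4)).mul_right D)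
  have h5 := (hq.dvd_or_dvd ((hq.dvd_or_dvd h4).resolve_right hq2)).resolve_left hq18D
  rcases hq.dvd_or_dvd h5 with h | h
  · have h6 := (dvd_sub_right ((h.mul_right s).mul_left 2)).1 e2
    exact fin (hq.dvd_of_dvd_pow ((hq.dvd_or_dvd h6).resolve_left hq4D))
  · exact fin (hq.dvd_of_dvd_pow h)

/-- Height bound for a sum of two points. -/
theorem num_add_le (hD : 0 < D) (P Q : (mordellCurve D).Point) :
    num (P + Q) ≤ 9 * (num P ^ 2 * num Q ^ 2) := by
  obtain ⟨g, hg, -, -, hL⟩ := parallelogram hD P Q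
  have hP := num_pos hD P
  have hQ := num_pos hD Q
  have h1 := num_pos hD (P + Q)
  have h2 := num_pos hD (P - Q)
  have hPd := den_nonneg P
  have hQd := den_nonneg Q
  have hle : num (P + Q) ≤ g * (num (P + Q) * num (P - Q)) := by
    have : 1 ≤ g * num (P - Q) := by have := mul_pos hg h2; omega
    nlinarith
  rw [← hL] at hle
  have bP : D * den P ^ 6 ≤ num P ^ 3 := by nlinarith [ynum_sq P, sq_nonneg (ynum P)]
  have bQ : D * den Q ^ 6 ≤ num Q ^ 3 := by nlinarith [ynum_sq Q, sq_nonneg (ynum Q)]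
  generalize num P = a at *
  generalize num Q = c at *
  generalize den P = d at *
  generalize den Q = e at *
  -- the two mixed terms are bounded by `(a * c) ^ 2`
  have m1 : D * d ^ 2 * e ^ 4 ≤ a * c ^ 2 := by
    apply le_of_pow_le_pow_left₀ three_ne_zero (by positivity)
    calc (D * d ^ 2 * e ^ 4) ^ 3 = (D * d ^ 6) * (D * e ^ 6) ^ 2 := by ring
      _ ≤ a ^ 3 * (c ^ 3) ^ 2 := by gcongr
      _ = (a * c ^ 2) ^ 3 := by ring
  have m2 : D * d ^ 4 * e ^ 2 ≤ a ^ 2 * c := by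
    apply le_of_pow_le_pow_left₀ three_ne_zero (by positivity)
    calc (D * d ^ 4 * e ^ 2) ^ 3 = (D * d ^ 6) ^ 2 * (D * e ^ 6) := by ring
      _ ≤ (a ^ 3) ^ 2 * c ^ 3 := by gcongr
      _ = (a ^ 2 * c) ^ 3 := by ring
  nlinarith [mul_le_mul_of_nonneg_left m1 hP.le, mul_le_mul_of_nonneg_left m2 hQ.le]

theorem triple_formula {x y c l m x₂ : ℚ} (hs : y ^ 2 = x ^ 3 - c) (hy : y ≠ 0)
    (hl : l * (2 * y) = 3 * x ^ 2) (hx₂ : x₂ = l ^ 2 - 2 * x) (hne : x₂ - x ≠ 0)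
    (hm : m * (x₂ - x) = -(y + l * (x₂ - x)) - y) :
    (m ^ 2 - x₂ - x) * (9 * x ^ 2 * (x ^ 3 - 4 * c) ^ 2) =
      x ^ 9 + 96 * c * x ^ 6 + 48 * c ^ 2 * x ^ 3 - 64 * c ^ 3 := by
  have hsub : 4 * y ^ 2 * (x₂ - x) = -(3 * x * (x ^ 3 - 4 * c)) := by
    rw [hx₂]
    linear_combination (l * (2 * y) + 3 * x ^ 2) * hl - 12 * x * hs
  have hml : (m + l) * (3 * x * (x ^ 3 - 4 * c)) = 8 * y ^ 3 := by
    have : (x₂ - x) * ((m + l) * (3 * x * (x ^ 3 - 4 * c)) - 8 * y ^ 3) = 0 := by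
      linear_combination (3 * x * (x ^ 3 - 4 * c)) * hm - 2 * y * hsub
    rcases mul_eq_zero.1 this with h | h
    · exact absurd h hne
    · linarith
  have hmy : m * (3 * x * (x ^ 3 - 4 * c)) * (2 * y) =
      16 * y ^ 4 - 9 * x ^ 3 * (x ^ 3 - 4 * c) := by
    linear_combination (2 * y) * hml - (3 * x * (x ^ 3 - 4 * c)) * hl
  have hx₂y : 4 * y ^ 2 * (x₂ + x) = 9 * x ^ 4 - 4 * x * y ^ 2 := by
    rw [hx₂]
    linear_combination (l * (2 * y) + 3 * x ^ 2) * hl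
  apply mul_left_cancel₀ (show 4 * y ^ 2 ≠ 0 by positivity)
  have i4 : y ^ 4 = (x ^ 3 - c) ^ 2 := by rw [← hs]; ring
  have step : 4 * y ^ 2 * ((m ^ 2 - x₂ - x) * (9 * x ^ 2 * (x ^ 3 - 4 * c) ^ 2)) =
      (16 * y ^ 4 - 9 * x ^ 3 * (x ^ 3 - 4 * c)) ^ 2 -
        (9 * x ^ 4 - 4 * x * y ^ 2) * (9 * x ^ 2 * (x ^ 3 - 4 * c) ^ 2) := by
    rw [← hmy, ← hx₂y]; ring
  rw [step, i4, hs]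
  ring

/-- The abscissa of `3 • Q` in terms of the abscissa of `Q`. -/
theorem triple_abscissa (hD : 0 < D) (Q : (mordellCurve D).Point) :
    num (Q + Q + Q) * (9 * num Q ^ 2 * (num Q ^ 3 - 4 * (D * den Q ^ 6)) ^ 2 * den Q ^ 2) =
      ((num Q ^ 3) ^ 3 + 96 * (D * den Q ^ 6) * (num Q ^ 3) ^ 2 +
        48 * (D * den Q ^ 6) ^ 2 * num Q ^ 3 - 64 * (D * den Q ^ 6) ^ 3) *
        den (Q + Q + Q) ^ 2 := by
  rcases Q with _ | ⟨x, y, h⟩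
  · simp [← Point.zero_def]
  by_cases hy : y = 0
  · have h0 : Point.some x y h + Point.some x y h = 0 :=
      Point.add_self_of_Y_eq (by simp [WeierstrassCurve.Affine.negY, hy])
    have hs := ynum_sq (.some x y h)
    rw [h0, zero_add]
    have : ynum (.some x y h) = 0 := by simp [ynum, hy]
    rw [this] at hs
    have hs' : D * den (.some x y h) ^ 6 = num (.some x y h) ^ 3 := by linarith
    rw [hs']
    ring
  obtain ⟨h', e⟩ := add_self_some h hy (l := 3 * x ^ 2 / (2 * y)) (by field_simp) rfl rfl
  obtain ⟨h1, h2, h3, h4⟩ := some_spec h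
  have hs := (equation_iff x y).1 h.1
  have hpos := num_pos hD (.some x y h)
  by_cases hx : (3 * x ^ 2 / (2 * y)) ^ 2 - 2 * x = x
  · have hz : Point.some x y h + Point.some x y h + Point.some x y h = 0 := by
      rw [e]
      rcases Point.X_eq_iff (h₁ := h') (h₂ := h) |>.1 hx with e' | e'
      · rw [e'] at e
        exact absurd (add_eq_left.1 e) (Point.some_ne_zero h)
      · rw [e', neg_add_cancel]
    rw [hz]
    simp only [num_zero, den_zero]
    have hc : x * (x ^ 3 - 4 * D) = 0 := by
      field_simp at hx
      linear_combination (-1 / 3) * hx - 4 * x * hs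
    rw [h2] at hc
    generalize num (.some x y h) = a at *
    generalize den (.some x y h) = d at *
    have hd : (d : ℚ) ≠ 0 := by exact_mod_cast h1.ne'
    have ha : (a : ℚ) ≠ 0 := by exact_mod_cast hpos.ne'
    field_simp at hc
    have hc' := (mul_eq_zero.1 (hc.trans (mul_zero _))).resolve_left ha
    have : a ^ 3 - 4 * (D * d ^ 6) = 0 := by
      have h' : ((a ^ 3 - 4 * (D * d ^ 6) : ℤ) : ℚ) = 0 := by push_cast; linear_combination hc'
      exact_mod_cast h'
    rw [this]; ring
  · have hx' := sub_ne_zero.2 hx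
    obtain ⟨h'', e'⟩ := add_some_of_X_ne h' h hx
      (l := (-(y + 3 * x ^ 2 / (2 * y) * ((3 * x ^ 2 / (2 * y)) ^ 2 - 2 * x - x)) - y) /
        ((3 * x ^ 2 / (2 * y)) ^ 2 - 2 * x - x)) (by rw [div_mul_cancel₀ _ hx']) rfl rfl
    rw [e, e']
    obtain ⟨h1', h2', -, -⟩ := some_spec h''
    have key := triple_formula hs hy (l := 3 * x ^ 2 / (2 * y)) (by field_simp) rfl hx'
      (div_mul_cancel₀ _ hx')
    rw [h2'] at key
    generalize num (.some x y h) = a at *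
    generalize den (.some x y h) = d at *
    generalize num (.some _ _ h'') = a' at *
    generalize den (.some _ _ h'') = d' at *
    have hd : (d : ℚ) ≠ 0 := by exact_mod_cast h1.ne'
    have hd' : (d' : ℚ) ≠ 0 := by exact_mod_cast h1'.ne'
    have ha : (a : ℚ) = x * d ^ 2 := by rw [h2]; field_simp
    have ha' : (a' : ℚ) = a' / d' ^ 2 * d' ^ 2 := by field_simp
    have goal : ((a' * (9 * a ^ 2 * (a ^ 3 - 4 * (D * d ^ 6)) ^ 2 * d ^ 2) : ℤ) : ℚ) =
        (((a ^ 3) ^ 3 + 96 * (D * d ^ 6) * (a ^ 3) ^ 2 + 48 * (D * d ^ 6) ^ 2 * a ^ 3 -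
          64 * (D * d ^ 6) ^ 3) * d' ^ 2 : ℤ) := by
      push_cast
      rw [ha', ha]
      linear_combination (d' : ℚ) ^ 2 * d ^ 18 * key
    exact_mod_cast goal

theorem triple_spec (hD : 0 < D) (Q : (mordellCurve D).Point) : ∃ g : ℤ, 0 < g ∧
    9 * num Q ^ 2 * (num Q ^ 3 - 4 * (D * den Q ^ 6)) ^ 2 * den Q ^ 2 =
      g * den (Q + Q + Q) ^ 2 ∧
    (num Q ^ 3) ^ 3 + 96 * (D * den Q ^ 6) * (num Q ^ 3) ^ 2 +
        48 * (D * den Q ^ 6) ^ 2 * num Q ^ 3 - 64 * (D * den Q ^ 6) ^ 3 =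
      g * num (Q + Q + Q) ∧
    (num Q ^ 3) ^ 3 ≤ g * num (Q + Q + Q) := by
  have h := triple_abscissa hD Q
  have hc := isCoprime_num_den (Q + Q + Q)
  have hnp := num_pos hD (Q + Q + Q)
  have hn := num_pos hD Q
  have hd := den_nonneg Q
  have hb : D * den Q ^ 6 ≤ num Q ^ 3 := by nlinarith [ynum_sq Q, sq_nonneg (ynum Q)]
  have hE : 0 ≤ D * den Q ^ 6 := by positivity
  have hA : 0 < num Q ^ 3 := by positivity
  generalize num Q ^ 3 = A at *
  generalize D * den Q ^ 6 = E at *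
  have hle : A ^ 3 ≤ A ^ 3 + 96 * E * A ^ 2 + 48 * E ^ 2 * A - 64 * E ^ 3 := by
    have h1 : E * E ^ 2 ≤ E * A ^ 2 := by gcongr
    have h2 : 0 ≤ E ^ 2 * A := by positivity
    have h3 : 0 ≤ E * A ^ 2 := by positivity
    linarith
  have hdvd : num (Q + Q + Q) ∣ A ^ 3 + 96 * E * A ^ 2 + 48 * E ^ 2 * A - 64 * E ^ 3 :=
    hc.pow_right.dvd_of_dvd_mul_right (Dvd.intro _ h)
  obtain ⟨g, hg⟩ := hdvd
  have hg' : A ^ 3 + 96 * E * A ^ 2 + 48 * E ^ 2 * A - 64 * E ^ 3 = g * num (Q + Q + Q) := by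
    rw [hg]; ring
  refine ⟨g, ?_, ?_, hg', hg' ▸ hle⟩
  · have : 0 < g * num (Q + Q + Q) := lt_of_lt_of_le (by positivity) (hg' ▸ hle)
    exact pos_of_mul_pos_left this hnp.le
  · apply mul_left_cancel₀ hnp.ne'
    rw [h, hg]; ring

/-- Cancellation in the tripling formula is bounded. -/
theorem pow_nine_le_of_num_eq (hD : 0 < D) (Q : (mordellCurve D).Point) {q A D' : ℤ} (hq : 0 < q)
    (hA : num Q = q * A) (hD' : D = q ^ 3 * D') (hAD : IsCoprime A D') :
    A ^ 9 ≤ 576 * 1728 ^ 2 * num (Q + Q + Q) := by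
  obtain ⟨g, hg, h1, h2, h3⟩ := triple_spec hD Q
  have hnp := num_pos hD (Q + Q + Q)
  have hAd : IsCoprime A (den Q) := by
    have := isCoprime_num_den Q
    rw [hA] at this
    exact this.of_mul_left_right
  have hF : IsCoprime A (D' * den Q ^ 6) := hAD.mul_right hAd.pow_right
  have hE : D * den Q ^ 6 = q ^ 3 * (D' * den Q ^ 6) := by
    linear_combination den Q ^ 6 * hD'
  rw [hE, hA] at h1 h2
  rw [hA] at h3
  have hFd : den Q ∣ D' * den Q ^ 6 := (dvd_pow_self _ (by norm_num)).mul_left _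
  generalize D' * den Q ^ 6 = F at *
  set N := (A ^ 3) ^ 3 + 96 * F * (A ^ 3) ^ 2 + 48 * F ^ 2 * A ^ 3 - 64 * F ^ 3 with hN
  have hcop : IsCoprime N (F ^ 9 * den Q ^ 2) := by
    refine IsCoprime.mul_right (IsCoprime.pow_right ?_) (IsCoprime.pow_right ?_)
    · have := (hF.pow_left.pow_left : IsCoprime ((A ^ 3) ^ 3) F).add_mul_left_left
        (96 * (A ^ 3) ^ 2 + 48 * F * A ^ 3 - 64 * F ^ 2)
      rwa [show (A ^ 3) ^ 3 + F * (96 * (A ^ 3) ^ 2 + 48 * F * A ^ 3 - 64 * F ^ 2) = N by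
        rw [hN]; ring] at this
    · obtain ⟨l, hl⟩ := hFd
      have := (hAd.pow_left.pow_left : IsCoprime ((A ^ 3) ^ 3) (den Q)).add_mul_left_left
        (l * (96 * (A ^ 3) ^ 2 + 48 * F * A ^ 3 - 64 * F ^ 2))
      rwa [show (A ^ 3) ^ 3 + den Q * (l * (96 * (A ^ 3) ^ 2 + 48 * F * A ^ 3 - 64 * F ^ 2)) = N by
        rw [hN]
        linear_combination -(96 * (A ^ 3) ^ 2 + 48 * F * A ^ 3 - 64 * F ^ 2) * hl] at this
  have d0 : g ∣ q ^ 9 * N := ⟨num (Q + Q + Q), by rw [← h2, hN]; ring⟩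
  have d1 : g ∣ q ^ 9 * (9 * A ^ 2 * (A ^ 3 - 4 * F) ^ 2 * den Q ^ 2) :=
    ⟨q * den (Q + Q + Q) ^ 2, by linear_combination q * h1⟩
  have d2 : g ∣ q ^ 9 * (576 * (A ^ 3 - 4 * F) ^ 2 * F ^ 3 * den Q ^ 2) := by
    have := (d1.mul_left (A * ((A ^ 3) ^ 2 + 96 * F * A ^ 3 + 48 * F ^ 2))).sub
      (d0.mul_left (9 * (A ^ 3 - 4 * F) ^ 2 * den Q ^ 2))
    exact this.trans (dvd_of_eq (by ring))
  have d3 : g ∣ q ^ 9 * (576 * 1728 ^ 2 * (F ^ 9 * den Q ^ 2)) := by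
    have := (d2.mul_left (((A ^ 3) ^ 2 + 100 * F * A ^ 3 + 448 * F ^ 2) ^ 2)).add
      (d0.mul_left (576 * (2 * 1728 * F ^ 3 - N) * F ^ 3 * den Q ^ 2))
    exact this.trans (dvd_of_eq (by ring))
  obtain ⟨r, s, hrs⟩ := hcop
  have d4 : g ∣ q ^ 9 * (576 * 1728 ^ 2) := by
    have := (d0.mul_left (576 * 1728 ^ 2 * r)).add (d3.mul_left s)
    exact this.trans (dvd_of_eq (by linear_combination q ^ 9 * (576 * 1728 ^ 2) * hrs))
  have hle := Int.le_of_dvd (by positivity) d4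
  have hq9 : 0 < q ^ 9 := by positivity
  refine le_of_mul_le_mul_left ?_ hq9
  calc q ^ 9 * A ^ 9 = ((q * A) ^ 3) ^ 3 := by ring
    _ ≤ g * num (Q + Q + Q) := h3
    _ ≤ q ^ 9 * (576 * 1728 ^ 2) * num (Q + Q + Q) := by gcongr
    _ = q ^ 9 * (576 * 1728 ^ 2 * num (Q + Q + Q)) := by ring

theorem num_pow_nine_le (hD : 0 < D) (Q : (mordellCurve D).Point) (hQ : IsCoprime (num Q) D) :
    num Q ^ 9 ≤ 576 * 1728 ^ 2 * num (Q + Q + Q) :=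
  pow_nine_le_of_num_eq hD Q one_pos (one_mul _).symm (by ring) hQ

theorem three_pow_dvd_den_triple (hD : 0 < D) {Q : (mordellCurve D).Point} {v : ℕ} (hv : v ≠ 0)
    (hQ : 3 ^ v ∣ den Q) : 3 ^ (v + 1) ∣ den (Q + Q + Q) := by
  obtain ⟨g, hg, h1, h2, h3⟩ := triple_spec hD Q
  have h3d : 3 ∣ den Q := (dvd_pow_self 3 hv).trans hQ
  have h3a : ¬ 3 ∣ num Q := fun h =>
    Int.prime_three.not_isUnit ((isCoprime_num_den Q).isUnit_of_dvd' h h3d)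
  have hE : (3 : ℤ) ∣ D * den Q ^ 6 := (dvd_pow h3d (by norm_num)).mul_left _
  have h3g : ¬ 3 ∣ g := by
    intro h
    have h4 := h.mul_right (num (Q + Q + Q))
    rw [← h2] at h4
    have h5 : (3 : ℤ) ∣ (num Q ^ 3) ^ 3 := by
      have := h4.sub (hE.mul_left (96 * (num Q ^ 3) ^ 2 + 48 * (D * den Q ^ 6) * num Q ^ 3 -
        64 * (D * den Q ^ 6) ^ 2))
      exact this.trans (dvd_of_eq (by ring))
    exact h3a (Int.prime_three.dvd_of_dvd_pow (Int.prime_three.dvd_of_dvd_pow h5))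
  have h6 : ((3 : ℤ) ^ (v + 1)) ^ 2 ∣ g * den (Q + Q + Q) ^ 2 := by
    rw [← h1]
    obtain ⟨w, hw⟩ := hQ
    exact ⟨num Q ^ 2 * (num Q ^ 3 - 4 * (D * den Q ^ 6)) ^ 2 * w ^ 2, by rw [hw]; ring⟩
  rw [← pow_mul] at h6
  have h7 := Int.prime_three.pow_dvd_of_dvd_mul_left _ h3g h6
  rw [pow_mul] at h7
  exact (Int.pow_dvd_pow_iff two_ne_zero).1 h7

theorem not_dvd_num_of_sq_not_dvd {q : ℤ} (hq : Prime q) (h1 : q ∣ D) (h2 : ¬ q ^ 2 ∣ D)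
    (Q : (mordellCurve D).Point) : ¬ q ∣ num Q := by
  intro h
  have hd : ¬ q ∣ den Q := fun h' => hq.not_isUnit ((isCoprime_num_den Q).isUnit_of_dvd' h h')
  have hs := ynum_sq Q
  have hb : q ∣ ynum Q := hq.dvd_of_dvd_pow (n := 2) (by
    rw [hs]; exact (dvd_pow h three_ne_zero).sub (h1.mul_right _))
  have h3 : q ^ 2 ∣ D * den Q ^ 6 := by
    have := (((pow_dvd_pow q (by norm_num : 2 ≤ 3)).trans (pow_dvd_pow_of_dvd h 3)).sub
      (pow_dvd_pow_of_dvd hb 2))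
    rw [hs] at this
    simpa using this
  exact h2 (hq.pow_dvd_of_dvd_mul_right _ (fun h => hd (hq.dvd_of_dvd_pow h)) h3)

theorem not_dvd_num_of_pow_six_not_dvd {q : ℤ} (hq : Prime q) (h1 : q ^ 5 ∣ D)
    (h2 : ¬ q ^ 6 ∣ D) (Q : (mordellCurve D).Point) : ¬ q ∣ num Q := by
  intro h
  have hd : ¬ q ∣ den Q := fun h' => hq.not_isUnit ((isCoprime_num_den Q).isUnit_of_dvd' h h')
  have hs := ynum_sq Q
  have hq0 := hq.ne_zero
  obtain ⟨a, ha⟩ := h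
  obtain ⟨E, hE⟩ := h1.mul_right (den Q ^ 6)
  rw [ha, hE] at hs
  obtain ⟨b, hb⟩ : q ∣ ynum Q := hq.dvd_of_dvd_pow (n := 2)
    ⟨q ^ 2 * a ^ 3 - q ^ 4 * E, by rw [hs]; ring⟩
  rw [hb] at hs
  have s1 : b ^ 2 = q * (a ^ 3 - q ^ 2 * E) := mul_left_cancel₀ (pow_ne_zero 2 hq0) (by
    linear_combination hs)
  obtain ⟨c, hc⟩ : q ∣ b := hq.dvd_of_dvd_pow ⟨_, s1⟩
  rw [hc] at s1
  have s2 : a ^ 3 = q * (c ^ 2 + q * E) := mul_left_cancel₀ hq0 (by linear_combination (-1) * s1)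
  obtain ⟨e, he⟩ : q ∣ a := hq.dvd_of_dvd_pow ⟨_, s2⟩
  rw [he] at s2
  have s3 : c ^ 2 = q * (q * e ^ 3 - E) := mul_left_cancel₀ hq0 (by linear_combination (-1) * s2)
  obtain ⟨f, hf⟩ : q ∣ c := hq.dvd_of_dvd_pow ⟨_, s3⟩
  rw [hf] at s3
  have s4 : E = q * (e ^ 3 - f ^ 2) := mul_left_cancel₀ hq0 (by linear_combination s3)
  apply h2
  apply hq.pow_dvd_of_dvd_mul_right (b := den Q ^ 6) _ (fun h => hd (hq.dvd_of_dvd_pow h))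
  rw [hE, s4]
  exact ⟨e ^ 3 - f ^ 2, by ring⟩

theorem dvd_num_triple {q D' : ℤ} (hq : Prime q) (hq3 : ¬ q ∣ 3) (hD : 0 < D)
    (h1 : D = q ^ 3 * D') (h2 : ¬ q ∣ D') (Q : (mordellCurve D).Point) (h : q ∣ num Q) :
    q ∣ num (Q + Q + Q) := by
  have hd : ¬ q ∣ den Q := fun h' => hq.not_isUnit ((isCoprime_num_den Q).isUnit_of_dvd' h h')
  have hs := ynum_sq Q
  have ht := triple_abscissa hD Q
  have hq0 := hq.ne_zero
  have hE : ¬ q ∣ D' * den Q ^ 6 := fun h => by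
    rcases hq.dvd_or_dvd h with h | h
    · exact h2 h
    · exact hd (hq.dvd_of_dvd_pow h)
  obtain ⟨a, ha⟩ := h
  have hDE : D * den Q ^ 6 = q ^ 3 * (D' * den Q ^ 6) := by
    linear_combination den Q ^ 6 * h1
  rw [ha, hDE] at hs ht
  generalize D' * den Q ^ 6 = E at *
  obtain ⟨b, hb⟩ : q ∣ ynum Q := hq.dvd_of_dvd_pow (n := 2)
    ⟨q ^ 2 * a ^ 3 - q ^ 2 * E, by rw [hs]; ring⟩
  rw [hb] at hs
  have s1 : b ^ 2 = q * (a ^ 3 - E) := mul_left_cancel₀ (pow_ne_zero 2 hq0) (by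
    linear_combination hs)
  obtain ⟨c, hc⟩ : q ∣ b := hq.dvd_of_dvd_pow ⟨_, s1⟩
  rw [hc] at s1
  have s2 : a ^ 3 = E + q * c ^ 2 := mul_left_cancel₀ hq0 (by linear_combination (-1) * s1)
  have hqa : ¬ q ∣ a := by
    intro h
    have := dvd_pow h three_ne_zero
    rw [s2] at this
    exact hE ((dvd_add_left (dvd_mul_right _ _)).1 this)
  have hqm : ¬ q ∣ a ^ 3 - 4 * E := by
    rw [s2]
    intro h
    have : q ∣ 3 * E := by
      have := ((dvd_mul_right q (c ^ 2)).sub h)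
      exact this.trans (dvd_of_eq (by ring))
    rcases hq.dvd_or_dvd this with h | h
    · exact hq3 h
    · exact hE h
  have h9 : num (Q + Q + Q) * (9 * a ^ 2 * (a ^ 3 - 4 * E) ^ 2 * den Q ^ 2) =
      q * (((a ^ 3) ^ 3 + 96 * E * (a ^ 3) ^ 2 + 48 * E ^ 2 * a ^ 3 - 64 * E ^ 3) *
        den (Q + Q + Q) ^ 2) :=
    mul_left_cancel₀ (pow_ne_zero 8 hq0) (by linear_combination ht)
  have h10 : q ∣ num (Q + Q + Q) * (9 * a ^ 2 * (a ^ 3 - 4 * E) ^ 2 * den Q ^ 2) := ⟨_, h9⟩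
  refine (hq.dvd_or_dvd h10).resolve_right fun h => ?_
  rcases hq.dvd_or_dvd h with h | h
  · rcases hq.dvd_or_dvd h with h | h
    · rcases hq.dvd_or_dvd h with h | h
      · exact hq3 (hq.dvd_of_dvd_pow (n := 2) (by norm_num; exact h))
      · exact hqa (hq.dvd_of_dvd_pow h)
    · exact hqm (hq.dvd_of_dvd_pow h)
  · exact hd (hq.dvd_of_dvd_pow h)

/-- Recognising `3 • Q` from its abscissa. -/
theorem eq_triple_or_eq_neg_triple (hD : 0 < D) {x y x' y' : ℚ}
    (h : (mordellCurve D).Nonsingular x y)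
    (h' : (mordellCurve D).Nonsingular x' y') (hne : 9 * x ^ 2 * (x ^ 3 - 4 * D) ^ 2 ≠ 0)
    (hx : x' * (9 * x ^ 2 * (x ^ 3 - 4 * D) ^ 2) =
      x ^ 9 + 96 * D * x ^ 6 + 48 * D ^ 2 * x ^ 3 - 64 * D ^ 3) :
    ∃ Q : (mordellCurve D).Point, (Q = .some x y h ∨ Q = -.some x y h) ∧
      .some x' y' h' = Q + Q + Q := by
  have ht := triple_abscissa hD (.some x y h)
  have hc := isCoprime_num_den
    (Point.some x y h + Point.some x y h + Point.some x y h)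
  have hn := num_pos hD (Point.some x y h + Point.some x y h + Point.some x y h)
  have hden := den_nonneg (Point.some x y h + Point.some x y h + Point.some x y h)
  obtain ⟨h1, h2, -, -⟩ := some_spec h
  set R := Point.some x y h + Point.some x y h + Point.some x y h with hR
  have key : num R = x' * den R ^ 2 := by
    have ht' : ((num R * (9 * num (Point.some x y h) ^ 2 *
      (num (Point.some x y h) ^ 3 - 4 * (D * den (Point.some x y h) ^ 6)) ^ 2 *
        den (Point.some x y h) ^ 2) : ℤ) : ℚ) = _ := congrArg _ ht
    push_cast at ht'
    have ha : (num (Point.some x y h) : ℚ) = x * den (Point.some x y h) ^ 2 := by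
      have : (den (Point.some x y h) : ℚ) ≠ 0 := by exact_mod_cast h1.ne'
      field_simp at h2
      linarith
    rw [ha] at ht'
    have hd0 : (den (Point.some x y h) : ℚ) ^ 18 ≠ 0 := by
      apply pow_ne_zero; exact_mod_cast h1.ne'
    apply mul_right_cancel₀ (mul_ne_zero hd0 hne)
    linear_combination ht' - den R ^ 2 * den (Point.some x y h) ^ 18 * hx
  have hR0 : den R ≠ 0 := by
    intro h0
    rw [h0] at key
    have : (num R : ℚ) = 0 := by rw [key]; simp
    have : num R = 0 := by exact_mod_cast this
    omega
  have hx' : x' = num R / (den R : ℚ) ^ 2 := by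
    have : (den R : ℚ) ≠ 0 := by exact_mod_cast hR0
    rw [key]; field_simp
  obtain ⟨e1, e2⟩ := num_den_unique h' (lt_of_le_of_ne hden (Ne.symm hR0)) hc hx'
  rcases eq_or_eq_neg_of_num_den e1 e2 with e | e
  · exact ⟨_, .inl rfl, e⟩
  · exact ⟨_, .inr rfl, by rw [e, hR]; abel⟩

/-- The field `ℚ(√-55)`. -/
abbrev QuadField := QuadraticAlgebra ℚ (-55) 0

theorem quadField_cube (u v : ℚ) :
    (⟨u, v⟩ : QuadField) ^ 3 = ⟨u * (u ^ 2 - 165 * v ^ 2), v * (3 * u ^ 2 - 55 * v ^ 2)⟩ := by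
  ext <;> simp [pow_succ] <;> ring

/-- Three collinear points `(xᵢ, l * xᵢ + m)` on the curve `y² = x³ - 55 k²`. -/
theorem collinear_mul_eq_cube {k l m x₁ x₂ x₃ : ℚ} (e₁ : x₁ + x₂ + x₃ = l ^ 2)
    (e₂ : x₁ * x₂ + x₁ * x₃ + x₂ * x₃ = -(2 * l * m))
    (e₃ : x₁ * x₂ * x₃ = m ^ 2 + 55 * k ^ 2) :
    (⟨l * x₁ + m, k⟩ * ⟨l * x₂ + m, k⟩ * ⟨l * x₃ + m, k⟩ : QuadField) = ⟨m, k⟩ ^ 3 := by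
  rw [quadField_cube]
  ext
  · simp
    linear_combination l ^ 3 * e₃ + l ^ 2 * m * e₂ + (l * m ^ 2 - 55 * k ^ 2 * l) * e₁
  · simp
    linear_combination k * l ^ 2 * e₂ + 2 * k * l * m * e₁

/-- The element `y + k√-55` attached to a point with ordinate `y` is multiplicative modulo
cubes. -/
theorem exists_add_mod_cubes {k : ℤ} (hk : k ≠ 0) {x₁ y₁ x₂ y₂ : ℚ}
    (h₁ : (mordellCurve (55 * k ^ 2)).Nonsingular x₁ y₁)
    (h₂ : (mordellCurve (55 * k ^ 2)).Nonsingular x₂ y₂) (hx : x₁ ≠ x₂) :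
    ∃ x₃ y₃ h₃, Point.some x₁ y₁ h₁ + Point.some x₂ y₂ h₂ = Point.some x₃ y₃ h₃ ∧
      ∃ β : QuadField, (⟨y₃, k⟩ : QuadField) = ⟨y₁, k⟩ * ⟨y₂, k⟩ * β ^ 3 := by
  have hsub : x₁ - x₂ ≠ 0 := sub_ne_zero.2 hx
  obtain ⟨l, hl⟩ : ∃ l, l * (x₁ - x₂) = y₁ - y₂ := ⟨(y₁ - y₂) / (x₁ - x₂), by field_simp⟩
  obtain ⟨x₃, hx₃⟩ : ∃ x₃, x₃ = l ^ 2 - x₁ - x₂ := ⟨_, rfl⟩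
  obtain ⟨m, hm⟩ : ∃ m, m = y₁ - l * x₁ := ⟨_, rfl⟩
  obtain ⟨h₃, he⟩ := add_some_of_X_ne h₁ h₂ hx (y₃ := -(l * x₃ + m)) hl hx₃ (by rw [hm]; ring)
  refine ⟨_, _, h₃, he, ?_⟩
  have e₁ := (equation_iff x₁ y₁).1 h₁.1
  have e₂ := (equation_iff x₂ y₂).1 h₂.1
  have e₃ := (equation_iff _ _).1 h₃.1
  push_cast at e₁ e₂ e₃
  have hy₁ : y₁ = l * x₁ + m := by linarith
  have hy₂ : y₂ = l * x₂ + m := by linarith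
  rw [hy₁] at e₁ ⊢
  rw [hy₂] at e₂ ⊢
  have s₁ : x₁ + x₂ + x₃ = l ^ 2 := by linarith
  have s₂ : x₁ * x₂ + x₁ * x₃ + x₂ * x₃ = -(2 * l * m) := by
    apply mul_left_cancel₀ hsub
    linear_combination e₁ - e₂ + (x₁ ^ 2 - x₂ ^ 2) * s₁
  have s₃ : x₁ * x₂ * x₃ = m ^ 2 + 55 * (k : ℚ) ^ 2 := by
    linear_combination -e₁ + x₁ * s₂ - x₁ ^ 2 * s₁
  have hkq : (k : ℚ) ≠ 0 := by exact_mod_cast hk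
  have hc := collinear_mul_eq_cube s₁ s₂ s₃
  have hL : (⟨-(l * x₃ + m), k⟩ * ⟨l * x₃ + m, k⟩ : QuadField) = ⟨-x₃, 0⟩ ^ 3 := by
    rw [quadField_cube]
    ext
    · simp
      linear_combination -e₃
    · simp
      ring
  have hm0 : (⟨m, k⟩ : QuadField) ≠ 0 := fun h => hkq (by
    simpa using congrArg QuadraticAlgebra.im h)
  refine ⟨⟨-x₃, 0⟩ / ⟨m, k⟩, ?_⟩
  rw [div_pow, mul_div_assoc', eq_div_iff (pow_ne_zero 3 hm0), ← hc, ← hL]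
  ring

/-- A point whose associated element is a cube is divisible by three. -/
theorem exists_eq_triple {k : ℤ} (hk : 0 < k) (hk3 : ∀ p, Prime p → ¬ p ^ 3 ∣ k)
    (hk55 : ∀ p, Prime p → p ∣ k → p ∣ 55) {x y : ℚ}
    (h : (mordellCurve (55 * k ^ 2)).Nonsingular x y)
    (ha : ∀ p, Prime p → p ∣ 55 → ¬ p ∣ num (Point.some x y h)) {β : QuadField}
    (hβ : (⟨y, k⟩ : QuadField) = β ^ 3) :
    ∃ Q, Point.some x y h = Q + Q + Q := by
  obtain ⟨u, v⟩ := β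
  rw [quadField_cube] at hβ
  have hy : y = u * (u ^ 2 - 165 * v ^ 2) := congrArg QuadraticAlgebra.re hβ
  have hv : (k : ℚ) = v * (3 * u ^ 2 - 55 * v ^ 2) := congrArg QuadraticAlgebra.im hβ
  have he := (equation_iff x y).1 h.1
  have hkq : (k : ℚ) ≠ 0 := by exact_mod_cast hk.ne'
  have hx : x = u ^ 2 + 55 * v ^ 2 := by
    apply (Odd.strictMono_pow (by decide : Odd 3)).injective
    push_cast at he
    show x ^ 3 = _ ^ 3
    have : x ^ 3 = y ^ 2 + 55 * (k : ℚ) ^ 2 := by linarith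
    rw [this, hy, hv]
    ring
  obtain ⟨hd, hxd, -, -⟩ := some_spec h
  obtain ⟨p, q, h1, h2, h3⟩ := second_descent hk hk3 hk55 hd.ne' ha (hx ▸ hxd) hv.symm
  have hpq : p ^ 2 - 165 * q ^ 2 ≠ 0 := by
    intro h0
    rw [h0, mul_zero] at h2
    exact hkq (by linarith)
  have hq0 : q ≠ 0 := by
    rintro rfl
    exact hkq (by linarith)
  have hs : p ^ 2 + 55 * q ^ 2 ≠ 0 := by
    intro h0
    rw [h0, mul_zero] at h1
    exact hkq h1
  have hD : 0 < 55 * k ^ 2 := by positivity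
  have hQ : (mordellCurve (55 * k ^ 2)).Nonsingular (p ^ 2 + 55 * q ^ 2)
      (p * (p ^ 2 + 55 * q ^ 2)) := by
    refine nonsingular_of_eq hD.ne' ?_
    push_cast
    rw [h1]
    ring
  have hcub : (p ^ 2 + 55 * q ^ 2) ^ 3 - 4 * ((55 * k ^ 2 : ℤ) : ℚ) =
      (p ^ 2 + 55 * q ^ 2) ^ 2 * (p ^ 2 - 165 * q ^ 2) := by
    push_cast
    rw [h1]
    ring
  have hu' : 3 * u * (p ^ 2 - 165 * q ^ 2) = p ^ 3 + 495 * p * q ^ 2 := by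
    apply mul_left_cancel₀ (mul_ne_zero (by norm_num : (3 : ℚ) ≠ 0) hkq)
    linear_combination (p ^ 2 - 165 * q ^ 2) * h3 - (p ^ 3 + 495 * p * q ^ 2) * h2
  have hne : 9 * (p ^ 2 + 55 * q ^ 2) ^ 2 *
      ((p ^ 2 + 55 * q ^ 2) ^ 3 - 4 * ((55 * k ^ 2 : ℤ) : ℚ)) ^ 2 ≠ 0 := by
    rw [hcub]
    positivity
  obtain ⟨Q, -, hQ'⟩ := eq_triple_or_eq_neg_triple hD hQ h hne (by
    calc x * (9 * (p ^ 2 + 55 * q ^ 2) ^ 2 *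
          ((p ^ 2 + 55 * q ^ 2) ^ 3 - 4 * ((55 * k ^ 2 : ℤ) : ℚ)) ^ 2)
        = (p ^ 2 + 55 * q ^ 2) ^ 6 * ((3 * u * (p ^ 2 - 165 * q ^ 2)) ^ 2 +
          495 * (v * (p ^ 2 - 165 * q ^ 2)) ^ 2) := by rw [hcub, hx]; ring
      _ = _ := by
        rw [hu', ← h2]
        push_cast
        rw [h1]
        ring)
  exact ⟨Q, hQ'⟩

theorem isCoprime_fiftyfive_iff {a : ℤ} :
    IsCoprime a 55 ↔ ∀ p : ℤ, Prime p → p ∣ 55 → ¬ p ∣ a := by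
  constructor
  · intro h p hp h1 h2
    exact hp.not_isUnit (h.isUnit_of_dvd' h2 h1)
  · intro h
    exact (isCoprime_of_no_common_prime (by norm_num) fun p hp h1 h2 => h p hp h1 h2).symm

theorem isCoprime_num_add (hk : 0 < k) {P Q : (mordellCurve (55 * k ^ 2)).Point}
    (hP : IsCoprime (num P) 55) (hQ : IsCoprime (num Q) 55) : IsCoprime (num (P + Q)) 55 := by
  rw [isCoprime_fiftyfive_iff] at *
  intro p hp h55
  exact not_dvd_num_add (by positivity) hp (h55.trans ⟨4 * k ^ 2, by ring⟩) (hP p hp h55)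
    (hQ p hp h55)

theorem isCoprime_num_neg {P : (mordellCurve (55 * k ^ 2)).Point}
    (hP : IsCoprime (num P) 55) : IsCoprime (num (-P)) 55 := by
  rwa [num_neg]

/-- The first descent, up to the class of the point `(x₀, y₀)`. -/
theorem exists_eq_triple_mod (hk : 0 < k) (hk3 : ∀ p, Prime p → ¬ p ^ 3 ∣ k)
    (hk55 : ∀ p, Prime p → p ∣ k → p ∣ 55) {x₀ y₀ : ℚ}
    (h₀ : (mordellCurve (55 * k ^ 2)).Nonsingular x₀ y₀)
    (ha₀ : IsCoprime (num (Point.some x₀ y₀ h₀)) 55) {β₀ : QuadField}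
    (hβ₀ : (⟨3, 1⟩ : QuadField) * ⟨y₀, k⟩ = β₀ ^ 3) (P : (mordellCurve (55 * k ^ 2)).Point)
    (hP : IsCoprime (num P) 55) :
    ∃ Q, P = Q + Q + Q ∨ P + Point.some x₀ y₀ h₀ = Q + Q + Q ∨
      P - Point.some x₀ y₀ h₀ = Q + Q + Q := by
  have hD : 0 < 55 * k ^ 2 := by positivity
  rcases P with _ | ⟨x, y, h⟩
  · exact ⟨0, Or.inl (by simp; rfl)⟩
  have hkq : (k : ℚ) ≠ 0 := by exact_mod_cast hk.ne'
  obtain ⟨hd, hxd, hyd, hcop⟩ := some_spec h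
  have hsq := ynum_sq (Point.some x y h)
  have hnum := num_pos hD (Point.some x y h)
  have hkd : IsCoprime (num (Point.some x y h)) (k * den (Point.some x y h) ^ 3) := by
    refine IsCoprime.mul_right ?_ hcop.pow_right
    refine (isCoprime_of_no_common_prime hk.ne' fun p hp h1 h2 => ?_).symm
    exact isCoprime_fiftyfive_iff.1 hP p hp (hk55 p hp h1) h2
  obtain ⟨s, t, e, f, h1, h2, h3⟩ := definite_quotient
    (U := ynum (Point.some x y h)) hnum (by linear_combination hsq) hkd
  have hcube : (⟨e, f⟩ : QuadField) * ⟨y, k⟩ =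
      (⟨s / den (Point.some x y h), t / den (Point.some x y h)⟩ : QuadField) ^ 3 := by
    have h1q := congrArg (Int.cast : ℤ → ℚ) h1
    have h2q := congrArg (Int.cast : ℤ → ℚ) h2
    push_cast at h1q h2q
    have hdq : (den (Point.some x y h) : ℚ) ≠ 0 := by exact_mod_cast hd.ne'
    generalize den (Point.some x y h) = d at *
    rw [quadField_cube]
    ext
    · simp
      rw [hyd]
      field_simp
      linear_combination -h1q
    · simp
      rw [hyd]
      field_simp
      linear_combination -h2q
  generalize (⟨s / den (Point.some x y h), t / den (Point.some x y h)⟩ : QuadField) = β at hcube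
  have direct : ∀ δ : QuadField, (⟨y, k⟩ : QuadField) = δ ^ 3 → ∃ Q,
      Point.some x y h = Q + Q + Q := fun δ hδ =>
    exists_eq_triple hk hk3 hk55 h (isCoprime_fiftyfive_iff.1 hP) hδ
  have hx₀ := (equation_iff x₀ y₀).1 h₀.1
  push_cast at hx₀
  by_cases hxx : x = x₀
  · have hy2 : (y - y₀) * (y + y₀) = 0 := by
      have := (equation_iff x y).1 h.1
      push_cast at this
      rw [hxx] at this
      linear_combination this - hx₀
    refine ⟨0, Or.inr ?_⟩
    rcases mul_eq_zero.1 hy2 with hy | hy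
    · obtain ⟨h', he⟩ := some_congr h hxx (sub_eq_zero.1 hy)
      right
      rw [he]
      simp
    · obtain ⟨h', he⟩ := some_congr h hxx (eq_neg_of_add_eq_zero_left hy)
      obtain ⟨h'', he'⟩ := neg_some' h₀
      left
      rw [he, ← he']
      simp
  have hne₀ : (⟨y₀, k⟩ : QuadField) ≠ 0 := fun h => hkq (by
    simpa using congrArg QuadraticAlgebra.im h)
  have hγ : (⟨3, 1⟩ : QuadField) ≠ 0 := fun h => by
    simpa using congrArg QuadraticAlgebra.im h
  have hβ₀0 : β₀ ^ 3 ≠ 0 := by rw [← hβ₀]; exact mul_ne_zero hγ hne₀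
  have plus : ∀ δ : QuadField, (⟨y, k⟩ * ⟨y₀, k⟩ : QuadField) = δ ^ 3 → ∃ Q,
      Point.some x y h + Point.some x₀ y₀ h₀ = Q + Q + Q := by
    intro δ hδ
    obtain ⟨x₃, y₃, h₃, he, δ', hδ'⟩ := exists_add_mod_cubes hk.ne' h h₀ hxx
    have := isCoprime_num_add hk hP ha₀
    rw [he] at this ⊢
    exact exists_eq_triple hk hk3 hk55 h₃ (isCoprime_fiftyfive_iff.1 this) (β := δ * δ')
      (by rw [hδ', hδ]; ring)
  have minus : ∀ δ : QuadField, (⟨y, k⟩ : QuadField) = ⟨y₀, k⟩ * δ ^ 3 → ∃ Q,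
      Point.some x y h - Point.some x₀ y₀ h₀ = Q + Q + Q := by
    intro δ hδ
    obtain ⟨h', he'⟩ := neg_some' h₀
    obtain ⟨x₃, y₃, h₃, he, δ', hδ'⟩ := exists_add_mod_cubes hk.ne' h h' hxx
    have := isCoprime_num_add hk hP (isCoprime_num_neg ha₀)
    rw [sub_eq_add_neg, he']
    rw [he'] at this
    rw [he] at this ⊢
    refine exists_eq_triple hk hk3 hk55 h₃ (isCoprime_fiftyfive_iff.1 this)
      (β := δ * δ' * ⟨-x₀, 0⟩) ?_
    have hnorm : (⟨y₀, k⟩ * ⟨-y₀, k⟩ : QuadField) = ⟨-x₀, 0⟩ ^ 3 := by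
      rw [quadField_cube]
      ext
      · simp
        linear_combination -hx₀
      · simp
        ring
    rw [hδ', hδ, mul_pow, ← hnorm]
    ring
  rcases h3 with ⟨rfl, rfl | rfl⟩ | ⟨rfl, rfl | rfl⟩ | ⟨rfl | rfl, rfl | rfl⟩
  · obtain ⟨Q, hQ⟩ := direct β (by
      rw [← hcube]
      ext <;> simp)
    exact ⟨Q, Or.inl hQ⟩
  · obtain ⟨Q, hQ⟩ := direct (-β) (by
      rw [Odd.neg_pow (by decide), ← hcube]
      ext <;> simp)
    exact ⟨Q, Or.inl hQ⟩
  · obtain ⟨Q, hQ⟩ := direct (β * ⟨1 / 2, 0⟩) (by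
      rw [mul_pow, ← hcube, quadField_cube]
      ext <;> simp <;> ring)
    exact ⟨Q, Or.inl hQ⟩
  · obtain ⟨Q, hQ⟩ := direct (β * ⟨-1 / 2, 0⟩) (by
      rw [mul_pow, ← hcube, quadField_cube]
      ext <;> simp <;> ring)
    exact ⟨Q, Or.inl hQ⟩
  · obtain ⟨Q, hQ⟩ := minus (β / β₀) (by
      rw [div_pow, mul_div_assoc', eq_div_iff hβ₀0, ← hcube, ← hβ₀]
      push_cast
      ring)
    exact ⟨Q, Or.inr (Or.inr hQ)⟩
  · obtain ⟨Q, hQ⟩ := plus (β * β₀ * ⟨1 / 4, 0⟩) (by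
      rw [mul_pow, mul_pow, ← hcube, ← hβ₀, quadField_cube]
      ext <;> simp <;> ring)
    exact ⟨Q, Or.inr (Or.inl hQ)⟩
  · obtain ⟨Q, hQ⟩ := plus (β * β₀ * ⟨-1 / 4, 0⟩) (by
      rw [mul_pow, mul_pow, ← hcube, ← hβ₀, quadField_cube]
      ext <;> simp <;> ring)
    exact ⟨Q, Or.inr (Or.inl hQ)⟩
  · obtain ⟨Q, hQ⟩ := minus (-β / β₀) (by
      rw [div_pow, mul_div_assoc', eq_div_iff hβ₀0, Odd.neg_pow (by decide), ← hcube, ← hβ₀]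
      ext <;> simp <;> ring)
    exact ⟨Q, Or.inr (Or.inr hQ)⟩

theorem mem_zmultiples_of_descent {D : ℤ} (hD : 0 < D) {P₀ : (mordellCurve D).Point}
    {H : (mordellCurve D).Point → Prop} {μ : (mordellCurve D).Point → ℤ} {B C c : ℤ}
    (hμ : ∀ P, 0 < μ P) (hC : 0 < C) (hnum : ∀ P, num P ≤ c * μ P)
    (htriple : ∀ Q, H Q → μ Q ^ 9 ≤ C * num (Q + Q + Q))
    (hstep : ∀ P, H P → ∃ Q, H Q ∧
      (P = Q + Q + Q ∨ P + P₀ = Q + Q + Q ∨ P - P₀ = Q + Q + Q))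
    (hB0 : 0 < B) (hB : C * (9 * (c ^ 2 * num P₀ ^ 2)) < B ^ 7)
    (hsmall : ∀ P, H P → μ P < B → P ∈ AddSubgroup.zmultiples P₀)
    (P : (mordellCurve D).Point) (hP : H P) : P ∈ AddSubgroup.zmultiples P₀ := by
  have main : ∀ n : ℕ, ∀ P : (mordellCurve D).Point, (μ P).toNat = n →
      H P → P ∈ AddSubgroup.zmultiples P₀ := by
    intro n
    induction n using Nat.strong_induction_on with
    | _ n ih =>
      intro P hn hP
      by_cases hlt : μ P < B
      · exact hsmall P hP hlt
      rw [not_lt] at hlt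
      have hpos := num_pos hD P
      have hpos₀ := num_pos hD P₀
      have hμP := hμ P
      have step : ∀ Q, H Q → num (Q + Q + Q) ≤ 9 * (num P ^ 2 * num P₀ ^ 2) →
          Q ∈ AddSubgroup.zmultiples P₀ := by
        intro Q hQ hle
        have hlt' : μ Q ^ 9 < μ P ^ 9 := by
          calc μ Q ^ 9 ≤ C * num (Q + Q + Q) := htriple Q hQ
            _ ≤ C * (9 * (num P ^ 2 * num P₀ ^ 2)) := by gcongr
            _ ≤ C * (9 * ((c * μ P) ^ 2 * num P₀ ^ 2)) := by
              gcongr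
              exact hnum P
            _ = C * (9 * (c ^ 2 * num P₀ ^ 2)) * μ P ^ 2 := by ring
            _ < B ^ 7 * μ P ^ 2 := by gcongr
            _ ≤ μ P ^ 7 * μ P ^ 2 := by gcongr
            _ = μ P ^ 9 := by ring
        have := lt_of_pow_lt_pow_left₀ 9 hμP.le hlt'
        have hμQ := hμ Q
        exact ih (μ Q).toNat (by omega) Q rfl hQ
      have mem₀ : P₀ ∈ AddSubgroup.zmultiples P₀ := AddSubgroup.mem_zmultiples P₀
      have add3 : ∀ Q, Q ∈ AddSubgroup.zmultiples P₀ → Q + Q + Q ∈ AddSubgroup.zmultiples P₀ :=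
        fun Q hQ => add_mem (add_mem hQ hQ) hQ
      obtain ⟨Q, hQ, h | h | h⟩ := hstep P hP
      · rw [h]
        refine add3 Q (step Q hQ ?_)
        rw [← h]
        nlinarith [mul_pos hpos hpos₀, mul_pos hpos hpos]
      · rw [eq_sub_of_add_eq h]
        refine sub_mem (add3 Q (step Q hQ ?_)) mem₀
        rw [← h]
        exact num_add_le hD P P₀
      · rw [sub_eq_iff_eq_add.1 h]
        refine add_mem (add3 Q (step Q hQ ?_)) mem₀
        rw [← h, sub_eq_add_neg, ← num_neg P₀]
        exact num_add_le hD P (-P₀)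
  exact main _ P rfl hP

theorem modEq_of_elliptic_recurrence {g : ℕ → ℤ} {C M : ℤ} (h0 : g 0 = 1)
    (hcop : ∀ n, IsCoprime M (g n))
    (hrec : ∀ n, g (n + 2) * g n ≡ C * g (n + 1) ^ 2 [ZMOD M]) (n : ℕ) :
    g (n + 1) ≡ g n * g 1 * C ^ n [ZMOD M] := by
  induction n with
  | zero => simp [h0]
  | succ n ih =>
    have h1 := (hrec n).symm.dvd
    have h2 := ih.symm.dvd
    refine (Int.modEq_iff_dvd.2 ((hcop n).dvd_of_dvd_mul_left ?_)).symm
    have := dvd_add h1 (h2.mul_left (C * g (n + 1)))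
    exact this.trans (dvd_of_eq (by ring))

theorem pow_dvd_num_mul_sub {q : ℤ} {v : ℕ} (hD : 0 < D) {R S : (mordellCurve D).Point}
    (h : q ^ v ∣ den (R - S)) : q ^ v ∣ num R * den S ^ 2 - num S * den R ^ 2 := by
  obtain ⟨g, -, hN, -, -⟩ := parallelogram hD R S
  rw [← Int.pow_dvd_pow_iff two_ne_zero, hN]
  exact ((pow_dvd_pow_of_dvd h 2).mul_left _).mul_left _

theorem not_dvd_den_add_zsmul (hD : 0 < D) {P Q : (mordellCurve D).Point}
    (hP : den P = 1) {q : ℤ} (hq : Prime q) (hQq : q ∣ den Q) (n : ℤ) :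
    ¬ q ∣ den (P + n • Q) := by
  intro h
  have h1 := sub_mem (show P + n • Q ∈ denSubgroup hD hq 1 from by
    change q ^ 1 ∣ den (P + n • Q); simpa using h)
    (show n • Q ∈ denSubgroup hD hq 1 from by
      change q ^ 1 ∣ den (n • Q); simpa using dvd_den_zsmul hD hq hQq n)
  rw [add_sub_cancel_right] at h1
  change q ^ 1 ∣ den P at h1
  rw [hP, pow_one] at h1
  exact hq.not_isUnit (isUnit_of_dvd_one h1)

theorem den_sq_recurrence (hD : 0 < D) {P Q : (mordellCurve D).Point} (hP : den P = 1)
    {q : ℤ} (hq : Prime q) {v : ℕ} (hQv : q ^ v ∣ den Q) (hQ3 : 3 ∣ den Q)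
    (hQ : ∀ q : ℤ, Prime q → q ∣ 4 * D → ¬ q ∣ num Q)
    (n : ℤ) :
    den (P + (n + 1) • Q) ^ 2 * den (P + (n - 1) • Q) ^ 2 ≡
      den (P + Q) ^ 2 * den (P - Q) ^ 2 * (den (P + n • Q) ^ 2) ^ 2 [ZMOD q ^ (3 * v)] := by
  have e1 := den_add_mul_den_sub hD hQ hQ3 
    (not_dvd_den_add_zsmul hD hP Int.prime_three hQ3 n)
  have e0 := den_add_mul_den_sub hD hQ hQ3 (P := P) (by rw [hP]; norm_num)
  have hx : q ^ v ∣ num (P + n • Q) * den P ^ 2 - num P * den (P + n • Q) ^ 2 := by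
    apply pow_dvd_num_mul_sub hD
    rw [add_sub_cancel_left]
    exact pow_dvd_den_zsmul hD hq hQv n
  have a1 : P + (n + 1) • Q = P + n • Q + Q := by rw [add_zsmul, one_zsmul, add_assoc]
  have a2 : P + (n - 1) • Q = P + n • Q - Q := by
    rw [sub_zsmul, one_zsmul, add_sub_assoc, sub_eq_add_neg]
  rw [hP] at e0 hx
  rw [a1, a2, ← mul_pow, ← mul_pow, ← e1, ← e0]
  generalize num (P + n • Q) = a at *
  generalize den (P + n • Q) = f at *
  refine (Int.modEq_iff_dvd.2 ?_).symm
  have h3 : q ^ (3 * v) ∣ (a * 1 ^ 2 - num P * f ^ 2) * den Q ^ 2 := by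
    have : q ^ (3 * v) = q ^ v * (q ^ v) ^ 2 := by ring
    rw [this]
    exact mul_dvd_mul hx (pow_dvd_pow_of_dvd hQv 2)
  have := h3.mul_right ((a * den Q ^ 2 - num Q * f ^ 2) +
    (num P * den Q ^ 2 - num Q * 1 ^ 2) * f ^ 2)
  exact this.trans (dvd_of_eq (by ring))

theorem den_sq_succ (hD : 0 < D) {P Q : (mordellCurve D).Point} (hP : den P = 1)
    {q : ℤ} (hq : Prime q) {v : ℕ} (hv : 0 < v) (hQv : q ^ v ∣ den Q) (hQ3 : 3 ∣ den Q)
    (hQ : ∀ q : ℤ, Prime q → q ∣ 4 * D → ¬ q ∣ num Q)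
    (n : ℕ) :
    den (P + (n + 1) • Q) ^ 2 ≡ den (P + n • Q) ^ 2 * den (P + Q) ^ 2 *
      (den (P + Q) ^ 2 * den (P - Q) ^ 2) ^ n [ZMOD q ^ (3 * v)] := by
  have hQq : q ∣ den Q := (dvd_pow_self q hv.ne').trans hQv
  have := modEq_of_elliptic_recurrence (g := fun n : ℕ => den (P + n • Q) ^ 2)
    (C := den (P + Q) ^ 2 * den (P - Q) ^ 2) (M := q ^ (3 * v)) (by simp [hP]) ?_ ?_ n
  · simpa using this
  · intro n
    refine ((hq.coprime_iff_not_dvd).2 ?_).pow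
    have := not_dvd_den_add_zsmul hD hP hq hQq n
    rwa [natCast_zsmul] at this
  · intro n
    have := den_sq_recurrence hD hP hq hQv hQ3 hQ (n + 1 : ℕ)
    rw [natCast_zsmul, show ((n + 1 : ℕ) : ℤ) + 1 = (n + 2 : ℕ) by push_cast; ring,
      show ((n + 1 : ℕ) : ℤ) - 1 = (n : ℕ) by push_cast; ring, natCast_zsmul, natCast_zsmul] at this
    exact this

theorem den_sq_triple (hD : 0 < D) {P Q : (mordellCurve D).Point} (hP : den P = 1) {v : ℕ}
    (hv : 0 < v) (hQv : 3 ^ v ∣ den Q) (hQ : ∀ q : ℤ, Prime q → q ∣ 4 * D → ¬ q ∣ num Q) :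
    den (P + (Q + Q + Q)) ^ 2 ≡ (den (P + Q) ^ 2) ^ 3 *
      (den (P + Q) ^ 2 * den (P - Q) ^ 2) ^ 3 [ZMOD 3 ^ (3 * v)] := by
  have hQ3 : 3 ∣ den Q := (dvd_pow_self 3 hv.ne').trans hQv
  have h1 := den_sq_succ hD hP Int.prime_three hv hQv hQ3 hQ 1
  have h2 := den_sq_succ hD hP Int.prime_three hv hQv hQ3 hQ 2
  have e2 : P + (1 + 1) • Q = P + 2 • Q := rfl
  have e3 : P + (2 + 1) • Q = P + (Q + Q + Q) := by
    rw [add_smul, two_smul, one_smul]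
  rw [e2, one_smul] at h1
  rw [e3] at h2
  refine h2.trans ?_
  have := (h1.mul_right (den (P + Q) ^ 2)).mul_right ((den (P + Q) ^ 2 * den (P - Q) ^ 2) ^ 2)
  refine this.trans ?_
  rw [show ∀ r C : ℤ, r * r * C ^ 1 * r * C ^ 2 = r ^ 3 * C ^ 3 from fun r C => by ring]

theorem three_pow_dvd_cube_sub_one {t : ℕ} (ht : 0 < t) {r : ℤ} (h : 3 ^ t ∣ r - 1) :
    3 ^ (t + 2) ∣ r ^ 3 - 1 - 3 * (r - 1) := by
  obtain ⟨u, hu⟩ := h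
  have hr : r = 1 + 3 ^ t * u := by linear_combination hu
  obtain ⟨t, rfl⟩ := Nat.exists_eq_succ_of_ne_zero ht.ne'
  refine ⟨u ^ 2 * 3 ^ t + u ^ 3 * 3 ^ (2 * t), ?_⟩
  rw [hr, Nat.succ_eq_add_one]
  ring

theorem den_add_nsmul_ne_one (hD : 0 < D) {P : (mordellCurve D).Point} (hP : den P = 1) (n : ℕ)
    (hn : 0 < n) (Q : (mordellCurve D).Point) (v t : ℕ) (hQv : 3 ^ v ∣ den Q) (ht : 0 < t)
    (htv : t + 2 ≤ 3 * v) (hQ : ∀ q : ℤ, Prime q → q ∣ 4 * D → ¬ q ∣ num Q)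
    (hr : 3 ^ t ∣ den (P + Q) ^ 2 - 1) (hr' : ¬ 3 ^ (t + 1) ∣ den (P + Q) ^ 2 - 1)
    (hC : 3 ^ (t + 1) ∣ den (P + Q) ^ 2 * den (P - Q) ^ 2 - 1) : den (P + n • Q) ≠ 1 := by
  induction n using Nat.strong_induction_on generalizing Q v t with
  | _ n ih =>
  have hv : 0 < v := by omega
  have hQ3 : 3 ∣ den Q := (dvd_pow_self 3 hv.ne').trans hQv
  by_cases h3 : 3 ∣ n
  · obtain ⟨m, rfl⟩ := h3
    have hsmul : (3 * m) • Q = m • (Q + Q + Q) := by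
      rw [mul_comm, mul_smul, show (3 : ℕ) = 2 + 1 from rfl, add_smul, two_smul, one_smul]
    have hneg : ∀ q : ℤ, Prime q → q ∣ 4 * D → ¬ q ∣ num (-Q) := by simpa using hQ
    have hle : (3 : ℤ) ^ (t + 2) ∣ 3 ^ (3 * v) := pow_dvd_pow 3 htv
    have e1 := hle.trans (den_sq_triple hD hP hv hQv hQ).symm.dvd
    have e2 := hle.trans (den_sq_triple hD hP hv (Q := -Q) (by simpa using hQv) hneg).symm.dvd
    have s2 : P + (-Q + -Q + -Q) = P - (Q + Q + Q) := by abel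
    rw [s2, sub_neg_eq_add, ← sub_eq_add_neg] at e2
    rw [hsmul]
    generalize hG : den (P + (Q + Q + Q)) ^ 2 = G at *
    generalize hH : den (P - (Q + Q + Q)) ^ 2 = H at *
    generalize den (P + Q) ^ 2 = r at *
    generalize den (P - Q) ^ 2 = r' at *
    have c1 : (3 : ℤ) ^ (t + 2) ∣ (r * r') ^ 3 - 1 := by
      have h1 := three_pow_dvd_cube_sub_one t.succ_pos hC
      have h2 : (3 : ℤ) ^ (t + 2) ∣ 3 * (r * r' - 1) := by
        rw [show (3 : ℤ) ^ (t + 2) = 3 * 3 ^ (t + 1) by ring]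
        exact mul_dvd_mul_left _ hC
      have := dvd_add ((pow_dvd_pow 3 (by omega)).trans h1) h2
      exact this.trans (dvd_of_eq (by ring))
    have c2 : (3 : ℤ) ^ (t + 2) ∣ G - 1 - 3 * (r - 1) := by
      have h1 := three_pow_dvd_cube_sub_one ht hr
      have := dvd_add (dvd_add e1 h1) (c1.mul_left (r ^ 3))
      exact this.trans (dvd_of_eq (by ring))
    have c3 : (3 : ℤ) ^ (t + 2) ∣ G * H - 1 := by
      have h1 := dvd_add (e1.mul_right H) (e2.mul_left (r ^ 3 * (r * r') ^ 3))
      have h2 := c1.mul_right ((r * r') ^ 6 + (r * r') ^ 3 + 1)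
      have := dvd_add h1 h2
      exact this.trans (dvd_of_eq (by ring))
    have h33 : (3 : ℤ) ^ (t + 1) = 3 * 3 ^ t := by ring
    have h34 : (3 : ℤ) ^ (t + 2) = 3 * 3 ^ (t + 1) := by ring
    refine ih m (by omega) (by omega) (Q + Q + Q) (v + 1) (t + 1)
      (three_pow_dvd_den_triple hD hv.ne' hQv) (by omega) (by omega)
      (fun q hq hqD => not_dvd_num_add hD hq hqD
        (not_dvd_num_add hD hq hqD (hQ q hq hqD) (hQ q hq hqD)) (hQ q hq hqD)) ?_ ?_ ?_
    · rw [hG]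
      have := dvd_add ((pow_dvd_pow 3 (by omega : t + 1 ≤ t + 2)).trans c2)
        (h33 ▸ mul_dvd_mul_left 3 hr)
      exact this.trans (dvd_of_eq (by ring))
    · rw [hG]
      intro h
      have h5 := dvd_sub h c2
      rw [sub_sub_cancel, show t + 1 + 1 = t + 2 from rfl, h34] at h5
      exact hr' ((mul_dvd_mul_iff_left (by norm_num)).1 h5)
    · rw [hG, hH]
      exact c3
  · have key : ∀ m : ℕ, (3 : ℤ) ^ (t + 1) ∣
        den (P + m • Q) ^ 2 - 1 - m * (den (P + Q) ^ 2 - 1) := by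
      intro m
      induction m with
      | zero => simp [hP]
      | succ m ihm =>
        have e1 := ((pow_dvd_pow 3 (by omega : t + 1 ≤ 3 * v)).trans
          (den_sq_succ hD hP Int.prime_three hv hQv hQ3 hQ m).symm.dvd)
        generalize den (P + (m + 1) • Q) ^ 2 = G at *
        generalize den (P + m • Q) ^ 2 = H at *
        generalize den (P + Q) ^ 2 = r at *
        generalize den (P - Q) ^ 2 = r' at *
        have e2 : (3 : ℤ) ^ (t + 1) ∣ (r * r') ^ m - 1 :=
          hC.trans (by simpa using sub_dvd_pow_sub_pow (r * r') 1 m)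
        have e3 : (3 : ℤ) ^ (t + 1) ∣ (r - 1) * (r - 1) :=
          ((pow_dvd_pow 3 (by omega : t + 1 ≤ t + t)).trans
            (dvd_of_eq (pow_add 3 t t))).trans (mul_dvd_mul hr hr)
        have := dvd_add (dvd_add (dvd_add e1 (e2.mul_left (H * r))) (ihm.mul_right r))
          (e3.mul_left m)
        refine this.trans (dvd_of_eq ?_)
        push_cast
        ring
    intro h1
    have h2 := key n
    rw [h1] at h2
    have h4 : (3 : ℤ) ^ (t + 1) ∣ n * (den (P + Q) ^ 2 - 1) := by
      have := h2.neg_right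
      exact this.trans (dvd_of_eq (by ring))
    have hc : IsCoprime ((3 : ℤ) ^ (t + 1)) n :=
      ((Int.prime_three.coprime_iff_not_dvd).2 (by exact_mod_cast h3)).pow_left
    exact hr' (hc.dvd_of_dvd_mul_left h4)

/-- Under the same hypotheses the translates of `P` by nonzero multiples of `Q` are not
integral. -/
theorem den_add_zsmul_ne_one (hD : 0 < D) {P Q : (mordellCurve D).Point} (hP : den P = 1) {n : ℤ}
    (hn : n ≠ 0) {v t : ℕ} (hQv : 3 ^ v ∣ den Q) (ht : 0 < t)
    (htv : t + 2 ≤ 3 * v) (hQ : ∀ q : ℤ, Prime q → q ∣ 4 * D → ¬ q ∣ num Q)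
    (hr : 3 ^ t ∣ den (P + Q) ^ 2 - 1) (hr' : ¬ 3 ^ (t + 1) ∣ den (P + Q) ^ 2 - 1)
    (hC : 3 ^ (t + 1) ∣ den (P + Q) ^ 2 * den (P - Q) ^ 2 - 1) : den (P + n • Q) ≠ 1 := by
  obtain ⟨m, rfl | rfl⟩ := n.eq_nat_or_neg
  · rw [natCast_zsmul]
    exact den_add_nsmul_ne_one hD hP m (by omega) Q v t hQv ht htv hQ hr hr' hC
  · rw [neg_smul, natCast_zsmul, ← neg_nsmul]
    have h3 : IsCoprime ((3 : ℤ) ^ (t + 1)) (den (P + Q) ^ 2) := by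
      refine ((Int.prime_three.coprime_iff_not_dvd).2 fun h => ?_).pow
      have h1 := (dvd_pow_self (3 : ℤ) ht.ne').trans hr
      have := dvd_sub (h.trans (dvd_pow_self _ two_ne_zero)) h1
      norm_num at this
    have hle := pow_dvd_pow (3 : ℤ) (Nat.le_succ t)
    have hcop := (h3.of_isCoprime_of_dvd_left hle)
    refine den_add_nsmul_ne_one hD hP m (by omega) (-Q) v t (by simpa using hQv) ht htv
      (by simpa using hQ) ?_ ?_ ?_
    · rw [← sub_eq_add_neg]
      refine hcop.dvd_of_dvd_mul_left ?_
      have := dvd_sub (hle.trans hC) hr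
      exact this.trans (dvd_of_eq (by ring))
    · rw [← sub_eq_add_neg]
      intro h
      have := dvd_sub hC (h.mul_left (den (P + Q) ^ 2))
      exact hr' (this.trans (dvd_of_eq (by ring)))
    · rw [← sub_eq_add_neg, sub_neg_eq_add, mul_comm]
      exact hC

/-- `P` is the affine point with coordinates `a / d ^ 2` and `b / d ^ 3`, in lowest terms. -/
def HasCoords (P : (mordellCurve D).Point) (a b d : ℤ) : Prop :=
  (0 < d ∧ IsCoprime a d) ∧
    ∃ h, P = .some ((a : ℚ) / (d : ℚ) ^ 2) ((b : ℚ) / (d : ℚ) ^ 3) h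

theorem HasCoords.num_eq {P : (mordellCurve D).Point} {a b d : ℤ} (h : HasCoords P a b d) :
    num P = a := by
  obtain ⟨⟨hd, had⟩, h, rfl⟩ := h
  exact (num_den_unique h hd had rfl).1

theorem HasCoords.den_eq {P : (mordellCurve D).Point} {a b d : ℤ} (h : HasCoords P a b d) :
    den P = d := by
  obtain ⟨⟨hd, had⟩, h, rfl⟩ := h
  exact (num_den_unique h hd had rfl).2

theorem HasCoords.add {P : (mordellCurve D).Point} {m n l a b d a' b' d' a'' b'' d'' : ℤ}
    (hm : HasCoords (m • P) a b d) (hn : HasCoords (n • P) a' b' d') (hmn : m + n = l)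
    (hd'' : 0 < d'') (hcop : IsCoprime a'' d'') (hw : a * d' ^ 2 - a' * d ^ 2 ≠ 0)
    (hx : a'' * (d * d' * (a * d' ^ 2 - a' * d ^ 2)) ^ 2 = d'' ^ 2 *
      ((b * d' ^ 3 - b' * d ^ 3) ^ 2 - (a * d' ^ 2 + a' * d ^ 2) * (a * d' ^ 2 - a' * d ^ 2) ^ 2))
    (hy : b'' * (d ^ 3 * d' * (a * d' ^ 2 - a' * d ^ 2)) =
      -(b * d'' ^ 3 * d' * (a * d' ^ 2 - a' * d ^ 2) +
        (b * d' ^ 3 - b' * d ^ 3) * d'' * (a'' * d ^ 2 - a * d'' ^ 2))) :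
    HasCoords (l • P) a'' b'' d'' := by
  obtain ⟨⟨hd, -⟩, h, e⟩ := hm
  obtain ⟨⟨hd', -⟩, h', e'⟩ := hn
  have qd : (d : ℚ) ≠ 0 := by exact_mod_cast hd.ne'
  have qd' : (d' : ℚ) ≠ 0 := by exact_mod_cast hd'.ne'
  have qd'' : (d'' : ℚ) ≠ 0 := by exact_mod_cast hd''.ne'
  have qw : (a * d' ^ 2 - a' * d ^ 2 : ℚ) ≠ 0 := by exact_mod_cast hw
  have qx : (a'' * (d * d' * (a * d' ^ 2 - a' * d ^ 2)) ^ 2 : ℚ) = d'' ^ 2 *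
      ((b * d' ^ 3 - b' * d ^ 3) ^ 2 - (a * d' ^ 2 + a' * d ^ 2) * (a * d' ^ 2 - a' * d ^ 2) ^ 2) :=
    by exact_mod_cast hx
  have qy : (b'' * (d ^ 3 * d' * (a * d' ^ 2 - a' * d ^ 2)) : ℚ) =
      -(b * d'' ^ 3 * d' * (a * d' ^ 2 - a' * d ^ 2) +
        (b * d' ^ 3 - b' * d ^ 3) * d'' * (a'' * d ^ 2 - a * d'' ^ 2)) := by exact_mod_cast hy
  refine ⟨⟨hd'', hcop⟩, ?_⟩
  rw [← hmn, add_zsmul, e, e']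
  set w : ℚ := a * d' ^ 2 - a' * d ^ 2 with hw'
  refine add_some_of_X_ne h h' (l := (b * d' ^ 3 - b' * d ^ 3) / (d * d' * w)) ?_ ?_ ?_ ?_
  · intro hc
    rw [div_eq_div_iff (by positivity) (by positivity)] at hc
    exact qw (by rw [hw', hc, sub_self])
  · have : (a / d ^ 2 - a' / d' ^ 2 : ℚ) = w / (d ^ 2 * d' ^ 2) := by
      rw [hw']
      field_simp
    rw [this]
    field_simp
  · field_simp
    linear_combination qx
  · field_simp
    linear_combination qy

theorem HasCoords.double {P : (mordellCurve D).Point} {m l a b d a'' b'' d'' : ℤ}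
    (hm : HasCoords (m • P) a b d) (hml : m + m = l)
    (hd'' : 0 < d'') (hcop : IsCoprime a'' d'') (hb : b ≠ 0)
    (hx : a'' * (2 * b * d) ^ 2 = d'' ^ 2 * (9 * a ^ 4 - 8 * a * b ^ 2))
    (hy : b'' * (2 * b * d ^ 3) =
      -(2 * b ^ 2 * d'' ^ 3 + 3 * a ^ 2 * d'' * (a'' * d ^ 2 - a * d'' ^ 2))) :
    HasCoords (l • P) a'' b'' d'' := by
  obtain ⟨⟨hd, -⟩, h, e⟩ := hm
  have qd : (d : ℚ) ≠ 0 := by exact_mod_cast hd.ne'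
  have qd'' : (d'' : ℚ) ≠ 0 := by exact_mod_cast hd''.ne'
  have qb : (b : ℚ) ≠ 0 := by exact_mod_cast hb
  have qx : (a'' * (2 * b * d) ^ 2 : ℚ) = d'' ^ 2 * (9 * a ^ 4 - 8 * a * b ^ 2) := by
    exact_mod_cast hx
  have qy : (b'' * (2 * b * d ^ 3) : ℚ) =
      -(2 * b ^ 2 * d'' ^ 3 + 3 * a ^ 2 * d'' * (a'' * d ^ 2 - a * d'' ^ 2)) := by
    exact_mod_cast hy
  refine ⟨⟨hd'', hcop⟩, ?_⟩
  rw [← hml, add_zsmul, e]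
  refine add_self_some h (l := 3 * a ^ 2 / (2 * b * d)) (by positivity) ?_ ?_ ?_
  · field_simp
  · field_simp
    linear_combination qx
  · field_simp
    linear_combination qy

theorem den_neg_zsmul (P : (mordellCurve D).Point) (n : ℤ) : den ((-n) • P) = den (n • P) := by
  rw [neg_smul, den_neg]

theorem dvd_den_of_prime_dvd_den_zsmul (hD : 0 < D) {P : (mordellCurve D).Point} (hP : den P = 1)
    {p c : ℤ} (hp : Prime p) (hc : p * c ∣ den (p • P)) {q : ℤ} (hq : Prime q) (hqc : q ∣ c)
    {m : ℤ} (hm : p ∣ den (m • P)) : q ∣ den (m • P) := by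
  have hpm : p ∣ m := by
    by_contra h
    obtain ⟨u, v, huv⟩ := (hp.coprime_iff_not_dvd).2 h
    have h1 := dvd_den_zsmul hD hp (dvd_of_mul_right_dvd hc) u
    have h2 := dvd_den_zsmul hD hp hm v
    have h3 := pow_dvd_den_add hD hp (v := 1) (by simpa using h1) (by simpa using h2)
    rw [smul_smul, smul_smul, ← add_zsmul, huv, one_zsmul, hP, pow_one] at h3
    exact hp.not_isUnit (isUnit_of_dvd_one h3)
  obtain ⟨n, rfl⟩ := hpm
  rw [mul_comm, mul_smul]
  exact dvd_den_zsmul hD hq (hqc.trans (dvd_of_mul_left_dvd hc)) n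

theorem not_prime_dvd_den_zsmul (hD : 0 < D) {P : (mordellCurve D).Point} (hP : den P = 1)
    {p c : ℤ} (hp : Prime p) (hc : p * c ∣ den (p • P)) (hc1 : c.natAbs ≠ 1) (hc55 : IsCoprime c 55)
    {m : ℤ} {s t : ℕ} (hm : den (m • P) = 5 ^ s * 11 ^ t) : ¬ p ∣ den (m • P) := by
  intro h
  obtain ⟨q, hq, hqc⟩ := Int.exists_prime_and_dvd hc1
  have h1 := dvd_den_of_prime_dvd_den_zsmul hD hP hp hc hq hqc h
  have h55 : ¬ q ∣ 55 := fun h' => hq.not_isUnit (hc55.isUnit_of_dvd' hqc h')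
  rw [hm] at h1
  rcases hq.dvd_or_dvd h1 with h2 | h2
  · exact h55 ((hq.dvd_of_dvd_pow h2).trans (by norm_num))
  · exact h55 ((hq.dvd_of_dvd_pow h2).trans (by norm_num))

theorem den_zsmul_eq_one (hD : 0 < D) {P : (mordellCurve D).Point} (hP : den P = 1)
    {c c' : ℤ} (hc : 5 * c ∣ den ((5 : ℤ) • P)) (hc1 : c.natAbs ≠ 1) (hc55 : IsCoprime c 55)
    (hc' : 11 * c' ∣ den ((11 : ℤ) • P)) (hc1' : c'.natAbs ≠ 1) (hc55' : IsCoprime c' 55)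
    {m : ℤ} {s t : ℕ} (hm : den (m • P) = 5 ^ s * 11 ^ t) : den (m • P) = 1 := by
  have h5 := not_prime_dvd_den_zsmul hD hP (by norm_num [Int.prime_iff_natAbs_prime]) hc hc1 hc55 hm
  have h11 := not_prime_dvd_den_zsmul hD hP (by norm_num [Int.prime_iff_natAbs_prime])
    hc' hc1' hc55' hm
  rw [hm] at h5 h11 ⊢
  have hs : s = 0 := by
    by_contra hs
    exact h5 ((dvd_pow_self 5 hs).mul_right _)
  have ht : t = 0 := by
    by_contra ht
    exact h11 ((dvd_pow_self 11 ht).mul_left _)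
  simp [hs, ht]

theorem three_dvd_of_den_add_nsmul_eq_one (hD : 0 < D) {P Q : (mordellCurve D).Point}
    (hP : den P = 1) (hQ3 : 3 ∣ den Q) (hQ : ∀ q : ℤ, Prime q → q ∣ 4 * D → ¬ q ∣ num Q) {q : ℤ}
    (hq : Prime q) (hQq : q ∣ den Q) (hC : den (P + Q) ^ 2 * den (P - Q) ^ 2 ≡ 1 [ZMOD q])
    (hr9 : (den (P + Q) ^ 2) ^ 9 ≡ 1 [ZMOD q]) (hr : ¬ den (P + Q) ^ 2 ≡ 1 [ZMOD q]) {n : ℕ}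
    (hn : den (P + n • Q) = 1) : 3 ∣ n := by
  have key : ∀ n : ℕ, den (P + n • Q) ^ 2 ≡ (den (P + Q) ^ 2) ^ n [ZMOD q] := by
    intro n
    induction n with
    | zero => simp [hP]
    | succ n ih =>
      have h1 := (den_sq_succ hD hP hq one_pos (by simpa using hQq) hQ3 hQ n).of_dvd
        (dvd_pow_self q three_ne_zero)
      have h2 := ((ih.mul_right (den (P + Q) ^ 2)).mul (hC.pow n))
      rw [one_pow, mul_one, ← pow_succ] at h2
      exact h1.trans h2
  have h := (key n).symm
  rw [hn, one_pow] at h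
  generalize den (P + Q) ^ 2 = r at *
  by_contra h3
  have h6 : n ^ 6 % 9 = 1 := by
    rw [Nat.pow_mod]
    have : n % 9 < 9 := Nat.mod_lt _ (by norm_num)
    have : n % 9 % 3 ≠ 0 := by omega
    interval_cases n % 9 <;> simp_all
  have h7 := (h.pow (n ^ 5)).symm
  rw [← pow_mul, one_pow, show n * n ^ 5 = 9 * (n ^ 6 / 9) + 1 by
    have : n * n ^ 5 = n ^ 6 := by ring
    omega, pow_succ, pow_mul] at h7
  have h8 := (hr9.pow (n ^ 6 / 9)).mul_right r
  rw [one_pow, one_mul] at h8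
  exact hr (h8.symm.trans h7.symm)

theorem three_dvd_of_den_add_zsmul_eq_one (hD : 0 < D) {P Q : (mordellCurve D).Point}
    (hP : den P = 1) (hQ3 : 3 ∣ den Q) (hQ : ∀ q : ℤ, Prime q → q ∣ 4 * D → ¬ q ∣ num Q) {q : ℤ}
    (hq : Prime q) (hQq : q ∣ den Q) (hC : den (P + Q) ^ 2 * den (P - Q) ^ 2 ≡ 1 [ZMOD q])
    (hr9 : (den (P + Q) ^ 2) ^ 9 ≡ 1 [ZMOD q]) (hr : ¬ den (P + Q) ^ 2 ≡ 1 [ZMOD q]) {n : ℤ}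
    (hn : den (P + n • Q) = 1) : 3 ∣ n := by
  obtain ⟨m, rfl | rfl⟩ := n.eq_nat_or_neg
  · rw [natCast_zsmul] at hn
    exact_mod_cast three_dvd_of_den_add_nsmul_eq_one hD hP hQ3 hQ hq hQq hC hr9 hr hn
  · rw [neg_smul, natCast_zsmul, ← neg_nsmul] at hn
    rw [dvd_neg]
    have hC9 := hC.pow 9
    rw [mul_pow, one_pow] at hC9
    have h9 := (hr9.mul_right ((den (P - Q) ^ 2) ^ 9)).symm.trans hC9
    rw [one_mul] at h9
    exact_mod_cast three_dvd_of_den_add_nsmul_eq_one hD hP (Q := -Q) (by simpa using hQ3)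
      (by simpa using hQ) hq (by simpa using hQq)
      (by rwa [← sub_eq_add_neg, sub_neg_eq_add, mul_comm]) (by rwa [← sub_eq_add_neg])
      (fun h => by
        rw [← sub_eq_add_neg] at h
        exact hr (by simpa using (h.mul_left (den (P + Q) ^ 2)).symm.trans hC)) hn

theorem not_dvd_num_of_isCoprime {Q : (mordellCurve D).Point}
    (h : IsCoprime (num Q) (4 * D)) (q : ℤ)
    (hq : Prime q) (hqD : q ∣ 4 * D) : ¬ q ∣ num Q :=
  fun h' => hq.not_isUnit (h.isUnit_of_dvd' h' hqD)

theorem num_eq_of_den_add_zsmul_ne_one {P Q R : (mordellCurve D).Point}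
    (h : ∀ n : ℤ, n ≠ 0 → den (P + n • Q) ≠ 1) (hR : den R = 1)
    (hn : ∃ n : ℤ, R = P + n • Q ∨ -R = P + n • Q) : num R = num P := by
  obtain ⟨n, hn⟩ := hn
  have h0 : n = 0 := by
    by_contra hn0
    rcases hn with hn | hn
    · exact h n hn0 (hn ▸ hR)
    · exact h n hn0 (hn ▸ (den_neg R).trans hR)
  rw [h0, zero_zsmul, add_zero] at hn
  rcases hn with hn | hn
  · rw [hn]
  · rw [← hn, num_neg]

theorem not_dvd_of_dvd_num_zsmul (hD : 0 < D) {P : (mordellCurve D).Point} {j m : ℤ}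
    (hj : ¬ 2 ∣ num (j • P)) (hm : 2 ∣ num (m • P)) : ¬ j ∣ m := by
  rintro ⟨n, rfl⟩
  rw [mul_comm, mul_smul] at hm
  exact not_dvd_num_zsmul hD Int.prime_two (by omega) hj n hm

theorem add_zsmul_self (P : (mordellCurve D).Point) (i j : ℤ) : i • P + j • P = (i + j) • P :=
  (add_zsmul P i j).symm

theorem sub_zsmul_self (P : (mordellCurve D).Point) (i j : ℤ) :
    i • P - j • P = (-(j - i)) • P := by
  rw [neg_sub, sub_zsmul, sub_eq_add_neg]

theorem exists_zsmul_eq_add_zsmul (P : (mordellCurve D).Point) {i j m : ℤ}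
    (h : j ∣ m - i ∨ j ∣ m + i) :
    ∃ n : ℤ, m • P = i • P + n • j • P ∨ -(m • P) = i • P + n • j • P := by
  rcases h with ⟨n, hn⟩ | ⟨n, hn⟩
  · refine ⟨n, Or.inl ?_⟩
    rw [smul_smul, add_zsmul_self]
    congr 1
    linear_combination hn
  · refine ⟨-n, Or.inr ?_⟩
    rw [smul_smul, add_zsmul_self, ← neg_zsmul]
    congr 1
    linear_combination -hn

/-- The integral points with even numerator among the multiples of `(14, 37)` on
`y ^ 2 = x ^ 3 - 55 * 5 ^ 2`, allowing the primes `5` and `11` in denominators. -/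
theorem num_eq_of_even_five {P : (mordellCurve (55 * 5 ^ 2)).Point}
    (hP : HasCoords P 14 37 1) {m : ℤ} {s t : ℕ} (hm : den (m • P) = 5 ^ s * 11 ^ t)
    (heven : 2 ∣ num (m • P)) : den (m • P) = 1 ∧ num (m • P) = 14 := by
  have hD : (0 : ℤ) < 55 * 5 ^ 2 := by norm_num
  have h1 : HasCoords ((1 : ℤ) • P) 14 37 1 := by rwa [one_zsmul]
  have h2 : HasCoords ((2 : ℤ) • P)
      48104
      (-10381933)
      37 :=
    h1.double (by norm_num) (by norm_num) (Int.isCoprime_iff_gcd_eq_one.2 (by norm_num))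
      (by norm_num) (by norm_num) (by norm_num)
  have h3 : HasCoords ((3 : ℤ) • P)
      17143793731
      2241898814492254
      14469 :=
    h2.add h1 (by norm_num) (by norm_num) (Int.isCoprime_iff_gcd_eq_one.2 (by norm_num))
      (by norm_num) (by norm_num) (by norm_num)
  have h4 : HasCoords ((4 : ℤ) • P)
      1678052685859692464
      (-554620279206637800938120687)
      384131521 :=
    h3.add h1 (by norm_num) (by norm_num) (Int.isCoprime_iff_gcd_eq_one.2 (by norm_num))
      (by norm_num) (by norm_num) (by norm_num)
  have h5 : HasCoords ((5 : ℤ) • P)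
      52355420201877982715946766934
      (-11979272206808187216060704589083267389467127)
      13399186885795 :=
    h3.add h2 (by norm_num) (by norm_num) (Int.isCoprime_iff_gcd_eq_one.2 (by norm_num))
      (by norm_num) (by norm_num) (by norm_num)
  have h6 : HasCoords ((6 : ℤ) • P)
      88113227386351400533271873445230672851321
      24116085857063199606501537852220838161853606812845798624418381
      64876067893776846252 :=
    h3.double (by norm_num) (by norm_num) (Int.isCoprime_iff_gcd_eq_one.2 (by norm_num))
      (by norm_num) (by norm_num) (by norm_num)
  have h8 : HasCoords ((8 : ℤ) • P)
      16808062034630438404516160189645250170393446644937102152986494593909535904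
      68908148917329104452080899759040578338094326144675310472038727618861282031596893135817380970561803171029472833
      213047131429090451770455526378874927 :=
    h4.double (by norm_num) (by norm_num) (Int.isCoprime_iff_gcd_eq_one.2 (by norm_num))
      (by norm_num) (by norm_num) (by norm_num)
  have h9 : HasCoords ((9 : ℤ) • P)
      158715528320468368016946824860802134460280080162482078772268350449338910349164851331944797971
      632981123396813992971380892838535019913552572446826392640452528868671034424455545907731190709787594673330493462751125693005751081081531894
      3712067747871144756596641292125018708853520147 :=
    h5.add h4 (by norm_num) (by norm_num) (Int.isCoprime_iff_gcd_eq_one.2 (by norm_num))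
      (by norm_num) (by norm_num) (by norm_num)
  have h10 : HasCoords ((10 : ℤ) • P)
      1879226860839710844131336512091269632893221635133405045010970444735628827804559238304120630751675306182746425624184
      (-2571568009397792812110917224883494795635806613463322917120168103158967958166982017317061019295648537297822121794941768169593179464074206396029458167843581502119638444696627)
      160512507054832791260477763130672090726217312811655760965 :=
    h5.double (by norm_num) (by norm_num) (Int.isCoprime_iff_gcd_eq_one.2 (by norm_num))
      (by norm_num) (by norm_num) (by norm_num)
  have h11 : HasCoords ((11 : ℤ) • P)
      1590232054969982310011638958702504740878623998966250818407638126264807540691709765488965872228553405928858122762103199981370377325944599614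
      1980089569938339033213001185602997201399302453051140030471579556062563731620288935747773828802253372934214483384449802960327241514780794513205321660565276452567065202130043114261001879091836301450865339315237
      204539256162039516636684425496857248352038342016736860627883787727711 :=
    h6.add h5 (by norm_num) (by norm_num) (Int.isCoprime_iff_gcd_eq_one.2 (by norm_num))
      (by norm_num) (by norm_num) (by norm_num)
  have hden : den (m • P) = 1 := den_zsmul_eq_one hD hP.den_eq
    (c := 2679837377159)
    (c' := 18594477832912683330607675045168840759276212910612441875262162520701)
    (by rw [h5.den_eq]; norm_num) (by norm_num) (Int.isCoprime_iff_gcd_eq_one.2 (by norm_num))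
    (by rw [h11.den_eq]; norm_num) (by norm_num) (Int.isCoprime_iff_gcd_eq_one.2 (by norm_num)) hm
  refine ⟨hden, ?_⟩
  have hm3 : ¬ (3 : ℤ) ∣ m := not_dvd_of_dvd_num_zsmul hD (by rw [h3.num_eq]; norm_num) heven
  have hQ3 := not_dvd_num_of_isCoprime (Q := (3 : ℤ) • P)
    (by rw [h3.num_eq]; exact Int.isCoprime_iff_gcd_eq_one.2 (by norm_num))
  have hQ9 := not_dvd_num_of_isCoprime (Q := (9 : ℤ) • P)
    (by rw [h9.num_eq]; exact Int.isCoprime_iff_gcd_eq_one.2 (by norm_num))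
  rw [← h1.num_eq]
  refine num_eq_of_den_add_zsmul_ne_one (fun n hn h => ?_) hden
    (exists_zsmul_eq_add_zsmul P (j := 3) (by omega))
  obtain ⟨l, rfl⟩ : (3 : ℤ) ∣ n := by
    refine three_dvd_of_den_add_zsmul_eq_one (q := 7) hD h1.den_eq
      (by rw [h3.den_eq]; norm_num) hQ3 (by norm_num [Int.prime_iff_natAbs_prime])
      (by rw [h3.den_eq]; norm_num) ?_ ?_ ?_ h
    all_goals
      simp only [add_zsmul_self, sub_zsmul_self, show (1 + 3 : ℤ) = 4 by norm_num,
        show (3 - 1 : ℤ) = 2 by norm_num, den_neg_zsmul, h4.den_eq, h2.den_eq]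
      decide
  rw [smul_smul, show 3 * l * 3 = l * 9 by ring, mul_smul] at h
  refine den_add_zsmul_ne_one hD h1.den_eq (by omega) (v := 2) (t := 3)
    (by rw [h9.den_eq]; norm_num) (by norm_num) (by norm_num) hQ9 ?_ ?_ ?_ h
  all_goals
    simp only [add_zsmul_self, sub_zsmul_self, show (1 + 9 : ℤ) = 10 by norm_num,
      show (9 - 1 : ℤ) = 8 by norm_num, den_neg_zsmul, h10.den_eq, h8.den_eq]
    norm_num

/-- The integral points with even numerator among the multiples of `(1226, -36599)` on
`y ^ 2 = x ^ 3 - 55 * 3025 ^ 2`, allowing the primes `5` and `11` in denominators. -/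
theorem num_eq_of_even_three_thousand_twenty_five {P : (mordellCurve (55 * 3025 ^ 2)).Point}
    (hP : HasCoords P 1226 (-36599) 1) {m : ℤ} {s t : ℕ} (hm : den (m • P) = 5 ^ s * 11 ^ t)
    (heven : 2 ∣ num (m • P)) : den (m • P) = 1 ∧ num (m • P) = 1226 := by
  have hD : (0 : ℤ) < 55 * 3025 ^ 2 := by norm_num
  have h1 : HasCoords ((1 : ℤ) • P) 1226 (-36599) 1 := by rwa [one_zsmul]
  have h2 : HasCoords ((2 : ℤ) • P)
      1798862652944
      2147414310185025253
      36599 :=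
    h1.double (by norm_num) (by norm_num) (Int.isCoprime_iff_gcd_eq_one.2 (by norm_num))
      (by norm_num) (by norm_num) (by norm_num)
  have h3 : HasCoords ((3 : ℤ) • P)
      2883954572669304737571636559
      (-154875464442147842939142110361579776386748)
      78325917459 :=
    h2.add h1 (by norm_num) (by norm_num) (Int.isCoprime_iff_gcd_eq_one.2 (by norm_num))
      (by norm_num) (by norm_num) (by norm_num)
  have h4 : HasCoords ((4 : ℤ) • P)
      6969451391252267455314411424052099513758155110624
      (-14829640482856501923971866908501538850289848364182070289746078833630814193)
      78593216338461739234547 :=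
    h3.add h1 (by norm_num) (by norm_num) (Int.isCoprime_iff_gcd_eq_one.2 (by norm_num))
      (by norm_num) (by norm_num) (by norm_num)
  have h5 : HasCoords ((5 : ℤ) • P)
      22004693861872883023537925812491987236446559294936737377895994049058699859066
      3001790989962638682516044036641205066139307846055676737368469006657944808017772241748455407966492464258456196342489
      3851983153518276836017976710371798895 :=
    h3.add h2 (by norm_num) (by norm_num) (Int.isCoprime_iff_gcd_eq_one.2 (by norm_num))
      (by norm_num) (by norm_num) (by norm_num)
  have h6 : HasCoords ((6 : ℤ) • P)
      69175718335880566502480989703143204167834789150831347321316275186774685677664896044315172681394610153383276361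
      (-575347789863648287653547891742390988017870320348123424330696408514419066376085618066589041589615970099705616694617883738288644587884408371561028411641460141896227141)
      24261525688639922853452281792904332420224202218866664 :=
    h3.double (by norm_num) (by norm_num) (Int.isCoprime_iff_gcd_eq_one.2 (by norm_num))
      (by norm_num) (by norm_num) (by norm_num)
  have h11 : HasCoords ((11 : ℤ) • P)
      1904843796329283640604583221836950430939012346450478688655796827780596902459009276357756130058394900027657881670507242134295088182599248162154063850404599914448532019555650746775544572195081536264807448078856286356378246898975980788502083228217383598227698197465425864240594151767667470587942198477156080906222394643226555726089922766119657416192050652284009871606436426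
      79788883909843880363463475768833073557863888346278170339556630726843431302723360624739643919656958378063756176215520896882691430805291798042487411140270541105953840685220334150578888956010353290875082825929565683063762587969757072625746199215673292699150885969564426727873815445378829413504315559316421254287975314011308085112181793060535318306411529789441103313675138683638601224028835185460262684899943938190865522759121334057320496458866438157240193087852437165806731275449506452266151672689738415019423919782902291687823651640696836648792214124028799
      1013461251086530910071051346138579570266490455474914988910429502592882619524844527234359622435689864968819028067699682395108261900009852770906651413185313162320650445283319892702758889 :=
    h6.add h5 (by norm_num) (by norm_num) (Int.isCoprime_iff_gcd_eq_one.2 (by norm_num))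
      (by norm_num) (by norm_num) (by norm_num)
  have hden : den (m • P) = 1 := den_zsmul_eq_one hD hP.den_eq
    (c := 770396630703655367203595342074359779)
    (c' := 92132841007866446370095576921689051842408223224992271719129954781171147229531320657669056585062714997165366187972698399555296536364532070082422855744119378392786404116665444791159899)
    (by rw [h5.den_eq]; norm_num) (by norm_num) (Int.isCoprime_iff_gcd_eq_one.2 (by norm_num))
    (by rw [h11.den_eq]; norm_num) (by norm_num) (Int.isCoprime_iff_gcd_eq_one.2 (by norm_num)) hm
  refine ⟨hden, ?_⟩
  have hm3 : ¬ (3 : ℤ) ∣ m := not_dvd_of_dvd_num_zsmul hD (by rw [h3.num_eq]; norm_num) heven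
  have hQ3 := not_dvd_num_of_isCoprime (Q := (3 : ℤ) • P)
    (by rw [h3.num_eq]; exact Int.isCoprime_iff_gcd_eq_one.2 (by norm_num))
  rw [← h1.num_eq]
  refine num_eq_of_den_add_zsmul_ne_one (fun n hn h => ?_) hden
    (exists_zsmul_eq_add_zsmul P (j := 3) (by omega))
  refine den_add_zsmul_ne_one hD h1.den_eq hn (v := 1) (t := 1)
    (by rw [h3.den_eq]; norm_num) (by norm_num) (by norm_num) hQ3 ?_ ?_ ?_ h
  all_goals
    simp only [add_zsmul_self, sub_zsmul_self, show (1 + 3 : ℤ) = 4 by norm_num,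
      show (3 - 1 : ℤ) = 2 by norm_num, den_neg_zsmul, h4.den_eq, h2.den_eq]
    norm_num

/-- The integral points with even numerator among the multiples of `(4, -3)` on
`y ^ 2 = x ^ 3 - 55 * 1 ^ 2`, allowing the primes `5` and `11` in denominators. -/
theorem num_eq_of_even_one {P : (mordellCurve (55 * 1 ^ 2)).Point}
    (hP : HasCoords P 4 (-3) 1) {m : ℤ} {s t : ℕ} (hm : den (m • P) = 5 ^ s * 11 ^ t)
    (heven : 2 ∣ num (m • P)) : den (m • P) = 1 ∧ (num (m • P) = 4 ∨ num (m • P) = 56) := by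
  have hD : (0 : ℤ) < 55 * 1 ^ 2 := by norm_num
  have h1 : HasCoords ((1 : ℤ) • P) 4 (-3) 1 := by rwa [one_zsmul]
  have h2 : HasCoords ((2 : ℤ) • P)
      56
      419
      1 :=
    h1.double (by norm_num) (by norm_num) (Int.isCoprime_iff_gcd_eq_one.2 (by norm_num))
      (by norm_num) (by norm_num) (by norm_num)
  have h3 : HasCoords ((3 : ℤ) • P)
      3961
      (-212499)
      26 :=
    h2.add h1 (by norm_num) (by norm_num) (Int.isCoprime_iff_gcd_eq_one.2 (by norm_num))
      (by norm_num) (by norm_num) (by norm_num)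
  have h4 : HasCoords ((4 : ℤ) • P)
      2464784
      3830972207
      419 :=
    h3.add h1 (by norm_num) (by norm_num) (Int.isCoprime_iff_gcd_eq_one.2 (by norm_num))
      (by norm_num) (by norm_num) (by norm_num)
  have h5 : HasCoords ((5 : ℤ) • P)
      13855340524
      (-1605121209718107)
      33895 :=
    h3.add h2 (by norm_num) (by norm_num) (Int.isCoprime_iff_gcd_eq_one.2 (by norm_num))
      (by norm_num) (by norm_num) (by norm_num)
  have h6 : HasCoords ((6 : ℤ) • P)
      87172426694809
      724628324359815914557
      3683316 :=
    h3.double (by norm_num) (by norm_num) (Int.isCoprime_iff_gcd_eq_one.2 (by norm_num))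
      (by norm_num) (by norm_num) (by norm_num)
  have h7 : HasCoords ((7 : ℤ) • P)
      39244038797996970844
      (-245750873355504871567563966717)
      970796863 :=
    h4.add h3 (by norm_num) (by norm_num) (Int.isCoprime_iff_gcd_eq_one.2 (by norm_num))
      (by norm_num) (by norm_num) (by norm_num)
  have h8 : HasCoords ((8 : ℤ) • P)
      10693979155560600513197024
      16797873237947825725278367655195905727
      1605177354733 :=
    h4.double (by norm_num) (by norm_num) (Int.isCoprime_iff_gcd_eq_one.2 (by norm_num))
      (by norm_num) (by norm_num) (by norm_num)
  have h11 : HasCoords ((11 : ℤ) • P)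
      611693158044170102718128667261093537117827279764
      478383829040183423260998319534898191312708634245073060499569610927719733
      87822990770491273099319 :=
    h6.add h5 (by norm_num) (by norm_num) (Int.isCoprime_iff_gcd_eq_one.2 (by norm_num))
      (by norm_num) (by norm_num) (by norm_num)
  have h17 : HasCoords ((17 : ℤ) • P)
      220120059765889196707067401379005309713474048210043674377020051326141876647223293790690109333296690778562484023164
      59408524031440211608334215895844662850735590323571454401968447907324971207849306287326072172028189935365526315689046856778509180890954699838975125255493331539764226716243
      225000109733012669540813074192354764759732376780618486673 :=
    h11.add h6 (by norm_num) (by norm_num) (Int.isCoprime_iff_gcd_eq_one.2 (by norm_num))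
      (by norm_num) (by norm_num) (by norm_num)
  have h18 : HasCoords ((18 : ℤ) • P)
      6510158697753467122542160417715138900619793869831186930080988133094363557182932662619886935839491835176136805655021945803886169
      (-16610675379994104956430073882052305660479281565751467623371535467778084837879175896357518706415644314684782165161423665718926411790251095692009110213568327026715311450227646084924760923102883)
      108911548911090711706860573482756400497427902549943531527274588 :=
    h11.add h7 (by norm_num) (by norm_num) (Int.isCoprime_iff_gcd_eq_one.2 (by norm_num))
      (by norm_num) (by norm_num) (by norm_num)
  have h19 : HasCoords ((19 : ℤ) • P)
      3158400260757160457691879962832560139961221412156124656785900507167559098933534087131910171437537123185470096886836013152523705100383846350284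
      (-24921239860739134671251472134666550635703220681974935921589158256546221593444978503992953523325933898184228467867148482731475044096167735343372182585181902693982835006045656995389074558628244558556358390063890507)
      28723149528581708337807353725953105241404071461285534377126768003103241 :=
    h11.add h8 (by norm_num) (by norm_num) (Int.isCoprime_iff_gcd_eq_one.2 (by norm_num))
      (by norm_num) (by norm_num) (by norm_num)
  have hden : den (m • P) = 1 := den_zsmul_eq_one hD hP.den_eq
    (c := 6779)
    (c' := 7983908251862843009029)
    (by rw [h5.den_eq]; norm_num) (by norm_num) (Int.isCoprime_iff_gcd_eq_one.2 (by norm_num))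
    (by rw [h11.den_eq]; norm_num) (by norm_num) (Int.isCoprime_iff_gcd_eq_one.2 (by norm_num)) hm
  refine ⟨hden, ?_⟩
  have hm3 : ¬ (3 : ℤ) ∣ m := not_dvd_of_dvd_num_zsmul hD (by rw [h3.num_eq]; norm_num) heven
  have hQ6 := not_dvd_num_of_isCoprime (Q := (6 : ℤ) • P)
    (by rw [h6.num_eq]; exact Int.isCoprime_iff_gcd_eq_one.2 (by norm_num))
  have hQ18 := not_dvd_num_of_isCoprime (Q := (18 : ℤ) • P)
    (by rw [h18.num_eq]; exact Int.isCoprime_iff_gcd_eq_one.2 (by norm_num))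
  rw [← h1.num_eq, ← h2.num_eq]
  rcases (by omega : (6 ∣ m - 1 ∨ 6 ∣ m + 1) ∨ (6 ∣ m - 2 ∨ 6 ∣ m + 2)) with hmod | hmod
  · refine Or.inl (num_eq_of_den_add_zsmul_ne_one (fun n hn h => ?_) hden
      (exists_zsmul_eq_add_zsmul P hmod))
    obtain ⟨l, rfl⟩ : (3 : ℤ) ∣ n := by
      refine three_dvd_of_den_add_zsmul_eq_one (q := 13) hD h1.den_eq
        (by rw [h6.den_eq]; norm_num) hQ6 (by norm_num [Int.prime_iff_natAbs_prime])
        (by rw [h6.den_eq]; norm_num) ?_ ?_ ?_ h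
      all_goals
        simp only [add_zsmul_self, sub_zsmul_self, show (1 + 6 : ℤ) = 7 by norm_num,
          show (6 - 1 : ℤ) = 5 by norm_num, den_neg_zsmul, h7.den_eq, h5.den_eq]
        decide
    rw [smul_smul, show 3 * l * 6 = l * 18 by ring, mul_smul] at h
    obtain ⟨j, rfl⟩ : (3 : ℤ) ∣ l := by
      refine three_dvd_of_den_add_zsmul_eq_one (q := 73) hD h1.den_eq
        (by rw [h18.den_eq]; norm_num) hQ18 (by norm_num [Int.prime_iff_natAbs_prime])
        (by rw [h18.den_eq]; norm_num) ?_ ?_ ?_ h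
      all_goals
        simp only [add_zsmul_self, sub_zsmul_self, show (1 + 18 : ℤ) = 19 by norm_num,
          show (18 - 1 : ℤ) = 17 by norm_num, den_neg_zsmul, h19.den_eq, h17.den_eq]
        decide
    rw [smul_smul, show 3 * j * 18 = j * 54 by ring, mul_smul] at h
    have hQ54 : ∀ q : ℤ, Prime q → q ∣ 4 * (55 * 1 ^ 2) →
        ¬ q ∣ num ((18 : ℤ) • P + (18 : ℤ) • P + (18 : ℤ) • P) := fun q hq hqD =>
      not_dvd_num_add hD hq hqD (not_dvd_num_add hD hq hqD (hQ18 q hq hqD) (hQ18 q hq hqD))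
        (hQ18 q hq hqD)
    have h9 : (3 : ℤ) ^ 2 ∣ den ((18 : ℤ) • P) := by rw [h18.den_eq]; norm_num
    have e1 := den_sq_triple hD h1.den_eq two_pos h9 hQ18
    have e2 := den_sq_triple hD h1.den_eq two_pos (Q := -((18 : ℤ) • P))
      (by rwa [den_neg]) (by simpa using hQ18)
    rw [show (1 : ℤ) • P + (-((18 : ℤ) • P) + -((18 : ℤ) • P) + -((18 : ℤ) • P)) =
      (1 : ℤ) • P - ((18 : ℤ) • P + (18 : ℤ) • P + (18 : ℤ) • P) by abel, sub_neg_eq_add,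
      ← sub_eq_add_neg] at e2
    simp only [add_zsmul_self _ 1, sub_zsmul_self, show (1 + 18 : ℤ) = 19 by norm_num,
      show (18 - 1 : ℤ) = 17 by norm_num, den_neg_zsmul, h19.den_eq, h17.den_eq] at e1 e2
    have e3 := e1.trans (by decide : _ ≡ 487 [ZMOD 3 ^ (3 * 2)])
    have e4 := e2.trans (by decide : _ ≡ 244 [ZMOD 3 ^ (3 * 2)])
    refine den_add_zsmul_ne_one hD h1.den_eq (n := j) (by omega) (v := 3) (t := 5)
      (three_pow_dvd_den_triple hD two_ne_zero h9) (by norm_num) (by norm_num) hQ54 ?_ ?_ ?_ ?_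
    · have := e3.dvd
      norm_num at this ⊢
      omega
    · have := e3.dvd
      norm_num at this ⊢
      omega
    · have := (e3.mul e4).dvd
      norm_num at this ⊢
      omega
    · rwa [add_zsmul_self, add_zsmul_self]
  · refine Or.inr (num_eq_of_den_add_zsmul_ne_one (fun n hn h => ?_) hden
      (exists_zsmul_eq_add_zsmul P hmod))
    refine den_add_zsmul_ne_one hD h2.den_eq hn (v := 1) (t := 1)
      (by rw [h6.den_eq]; norm_num) (by norm_num) (by norm_num) hQ6 ?_ ?_ ?_ h
    all_goals
      simp only [add_zsmul_self, sub_zsmul_self, show (2 + 6 : ℤ) = 8 by norm_num,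
        show (6 - 2 : ℤ) = 4 by norm_num, den_neg_zsmul, h8.den_eq, h4.den_eq]
      norm_num

theorem isCoprime_fiftyfive_iff_not_dvd {a : ℤ} : IsCoprime a 55 ↔ ¬ 5 ∣ a ∧ ¬ 11 ∣ a := by
  have h5 : Prime (5 : ℤ) := by norm_num [Int.prime_iff_natAbs_prime]
  have h11 : Prime (11 : ℤ) := by norm_num [Int.prime_iff_natAbs_prime]
  rw [show (55 : ℤ) = 5 * 11 by norm_num, IsCoprime.mul_right_iff, isCoprime_comm,
    h5.coprime_iff_not_dvd, isCoprime_comm, h11.coprime_iff_not_dvd]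

theorem dvd_fiftyfive_of_dvd (hk : k ∣ 55 ^ 2) (p : ℤ) (hp : Prime p) (h : p ∣ k) : p ∣ 55 :=
  hp.dvd_of_dvd_pow (h.trans hk)

theorem not_pow_three_dvd (hk : k ∣ 55 ^ 2) (p : ℤ) (hp : Prime p) : ¬ p ^ 3 ∣ k := by
  intro h
  obtain ⟨m, hm⟩ := dvd_fiftyfive_of_dvd hk p hp ((dvd_pow_self p three_ne_zero).trans h)
  have h1 : p ^ 2 * p ∣ p ^ 2 * m ^ 2 := by
    rw [← mul_pow, ← hm, ← pow_succ]
    exact h.trans hk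
  obtain ⟨l, rfl⟩ := hp.dvd_of_dvd_pow
    ((mul_dvd_mul_iff_left (pow_ne_zero 2 hp.ne_zero)).1 h1)
  have hsq : Squarefree (55 : ℤ) := by
    rw [← Int.squarefree_natAbs]
    norm_num [Nat.squarefree_iff_minSqFac]
    decide +kernel
  exact hp.not_isUnit (hsq p ⟨l, by rw [hm]; ring⟩)

theorem exists_eq_triple_mod_of_hasCoords (hk : 0 < k) (hk55 : k ∣ 55 ^ 2)
    {P₀ : (mordellCurve (55 * k ^ 2)).Point} {a b d u v : ℤ} (h₀ : HasCoords P₀ a b d)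
    (ha : ¬ 5 ∣ a ∧ ¬ 11 ∣ a) (hu : 3 * b - 55 * (k * d ^ 3) = u * (u ^ 2 - 165 * v ^ 2))
    (hv : b + 3 * (k * d ^ 3) = v * (3 * u ^ 2 - 55 * v ^ 2))
    (P : (mordellCurve (55 * k ^ 2)).Point) (hP : IsCoprime (num P) 55) :
    ∃ Q, (P = Q + Q + Q ∨ P + P₀ = Q + Q + Q ∨ P - P₀ = Q + Q + Q) ∧
      IsCoprime (num (Q + Q + Q)) 55 := by
  have ha' : IsCoprime (num P₀) 55 := by
    rw [h₀.num_eq]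
    exact isCoprime_fiftyfive_iff_not_dvd.2 ha
  obtain ⟨⟨hd, -⟩, h, rfl⟩ := h₀
  have hdq : (d : ℚ) ≠ 0 := by exact_mod_cast hd.ne'
  have huq := congrArg (Int.cast : ℤ → ℚ) hu
  have hvq := congrArg (Int.cast : ℤ → ℚ) hv
  push_cast at huq hvq
  obtain ⟨Q, h⟩ := exists_eq_triple_mod hk (not_pow_three_dvd hk55) (dvd_fiftyfive_of_dvd hk55) h
    ha' (β₀ := ⟨u / d, v / d⟩) (by
      rw [quadField_cube]
      ext
      · simp
        field_simp
        linear_combination huq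
      · simp
        field_simp
        linear_combination hvq) P hP
  refine ⟨Q, h, ?_⟩
  rcases h with h | h | h
  · rwa [← h]
  · rw [← h]
    exact isCoprime_num_add hk hP ha'
  · rw [← h, sub_eq_add_neg]
    exact isCoprime_num_add hk hP (isCoprime_num_neg ha')

theorem isCoprime_num_of_fiftyfive (hk : 0 < k) (hk55 : k ∣ 55 ^ 2)
    {Q : (mordellCurve (55 * k ^ 2)).Point} (hQ : IsCoprime (num Q) 55) :
    IsCoprime (num Q) (55 * k ^ 2) := by
  refine IsCoprime.mul_right hQ (IsCoprime.pow_right ?_)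
  refine (isCoprime_of_no_common_prime hk.ne' fun p hp h1 h2 => ?_).symm
  exact isCoprime_fiftyfive_iff.1 hQ p hp (dvd_fiftyfive_of_dvd hk55 p hp h1) h2

/-- The coordinates of a nonzero point, as natural numbers subject to decidable conditions. -/
theorem exists_nat_coords {D : ℕ} {D' : ℤ} (hDD' : (D : ℤ) = D') (hD : 0 < D')
    {P : (mordellCurve D').Point} (hP : P ≠ 0) :
    ∃ c e : ℕ, num P = c ∧ den P = e ∧ 0 < e ∧ D * e ^ 6 ≤ c ^ 3 ∧
      Nat.sqrt (c ^ 3 - D * e ^ 6) ^ 2 = c ^ 3 - D * e ^ 6 ∧ Nat.gcd c e = 1 := by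
  have hsq := ynum_sq P
  have hc := isCoprime_num_den P
  have h0 := (den_nonneg P).lt_of_ne' fun h => hP (eq_zero_of_den_eq_zero h)
  obtain ⟨e, he⟩ := Int.eq_ofNat_of_zero_le (den_nonneg P)
  obtain ⟨c, hc'⟩ := Int.eq_ofNat_of_zero_le (num_pos hD P).le
  rw [he, hc'] at hc hsq
  rw [he] at h0
  have hsq' : (ynum P).natAbs ^ 2 + D * e ^ 6 = c ^ 3 := by
    zify
    rw [sq_abs, hsq, hDD']
    ring
  refine ⟨c, e, hc', he, by exact_mod_cast h0, by omega, ?_, Nat.isCoprime_iff_coprime.1 hc⟩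
  rw [← hsq', Nat.add_sub_cancel, sq, sq, Nat.sqrt_eq]

theorem lt_of_mul_pow_six_le {D B M c e : ℕ} (hM : B ^ 3 ≤ D * M ^ 6) (hc : c < B)
    (h : D * e ^ 6 ≤ c ^ 3) : e < M := by
  by_contra hle
  rw [not_lt] at hle
  have h1 : c ^ 3 < B ^ 3 := Nat.pow_lt_pow_left hc three_ne_zero
  have h2 : D * M ^ 6 ≤ D * e ^ 6 := by gcongr
  omega

/-- Mordell–Weil: the points whose abscissa is prime to `55` are the multiples of `P₀`. -/
theorem mem_zmultiples_of_hasCoords (hk : 0 < k) (hk55 : k ∣ 55 ^ 2)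
    {P₀ : (mordellCurve (55 * k ^ 2)).Point} {a b d u v : ℤ} (h₀ : HasCoords P₀ a b d)
    (ha : ¬ 5 ∣ a ∧ ¬ 11 ∣ a) (hu : 3 * b - 55 * (k * d ^ 3) = u * (u ^ 2 - 165 * v ^ 2))
    (hv : b + 3 * (k * d ^ 3) = v * (3 * u ^ 2 - 55 * v ^ 2))
    (hthird : ∀ Q : (mordellCurve (55 * k ^ 2)).Point, IsCoprime (num (Q + Q + Q)) 55 →
      IsCoprime (num Q) 55)
    {D B M : ℕ} (hD : (D : ℤ) = 55 * k ^ 2) (hB0 : 0 < B)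
    (hB : 576 * 1728 ^ 2 * (9 * a ^ 2) < (B : ℤ) ^ 7) (hM : B ^ 3 ≤ D * M ^ 6)
    (hsmall : searchPoints (fun c e => decide ((c : ℤ) = a ∧ (e : ℤ) = d)) D 1 M B = true)
    (P : (mordellCurve (55 * k ^ 2)).Point) (hP : IsCoprime (num P) 55) :
    P ∈ AddSubgroup.zmultiples P₀ := by
  have hDpos : 0 < 55 * k ^ 2 := by positivity
  refine mem_zmultiples_of_descent (H := fun Q => IsCoprime (num Q) 55) (μ := num) (B := B)
    (C := 576 * 1728 ^ 2) (c := 1) hDpos (num_pos hDpos) (by norm_num) (fun Q => (one_mul _).ge)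
    (fun Q hQ => num_pow_nine_le hDpos Q (isCoprime_num_of_fiftyfive hk hk55 hQ)) (fun P hP => ?_)
    (by exact_mod_cast hB0) (by rwa [one_pow, one_mul, h₀.num_eq]) (fun Q _ hQ => ?_) P hP
  · obtain ⟨Q, h, hQ⟩ := exists_eq_triple_mod_of_hasCoords hk hk55 h₀ ha hu hv P hP
    exact ⟨Q, hthird Q hQ, h⟩
  · by_cases hQ0 : Q = 0
    · rw [hQ0]
      exact zero_mem _
    obtain ⟨c, e, hc, he, h1, h2, h3, h4⟩ := exists_nat_coords hD hDpos hQ0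
    rw [hc] at hQ
    have hcB : c < B := by exact_mod_cast hQ
    obtain ⟨e1, e2⟩ := of_decide_eq_true (searchPoints_spec hsmall e
      (lt_of_mul_pow_six_le hM hcB h2) c hcB (by rw [one_mul]; exact ⟨h1, h2, h3, h4⟩))
    rw [one_mul] at e1
    rcases eq_or_eq_neg_of_num_den (hc.trans (e1.trans h₀.num_eq.symm))
      (he.trans (e2.trans h₀.den_eq.symm)) with rfl | rfl
    · exact AddSubgroup.mem_zmultiples _
    · exact neg_mem (AddSubgroup.mem_zmultiples _)

theorem exists_hasCoords {D x y z : ℤ} (hD : D ≠ 0) (hz : 0 < z) (hyz : IsCoprime y z)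
    (h : x ^ 2 + D * z ^ 6 = y ^ 3) : ∃ P : (mordellCurve D).Point, HasCoords P y x z := by
  have hzq : (z : ℚ) ≠ 0 := by exact_mod_cast hz.ne'
  have hq := congrArg (Int.cast : ℤ → ℚ) h
  push_cast at hq
  exact ⟨_, ⟨hz, hyz⟩, nonsingular_of_eq hD (by field_simp; linear_combination hq), rfl⟩

theorem isCoprime_num_of_triple {D : ℤ} (h5 : ∀ Q : (mordellCurve D).Point,
    5 ∣ num Q → 5 ∣ num (Q + Q + Q)) (h11 : ∀ Q : (mordellCurve D).Point,
    11 ∣ num Q → 11 ∣ num (Q + Q + Q)) (Q : (mordellCurve D).Point)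
    (h : IsCoprime (num (Q + Q + Q)) 55) : IsCoprime (num Q) 55 := by
  rw [isCoprime_fiftyfive_iff_not_dvd] at *
  exact ⟨fun h' => h.1 (h5 Q h'), fun h' => h.2 (h11 Q h')⟩

theorem prime_five : Prime (5 : ℤ) := by norm_num [Int.prime_iff_natAbs_prime]

theorem prime_eleven : Prime (11 : ℤ) := by norm_num [Int.prime_iff_natAbs_prime]

theorem eq_of_one {x y z : ℤ} {s t : ℕ} (hz : z = 5 ^ s * 11 ^ t) (hyz : IsCoprime y z)
    (hy : IsCoprime y 55) (h2 : 2 ∣ y) (h : x ^ 2 + 55 * 1 ^ 2 * z ^ 6 = y ^ 3) :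
    z = 1 ∧ (y = 4 ∨ y = 56) := by
  obtain ⟨P₀, h₀⟩ := exists_hasCoords (D := 55 * 1 ^ 2) (x := -3) (y := 4) (z := 1)
    (by norm_num) (by norm_num) isCoprime_one_right (by norm_num)
  obtain ⟨P, hP⟩ := exists_hasCoords (by norm_num) (by rw [hz]; positivity) hyz h
  obtain ⟨m, rfl⟩ := mem_zmultiples_of_hasCoords (by norm_num) (by norm_num) h₀ (by norm_num)
    (u := -4) (v := 0) (by norm_num) (by norm_num)
    (isCoprime_num_of_triple
      (fun Q h => absurd h (not_dvd_num_of_sq_not_dvd prime_five (by norm_num) (by norm_num) Q))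
      (fun Q h => absurd h (not_dvd_num_of_sq_not_dvd prime_eleven (by norm_num) (by norm_num) Q)))
    (D := 55) (B := 43) (M := 4) (by norm_num) (by norm_num) (by norm_num) (by norm_num)
    (by decide +kernel) P (by rwa [hP.num_eq])
  have := num_eq_of_even_one h₀ (m := m) (s := s) (t := t) (hP.den_eq.trans hz)
    (by rw [← hP.num_eq] at h2; exact h2)
  rwa [← hP.num_eq, ← hP.den_eq]

theorem eq_of_five {x y z : ℤ} {s t : ℕ} (hz : z = 5 ^ s * 11 ^ t) (hyz : IsCoprime y z)
    (hy : IsCoprime y 55) (h2 : 2 ∣ y) (h : x ^ 2 + 55 * 5 ^ 2 * z ^ 6 = y ^ 3) :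
    z = 1 ∧ y = 14 := by
  obtain ⟨P₀, h₀⟩ := exists_hasCoords (D := 55 * 5 ^ 2) (x := 37) (y := 14) (z := 1)
    (by norm_num) (by norm_num) isCoprime_one_right (by norm_num)
  obtain ⟨P, hP⟩ := exists_hasCoords (by norm_num) (by rw [hz]; positivity) hyz h
  obtain ⟨m, rfl⟩ := mem_zmultiples_of_hasCoords (by norm_num) (by norm_num) h₀ (by norm_num)
    (u := 1) (v := -1) (by norm_num) (by norm_num)
    (isCoprime_num_of_triple
      (fun Q h => dvd_num_triple prime_five (by norm_num) (by norm_num) (D' := 11) (by norm_num)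
        (by norm_num) Q h)
      (fun Q h => absurd h (not_dvd_num_of_sq_not_dvd prime_eleven (by norm_num) (by norm_num) Q)))
    (D := 1375) (B := 61) (M := 3) (by norm_num) (by norm_num) (by norm_num) (by norm_num)
    (by decide +kernel) P (by rwa [hP.num_eq])
  have := num_eq_of_even_five h₀ (m := m) (s := s) (t := t) (hP.den_eq.trans hz)
    (by rw [← hP.num_eq] at h2; exact h2)
  rwa [← hP.num_eq, ← hP.den_eq]

theorem eq_of_three_thousand_twenty_five {x y z : ℤ} {s t : ℕ} (hz : z = 5 ^ s * 11 ^ t)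
    (hyz : IsCoprime y z) (hy : IsCoprime y 55) (h2 : 2 ∣ y)
    (h : x ^ 2 + 55 * 3025 ^ 2 * z ^ 6 = y ^ 3) : z = 1 ∧ y = 1226 := by
  obtain ⟨P₀, h₀⟩ := exists_hasCoords (D := 55 * 3025 ^ 2) (x := -36599) (y := 1226) (z := 1)
    (by norm_num) (by norm_num) isCoprime_one_right (by norm_num)
  obtain ⟨P, hP⟩ := exists_hasCoords (by norm_num) (by rw [hz]; positivity) hyz h
  obtain ⟨m, rfl⟩ := mem_zmultiples_of_hasCoords (by norm_num) (by norm_num) h₀ (by norm_num)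
    (u := 47) (v := -7) (by norm_num) (by norm_num)
    (isCoprime_num_of_triple
      (fun Q h => absurd h
        (not_dvd_num_of_pow_six_not_dvd prime_five (by norm_num) (by norm_num) Q))
      (fun Q h => absurd h
        (not_dvd_num_of_pow_six_not_dvd prime_eleven (by norm_num) (by norm_num) Q)))
    (D := 503284375) (B := 218) (M := 1) (by norm_num) (by norm_num) (by norm_num) (by norm_num)
    (by decide +kernel) P (by rwa [hP.num_eq])
  have := num_eq_of_even_three_thousand_twenty_five h₀ (m := m) (s := s) (t := t)
    (hP.den_eq.trans hz) (by rw [← hP.num_eq] at h2; exact h2)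
  rwa [← hP.num_eq, ← hP.den_eq]

theorem false_of_hundred_twenty_one {x y z : ℤ} {s t : ℕ} (hz : z = 5 ^ s * 11 ^ t)
    (hyz : IsCoprime y z) (hy : IsCoprime y 55) (h : x ^ 2 + 55 * 121 ^ 2 * z ^ 6 = y ^ 3) :
    False := by
  obtain ⟨P₀, h₀⟩ := exists_hasCoords (D := 55 * 121 ^ 2) (x := -94203937) (y := 589274) (z := 79)
    (by norm_num) (by norm_num) (Int.isCoprime_iff_gcd_eq_one.2 (by norm_num)) (by norm_num)
  obtain ⟨P, hP⟩ := exists_hasCoords (by norm_num) (by rw [hz]; positivity) hyz h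
  obtain ⟨m, rfl⟩ := mem_zmultiples_of_hasCoords (by norm_num) (by norm_num) h₀ (by norm_num)
    (u := 689) (v := -185) (by norm_num) (by norm_num)
    (isCoprime_num_of_triple
      (fun Q h => absurd h (not_dvd_num_of_sq_not_dvd prime_five (by norm_num) (by norm_num) Q))
      (fun Q h => absurd h
        (not_dvd_num_of_pow_six_not_dvd prime_eleven (by norm_num) (by norm_num) Q)))
    (D := 805255) (B := 1272) (M := 4) (by norm_num) (by norm_num) (by norm_num) (by norm_num)
    (by decide +kernel) P (by rwa [hP.num_eq])
  have h79 : Prime (79 : ℤ) := by norm_num [Int.prime_iff_natAbs_prime]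
  have := dvd_den_zsmul (P := P₀) (by norm_num) h79 (by rw [h₀.den_eq]) m
  rw [hP.den_eq, hz] at this
  rcases h79.dvd_or_dvd this with h' | h' <;> have := h79.dvd_of_dvd_pow h' <;> norm_num at this

theorem mem_zmultiples_of_two_hundred_seventy_five {P₀ P : (mordellCurve (55 * 275 ^ 2)).Point}
    (h₀ : HasCoords P₀ 281666 (-50879411) 41) (hP : IsCoprime (num P) 55) :
    P ∈ AddSubgroup.zmultiples P₀ := by
  have hD : (0 : ℤ) < 55 * 275 ^ 2 := by norm_num
  have h5 : ∀ Q : (mordellCurve (55 * 275 ^ 2)).Point, ¬ 5 ∣ num Q :=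
    not_dvd_num_of_pow_six_not_dvd prime_five (by norm_num) (by norm_num)
  have h11 : ∀ Q : (mordellCurve (55 * 275 ^ 2)).Point,
      IsCoprime (num Q) 55 ↔ ¬ 11 ∣ num Q := fun Q => by
    rw [isCoprime_fiftyfive_iff_not_dvd, and_iff_right (h5 Q)]
  have h1 : HasCoords ((1 : ℤ) • P₀) 281666 (-50879411) 41 := by rwa [one_zsmul]
  have h2 : HasCoords ((2 : ℤ) • P₀) 867669688560007424 808156241145811045139848093 17240131 :=
    h1.double (by norm_num) (by norm_num) (Int.isCoprime_iff_gcd_eq_one.2 (by norm_num))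
      (by norm_num) (by norm_num) (by norm_num)
  rw [two_zsmul] at h2
  have h2c : IsCoprime (num (P₀ + P₀)) 55 := by
    rw [h2.num_eq]
    exact Int.isCoprime_iff_gcd_eq_one.2 (by norm_num)
  have step : ∀ P : (mordellCurve (55 * 275 ^ 2)).Point, IsCoprime (num P) 55 → ∃ Q,
      (P = Q + Q + Q ∨ P + (P₀ + P₀) = Q + Q + Q ∨ P - (P₀ + P₀) = Q + Q + Q) ∧
        IsCoprime (num Q) 55 := by
    intro P hP
    obtain ⟨Q, h, hQ⟩ := exists_eq_triple_mod_of_hasCoords (by norm_num) (by norm_num) h2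
      (by norm_num) (u := -1485987746) (v := 151508726) (by norm_num) (by norm_num) P hP
    refine ⟨Q, h, (h11 Q).2 fun h' => (h11 _).1 hQ ?_⟩
    exact dvd_num_triple prime_eleven (by norm_num) hD (D' := 3125) (by norm_num) (by norm_num) Q h'
  have reduced : ∀ Q : (mordellCurve (55 * 275 ^ 2)).Point, ¬ 11 ∣ num Q →
      num Q ^ 9 ≤ 576 * 1728 ^ 2 * num (Q + Q + Q) := fun Q hQ =>
    num_pow_nine_le hD Q (isCoprime_num_of_fiftyfive (by norm_num) (by norm_num) ((h11 Q).2 hQ))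
  have add3 : ∀ Q R : (mordellCurve (55 * 275 ^ 2)).Point,
      (Q + R) + (Q + R) + (Q + R) = (Q + Q + Q) + (R + R + R) := fun Q R => by abel
  refine mem_zmultiples_of_descent (B := 2044) (C := 576 * 1728 ^ 2) (c := 11)
    (H := fun Q => IsCoprime (num Q) 55 ∨ IsCoprime (num (Q - P₀)) 55)
    (μ := fun Q => if 11 ∣ num Q then num Q / 11 else num Q) hD (fun Q => ?_) (by norm_num)
    (fun Q => ?_) (fun Q _ => ?_) ?_ (by norm_num) (by rw [h₀.num_eq]; norm_num) ?_ P (Or.inl hP)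
  · have := num_pos hD Q
    split_ifs <;> omega
  · have := num_pos hD Q
    split_ifs <;> omega
  · split_ifs with h
    · obtain ⟨A, hA⟩ := h
      have hA' : num Q / 11 = A := by omega
      rw [hA']
      refine pow_nine_le_of_num_eq hD Q (by norm_num) hA (D' := 3125) (by norm_num) ?_
      rw [show (3125 : ℤ) = 5 ^ 5 by norm_num]
      refine IsCoprime.pow_right (isCoprime_comm.1 (prime_five.coprime_iff_not_dvd.2 fun h => ?_))
      exact h5 Q (hA ▸ h.mul_left 11)
    · exact reduced Q h
  · rintro Q (hQ | hQ)
    · obtain ⟨R, h | h | h, hR⟩ := step Q hQ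
      · exact ⟨R, Or.inl hR, Or.inl h⟩
      · refine ⟨R - P₀, Or.inr ?_, Or.inr (Or.inr ?_)⟩
        · rw [show R - P₀ - P₀ = R + -(P₀ + P₀) by abel]
          exact isCoprime_num_add (by norm_num) hR (isCoprime_num_neg h2c)
        · rw [sub_eq_add_neg R, add3, ← h]
          abel
      · refine ⟨R + P₀, Or.inr (by rwa [add_sub_cancel_right]), Or.inr (Or.inl ?_)⟩
        rw [add3, ← h]
        abel
    · obtain ⟨R, h | h | h, hR⟩ := step _ hQ
      · exact ⟨R, Or.inl hR, Or.inr (Or.inr h)⟩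
      · refine ⟨R, Or.inl hR, Or.inr (Or.inl ?_)⟩
        rw [← h]
        abel
      · refine ⟨R + P₀, Or.inr (by rwa [add_sub_cancel_right]), Or.inl ?_⟩
        rw [add3, ← h]
        abel
  · intro Q _ hQ
    by_cases hQ0 : Q = 0
    · rw [hQ0]
      exact zero_mem _
    exfalso
    obtain ⟨c, e, hc, he, h⟩ := exists_nat_coords (D := 4159375) (by norm_num) hD hQ0
    simp only [hc] at hQ
    split_ifs at hQ with h'
    · obtain ⟨A, rfl⟩ : 11 ∣ c := by exact_mod_cast h'
      have hA : A < 2044 := by omega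
      have hM : e < 12 := lt_of_mul_pow_six_le (B := 11 * 2044) (by norm_num) (by omega) h.2.1
      exact Bool.false_ne_true (searchPoints_spec (R := fun _ _ => false) (D := 4159375)
        (q := 11) (M := 12) (B := 2044) (by decide +kernel) e hM A hA h)
    · have hcB : c < 2044 := by omega
      have hM : e < 4 := lt_of_mul_pow_six_le (B := 2044) (by norm_num) hcB h.2.1
      exact Bool.false_ne_true (searchPoints_spec (R := fun _ _ => false) (D := 4159375)
        (q := 1) (M := 4) (B := 2044) (by decide +kernel) e hM c hcB (by rwa [one_mul]))

theorem false_of_two_hundred_seventy_five {x y z : ℤ} {s t : ℕ} (hz : z = 5 ^ s * 11 ^ t)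
    (hyz : IsCoprime y z) (hy : IsCoprime y 55) (h : x ^ 2 + 55 * 275 ^ 2 * z ^ 6 = y ^ 3) :
    False := by
  obtain ⟨P₀, h₀⟩ := exists_hasCoords (D := 55 * 275 ^ 2) (x := -50879411) (y := 281666) (z := 41)
    (by norm_num) (by norm_num) (Int.isCoprime_iff_gcd_eq_one.2 (by norm_num)) (by norm_num)
  obtain ⟨P, hP⟩ := exists_hasCoords (by norm_num) (by rw [hz]; positivity) hyz h
  obtain ⟨m, rfl⟩ := mem_zmultiples_of_two_hundred_seventy_five h₀ (P := P) (by rwa [hP.num_eq])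
  have h41 : Prime (41 : ℤ) := by norm_num [Int.prime_iff_natAbs_prime]
  have := dvd_den_zsmul (P := P₀) (by norm_num) h41 (by rw [h₀.den_eq]) m
  rw [hP.den_eq, hz] at this
  rcases h41.dvd_or_dvd this with h' | h' <;> have := h41.dvd_of_dvd_pow h' <;> norm_num at this

end mordellCurve

theorem not_three_dvd_five_pow_mul_eleven_pow (s t : ℕ) : ¬ (3 : ℤ) ∣ 5 ^ s * 11 ^ t := by
  intro h
  rcases Int.prime_three.dvd_or_dvd h with h | h <;>
    have := Int.prime_three.dvd_of_dvd_pow h <;> norm_num at this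

theorem odd_five_pow_mul_eleven_pow (s t : ℕ) : Odd ((5 : ℤ) ^ s * 11 ^ t) :=
  (Odd.pow (by decide)).mul (Odd.pow (by decide))

theorem eq_zero_of_five_pow_mul_eleven_pow {s t : ℕ} (h : (5 : ℤ) ^ s * 11 ^ t = 1) :
    s = 0 ∧ t = 0 := by
  have h' : 5 ^ s * 11 ^ t = 1 := by exact_mod_cast h
  obtain ⟨h1, h2⟩ := mul_eq_one.1 h'
  exact ⟨by simpa using h1, by simpa using h2⟩

/-- The solutions of `x ^ 2 + 5 ^ (2 * (A + 3 * s) + 1) * 11 ^ (2 * (B + 3 * t) + 1) = y ^ 3`. -/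
theorem eq_of_sq_add_eq_cube {x y : ℤ} {A B s t : ℕ} (hA : A < 3) (hB : B < 3) (hx : Odd x)
    (hy : 0 < y) (hcop : IsCoprime x y)
    (h : x ^ 2 + 5 ^ (2 * (A + 3 * s) + 1) * 11 ^ (2 * (B + 3 * t) + 1) = y ^ 3) :
    s = 0 ∧ t = 0 ∧ ((A = 0 ∧ B = 0 ∧ (y = 4 ∨ y = 56)) ∨ (A = 1 ∧ B = 0 ∧ y = 14) ∨
      (A = 2 ∧ B = 2 ∧ y = 1226)) := by
  obtain ⟨k, hk⟩ : ∃ k : ℤ, k = 5 ^ A * 11 ^ B := ⟨_, rfl⟩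
  obtain ⟨z, hz⟩ : ∃ z : ℤ, z = 5 ^ s * 11 ^ t := ⟨_, rfl⟩
  have hN : x ^ 2 + 55 * k ^ 2 * z ^ 6 = y ^ 3 := by
    rw [← h, hk, hz]
    ring
  have hcopN : IsCoprime y (55 * k ^ 2 * z ^ 6) := by
    obtain ⟨a, b, hab⟩ := hcop.symm.pow_right (n := 2)
    exact ⟨a + b * y ^ 2, -b, by linear_combination hab - b * hN⟩
  have hy55 : IsCoprime y 55 := hcopN.of_isCoprime_of_dvd_right ⟨k ^ 2 * z ^ 6, by ring⟩
  have hyk : IsCoprime y k := hcopN.of_isCoprime_of_dvd_right ⟨55 * k * z ^ 6, by ring⟩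
  have hyz : IsCoprime y z := hcopN.of_isCoprime_of_dvd_right ⟨55 * k ^ 2 * z ^ 5, by ring⟩
  have hzodd : Odd z := hz ▸ odd_five_pow_mul_eleven_pow s t
  have hkodd : Odd k := hk ▸ odd_five_pow_mul_eleven_pow A B
  have hz3 : ¬ 3 ∣ z := hz ▸ not_three_dvd_five_pow_mul_eleven_pow s t
  have h2 : 2 ∣ y := by
    refine Int.prime_two.dvd_of_dvd_pow (n := 3) (even_iff_two_dvd.1 ?_)
    rw [← hN]
    exact hx.pow.add_odd (((by decide : Odd (55 : ℤ)).mul hkodd.pow).mul hzodd.pow)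
  have hst : z = 1 → s = 0 ∧ t = 0 := fun h' => eq_zero_of_five_pow_mul_eleven_pow (hz ▸ h')
  have mod_nine : (k : ZMod 9) = 2 ∨ (k : ZMod 9) = -2 → False := fun h9 =>
    false_of_sq_add_mul_pow_six hy h9 hkodd hzodd hz3 hx hyk hyz hN
  interval_cases A <;> interval_cases B <;> norm_num at hk <;> subst hk
  · obtain ⟨h1, h4⟩ := mordellCurve.eq_of_one hz hyz hy55 h2 hN
    exact ⟨(hst h1).1, (hst h1).2, Or.inl ⟨rfl, rfl, h4⟩⟩
  · exact (mod_nine (Or.inl (by decide))).elim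
  · exact (mordellCurve.false_of_hundred_twenty_one hz hyz hy55 hN).elim
  · obtain ⟨h1, h4⟩ := mordellCurve.eq_of_five hz hyz hy55 h2 hN
    exact ⟨(hst h1).1, (hst h1).2, Or.inr (Or.inl ⟨rfl, rfl, h4⟩)⟩
  · refine (false_of_sq_add_cube (x := x) (y := y) (m := 55 * z ^ 2) (p := 2 * s + 1)
      (q := 2 * t + 1) ?_ (by omega) (by omega) (hy55.mul_right hyz.pow_right) ?_ (by linear_combination hN)).elim
    · rw [hz]
      ring
    · rintro rfl
      exact absurd hx (by decide)
  · exact (mod_nine (Or.inl (by decide))).elim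
  · exact (mod_nine (Or.inr (by decide))).elim
  · exact (mordellCurve.false_of_two_hundred_seventy_five hz hyz hy55 hN).elim
  · obtain ⟨h1, h4⟩ := mordellCurve.eq_of_three_thousand_twenty_five hz hyz hy55 h2 hN
    exact ⟨(hst h1).1, (hst h1).2, Or.inr (Or.inr ⟨rfl, rfl, h4⟩)⟩

theorem exists_eq_two_mul_add_three_mul {a : ℕ} (ha : Odd a) :
    ∃ A s, A < 3 ∧ a = 2 * (A + 3 * s) + 1 := by
  obtain ⟨m, rfl⟩ := ha
  exact ⟨m % 3, m / 3, Nat.mod_lt _ (by norm_num), by omega⟩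

theorem solutions_n_eq_3 (x y a b : ℕ) (hx : 0 < x) (hy : 0 < y)
    (hgcd : Nat.gcd x y = 1) (ha : Odd a) (hb : Odd b) (hxodd : Odd x) :
    x ^ 2 + 5 ^ a * 11 ^ b = y ^ 3 ↔
      (a, b, x, y) = (1, 1, 3, 4) ∨ (a, b, x, y) = (1, 1, 419, 56) ∨
      (a, b, x, y) = (3, 1, 37, 14) ∨ (a, b, x, y) = (5, 5, 36599, 1226) := by
  simp only [Prod.mk.injEq]
  constructor
  · intro h
    obtain ⟨A, s, hA, rfl⟩ := exists_eq_two_mul_add_three_mul ha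
    obtain ⟨B, t, hB, rfl⟩ := exists_eq_two_mul_add_three_mul hb
    obtain ⟨rfl, rfl, h'⟩ := eq_of_sq_add_eq_cube (x := x) (y := y) (s := s) (t := t) hA hB
      (by exact_mod_cast hxodd) (by exact_mod_cast hy) (Nat.isCoprime_iff_coprime.2 hgcd)
      (by exact_mod_cast h)
    have root : ∀ c : ℕ, x ^ 2 = c ^ 2 → x = c := fun c hc =>
      Nat.pow_left_injective two_ne_zero hc
    rcases h' with ⟨rfl, rfl, hy | hy⟩ | ⟨rfl, rfl, hy⟩ | ⟨rfl, rfl, hy⟩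
    · obtain rfl : y = 4 := by exact_mod_cast hy
      have := root 3 (by norm_num at h ⊢; omega)
      omega
    · obtain rfl : y = 56 := by exact_mod_cast hy
      have := root 419 (by norm_num at h ⊢; omega)
      omega
    · obtain rfl : y = 14 := by exact_mod_cast hy
      have := root 37 (by norm_num at h ⊢; omega)
      omega
    · obtain rfl : y = 1226 := by exact_mod_cast hy
      have := root 36599 (by norm_num at h ⊢; omega)
      omega
  · rintro (⟨rfl, rfl, rfl, rfl⟩ | ⟨rfl, rfl, rfl, rfl⟩ | ⟨rfl, rfl, rfl, rfl⟩ |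
      ⟨rfl, rfl, rfl, rfl⟩) <;> norm_num
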